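/- arXiv:2512.24158 — 2 statements merged into one kernel-verified Lean document; each statement's English description precedes it below -/
import Mathlib

section
/- Let n > 8, let S̃_n be Schur's double cover of S_n with projection π, and let g ∈ S̃_n with k = k(g) the order of π(g). Assume π(g) has a cycle of length 3 and a cycle of length 5, and every other cycle of π(g) (fixed points counted as cycles of length 1) has length divisible by neither 3 nor 5. Then 15 divides k and there exists an irreducible spin representation (ρ, V) of S̃_n with dim_ℂ V = (n−2)·2^{⌊(n−2)/2⌋} whose minimal polynomial p(X) at g satisfies p(X) · (X^{k/15} − ε_g) = X^k − ε_g. -/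
/-!
Schur's double cover `S̃_N` of the symmetric group, presented by generators
`z, t_1, …, t_{N-1}` and relations `z² = 1`, `t_i² = z`, `(t_i t_{i+1})³ = z`,
`(t_i t_j)² = z` for `|i − j| ≥ 2`.

Generators are indexed by `Option (Fin (N-1))`: `none` is the central element `z`
and `some i` is `t_{i+1}` (so `some i` for `i = 0, …, N-2` are `t_1, …, t_{N-1}`).
-/

abbrev SchurGen (N : ℕ) := Option (Fin (N - 1))

namespace Schur

/-- The relator `z` as an element of the free group. -/
def zf (N : ℕ) : FreeGroup (SchurGen N) := FreeGroup.of none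

/-- The generator `t_{i+1}` as an element of the free group. -/
def tf (N : ℕ) (i : Fin (N - 1)) : FreeGroup (SchurGen N) := FreeGroup.of (some i)

/-- The defining relators of Schur's double cover. -/
def rels (N : ℕ) : Set (FreeGroup (SchurGen N)) :=
  { r | r = zf N ^ 2 ∨
        (∃ i, r = tf N i ^ 2 * (zf N)⁻¹) ∨
        (∃ i j : Fin (N - 1), (i : ℕ) + 1 = (j : ℕ) ∧
          r = (tf N i * tf N j) ^ 3 * (zf N)⁻¹) ∨
        (∃ i j : Fin (N - 1), ((i : ℕ) + 2 ≤ (j : ℕ) ∨ (j : ℕ) + 2 ≤ (i : ℕ)) ∧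
          r = (tf N i * tf N j) ^ 2 * (zf N)⁻¹) }

/-- Schur's double cover `S̃_N` of the symmetric group `S_N`. -/
abbrev Cover (N : ℕ) := PresentedGroup (rels N)

/-- The central element `z` of `S̃_N`. -/
def z (N : ℕ) : Cover N := PresentedGroup.of none

/-- The generator `t_{i+1}` of `S̃_N` (0-indexed). -/
def t (N : ℕ) (i : Fin (N - 1)) : Cover N := PresentedGroup.of (some i)

/-- The generator `t_i` of `S̃_N`, 1-indexed: meaningful for `1 ≤ i ≤ N-1`
(junk value `1` outside this range). -/
def T (N i : ℕ) : Cover N := if h : i - 1 < N - 1 then t N ⟨i - 1, h⟩ else 1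

/-- The product `t_a t_{a+1} ⋯ t_{a+n-1}` (`n` consecutive generators, 1-indexed). -/
def P (N a n : ℕ) : Cover N := ((List.range n).map fun j => T N (a + j)).prod

end Schur

/-- The adjacent transposition `(i, i+1)` of `{1, …, n}`: in 0-indexed terms, for
`i : Fin (n-1)` this is the swap of `i` and `i+1` in `Fin n`.  It is the image of the
generator `t_{i+1}` under the canonical projection `S̃_n → S_n`. -/
def Schur.adj (n : ℕ) (i : Fin (n - 1)) : Equiv.Perm (Fin n) :=
  Equiv.swap ⟨i.1, by have := i.2; omega⟩ ⟨i.1 + 1, by have := i.2; omega⟩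

/-- Anticommuting involutions `e i`: the images of an orthonormal basis in a Clifford module. -/
structure IsClifford {ι S : Type} [AddCommGroup S] [Module ℂ S]
    (e : ι → Module.End ℂ S) : Prop where
  sq : ∀ i, e i * e i = 1
  anti : ∀ i j, i ≠ j → e i * e j = -(e j * e i)

section Involution

variable {S : Type} [AddCommGroup S] [Module ℂ S]

theorem finrank_eq_two_mul_of_anticomm [FiniteDimensional ℂ S] (N u : Module.End ℂ S)
    (hN : N * N = 1) (hu : u * N = -(N * u)) {c : ℂ} (hc : c ≠ 0) (huu : u * u = c • 1) :
    Module.finrank ℂ S = 2 * Module.finrank ℂ (LinearMap.ker (N - 1)) := by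
  have hN' : ∀ x, N (N x) = x := fun x => by simpa using LinearMap.congr_fun hN x
  have hu' : ∀ x, u (N x) = -(N (u x)) := fun x => by simpa using LinearMap.congr_fun hu x
  have huu' : ∀ x, u (u x) = c • x := fun x => by simpa using LinearMap.congr_fun huu x
  have hinj : Function.Injective u := by
    rw [← LinearMap.ker_eq_bot, LinearMap.ker_eq_bot']
    intro x hx
    have := huu' x
    rw [hx, map_zero] at this
    exact (smul_eq_zero.1 this.symm).resolve_left hc
  have h1 : Module.finrank ℂ (LinearMap.ker (N - 1)) ≤ Module.finrank ℂ (LinearMap.ker (N + 1)) := by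
    refine LinearMap.finrank_le_finrank_of_injective
      (f := u.restrict (p := LinearMap.ker (N - 1)) (q := LinearMap.ker (N + 1)) ?_) ?_
    · intro x hx
      simp only [LinearMap.mem_ker, LinearMap.sub_apply, LinearMap.add_apply, Module.End.one_apply,
        sub_eq_zero] at hx ⊢
      have := hu' x
      rw [hx] at this
      rw [add_comm]
      exact eq_neg_iff_add_eq_zero.1 this
    · intro x y hxy
      exact Subtype.ext (hinj (congrArg Subtype.val hxy))
  have h2 : Module.finrank ℂ (LinearMap.ker (N + 1)) ≤ Module.finrank ℂ (LinearMap.ker (N - 1)) := by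
    refine LinearMap.finrank_le_finrank_of_injective
      (f := u.restrict (p := LinearMap.ker (N + 1)) (q := LinearMap.ker (N - 1)) ?_) ?_
    · intro x hx
      simp only [LinearMap.mem_ker, LinearMap.sub_apply, LinearMap.add_apply, Module.End.one_apply,
        sub_eq_zero] at hx ⊢
      have := hu' x
      rw [eq_neg_of_add_eq_zero_left hx] at this
      simpa using this.symm
    · intro x y hxy
      exact Subtype.ext (hinj (congrArg Subtype.val hxy))
  have h3 : IsCompl (LinearMap.ker (N - 1)) (LinearMap.ker (N + 1)) := by
    constructor
    · rw [Submodule.disjoint_def]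
      intro x hx hy
      simp only [LinearMap.mem_ker, LinearMap.sub_apply, LinearMap.add_apply, Module.End.one_apply,
        sub_eq_zero] at hx hy
      rw [hx, ← two_smul ℂ] at hy
      simpa using hy
    · rw [codisjoint_iff, Submodule.eq_top_iff']
      intro x
      rw [Submodule.mem_sup]
      refine ⟨(1 / 2 : ℂ) • (x + N x), ?_, (1 / 2 : ℂ) • (x - N x), ?_, ?_⟩
      · simp [hN', add_comm]
      · simp [hN']
      · module
  have := Submodule.finrank_add_eq_of_isCompl h3
  omega

end Involution

theorem IsClifford.two_pow_le_finrank (m : ℕ) : ∀ {S : Type} [AddCommGroup S] [Module ℂ S]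
    [FiniteDimensional ℂ S] [Nontrivial S] (e : Fin m → Module.End ℂ S), IsClifford e →
    2 ^ (m / 2) ≤ Module.finrank ℂ S := by
  induction m using Nat.twoStepInduction with
  | zero => intro S _ _ _ _ e _; simpa using Nat.succ_le_of_lt (Module.finrank_pos (R := ℂ) (M := S))
  | one => intro S _ _ _ _ e _; simpa using Nat.succ_le_of_lt (Module.finrank_pos (R := ℂ) (M := S))
  | more m ih _ =>
    intro S _ _ _ _ e he
    set a := e (Fin.last _) with ha
    set b := e (Fin.castSucc (Fin.last _)) with hb
    have hab : a * b = -(b * a) := he.anti _ _ (by simp [Fin.ext_iff])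
    have haa : a * a = 1 := he.sq _
    have hbb : b * b = 1 := he.sq _
    set N : Module.End ℂ S := Complex.I • (a * b) with hNdef
    have hN : N * N = 1 := by
      have : a * b * (a * b) = -1 := by
        calc a * b * (a * b) = a * (b * a) * b := by noncomm_ring
          _ = a * (-(a * b)) * b := by rw [hab, neg_neg]
          _ = -((a * a) * (b * b)) := by noncomm_ring
          _ = -1 := by rw [haa, hbb]; simp
      rw [hNdef, smul_mul_smul_comm, this]; simp
    have hu : a * N = -(N * a) := by
      rw [hNdef, mul_smul_comm, smul_mul_assoc, ← smul_neg]
      congr 1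
      calc a * (a * b) = a * -(b * a) := by rw [hab]
        _ = -(a * b * a) := by noncomm_ring
    have hdim := finrank_eq_two_mul_of_anticomm N a hN hu one_ne_zero (by simpa using haa)
    have hcomm : ∀ i : Fin m, ∀ x ∈ LinearMap.ker (N - 1),
        e i.castSucc.castSucc x ∈ LinearMap.ker (N - 1) := by
      intro i x hx
      have h1 : e i.castSucc.castSucc * a = -(a * e i.castSucc.castSucc) :=
        he.anti _ _ (by simp only [ne_eq, Fin.ext_iff, Fin.val_castSucc, Fin.val_last]; omega)
      have h2 : e i.castSucc.castSucc * b = -(b * e i.castSucc.castSucc) :=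
        he.anti _ _ (by simp only [ne_eq, Fin.ext_iff, Fin.val_castSucc, Fin.val_last]; omega)
      have h3 : e i.castSucc.castSucc * N = N * e i.castSucc.castSucc := by
        rw [hNdef, mul_smul_comm, smul_mul_assoc]
        congr 1
        rw [← mul_assoc, h1, neg_mul, mul_assoc, h2]; simp [mul_assoc]
      simp only [LinearMap.mem_ker, LinearMap.sub_apply, Module.End.one_apply, sub_eq_zero] at hx ⊢
      have := LinearMap.congr_fun h3 x
      simp only [Module.End.mul_apply] at this
      rw [← this, hx]
    have : Nontrivial (LinearMap.ker (N - 1)) := by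
      rw [← Module.finrank_pos_iff (R := ℂ)]
      have := Module.finrank_pos (R := ℂ) (M := S)
      omega
    have key := ih (S := LinearMap.ker (N - 1))
      (fun i => (e i.castSucc.castSucc).restrict (hcomm i))
      ⟨fun i => by
          ext x
          simpa using LinearMap.congr_fun (he.sq i.castSucc.castSucc) x.1,
        fun i j hij => by
          ext x
          simpa using LinearMap.congr_fun (he.anti i.castSucc.castSucc j.castSucc.castSucc
            (by simpa [Fin.ext_iff] using hij)) x.1⟩
    rw [hdim, show (m + 2) / 2 = m / 2 + 1 by omega, pow_succ]
    omega

theorem exists_isClifford (m : ℕ) : ∃ (S : Type) (_ : AddCommGroup S) (_ : Module ℂ S)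
    (_ : FiniteDimensional ℂ S) (e : Fin m → Module.End ℂ S), IsClifford e ∧
    Module.finrank ℂ S = 2 ^ (m / 2) := by
  induction m using Nat.twoStepInduction with
  | zero => exact ⟨ℂ, inferInstance, inferInstance, inferInstance, fun _ => 1,
      ⟨fun i => i.elim0, fun i => i.elim0⟩, by simp⟩
  | one => exact ⟨ℂ, inferInstance, inferInstance, inferInstance, fun _ => 1,
      ⟨fun i => by simp, fun i j h => absurd (Subsingleton.elim i j) h⟩, by simp⟩
  | more m ih _ =>
    obtain ⟨S, _, _, _, e, he, hS⟩ := ih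
    let a : Module.End ℂ (S × S) := (LinearMap.snd ℂ S S).prod (LinearMap.fst ℂ S S)
    let b : Module.End ℂ (S × S) :=
      (-(Complex.I • LinearMap.snd ℂ S S)).prod (Complex.I • LinearMap.fst ℂ S S)
    let f : Fin m → Module.End ℂ (S × S) := fun i => (e i).prodMap (-(e i))
    refine ⟨S × S, inferInstance, inferInstance, inferInstance,
      Fin.snoc (α := fun _ => Module.End ℂ (S × S))
        (Fin.snoc (α := fun _ => Module.End ℂ (S × S)) f a) b, ?_, ?_⟩
    · have haa : a * a = 1 := by ext x <;> simp [a]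
      have hbb : b * b = 1 := by ext x <;> simp [b, smul_smul]
      have hab : a * b = -(b * a) := by ext x <;> simp [a, b]
      have hff : ∀ i, f i * f i = 1 := fun i => by
        have := fun x => LinearMap.congr_fun (he.sq i) x
        simp only [Module.End.mul_apply, Module.End.one_apply] at this
        ext x <;> simp [f, this]
      have hfg : ∀ i j, i ≠ j → f i * f j = -(f j * f i) := fun i j hij => by
        have := fun x => LinearMap.congr_fun (he.anti i j hij) x
        simp only [Module.End.mul_apply, LinearMap.neg_apply] at this
        ext x <;> simp [f, this]
      have hfa : ∀ i, f i * a = -(a * f i) := fun i => by ext x <;> simp [f, a]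
      have hfb : ∀ i, f i * b = -(b * f i) := fun i => by ext x <;> simp [f, b]
      constructor
      · intro i
        refine Fin.lastCases ?_ (fun i => ?_) i
        · simpa using hbb
        · refine Fin.lastCases ?_ (fun i => ?_) i
          · simpa using haa
          · simpa using hff i
      · intro i j
        refine Fin.lastCases ?_ (fun i => ?_) i <;> refine Fin.lastCases ?_ (fun j => ?_) j
        · simp
        · refine Fin.lastCases ?_ (fun j => ?_) j
          · intro; simp [hab]
          · intro; simp [hfb]
        · refine Fin.lastCases ?_ (fun i => ?_) i
          · intro; simp [hab]
          · intro; simp [hfb]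
        · refine Fin.lastCases ?_ (fun i => ?_) i <;> refine Fin.lastCases ?_ (fun j => ?_) j
          · simp
          · intro; simp [hfa]
          · intro; simp [hfa]
          · intro h
            simpa using hfg i j (by simpa [Fin.ext_iff] using h)
    · rw [Module.finrank_prod, hS, show (m + 2) / 2 = m / 2 + 1 by omega]
      ring

section Irreducible

variable {S : Type} [AddCommGroup S] [Module ℂ S] [FiniteDimensional ℂ S] {n : ℕ}
  {e : Fin n → Module.End ℂ S}

theorem IsClifford.eq_top_of_invariant (he : IsClifford e)
    (hS : Module.finrank ℂ S = 2 ^ (n / 2)) (W : Submodule ℂ S) (hW : W ≠ ⊥)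
    (hinv : ∀ i, ∀ x ∈ W, e i x ∈ W) : W = ⊤ := by
  have : Nontrivial W := Submodule.nontrivial_iff_ne_bot.2 hW
  apply Submodule.eq_top_of_finrank_eq
  apply le_antisymm (Submodule.finrank_le W)
  rw [hS]
  exact IsClifford.two_pow_le_finrank n (fun i => (e i).restrict (hinv i))
      ⟨fun i => by
          ext x
          simpa using LinearMap.congr_fun (he.sq i) x.1,
        fun i j hij => by
          ext x
          simpa using LinearMap.congr_fun (he.anti i j hij) x.1⟩

theorem IsClifford.eq_smul_of_commute [Nontrivial S] (he : IsClifford e)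
    (hS : Module.finrank ℂ S = 2 ^ (n / 2)) (X : Module.End ℂ S)
    (hX : ∀ i, X * e i = e i * X) : ∃ s : ℂ, X = s • 1 := by
  obtain ⟨s, hs⟩ := Module.End.exists_eigenvalue X
  refine ⟨s, ?_⟩
  have := he.eq_top_of_invariant hS (Module.End.eigenspace X s) hs (by
    intro i x hx
    rw [Module.End.mem_eigenspace_iff] at hx ⊢
    have := LinearMap.congr_fun (hX i) x
    simp only [Module.End.mul_apply] at this
    rw [this, hx, map_smul])
  ext x
  have hx : x ∈ Module.End.eigenspace X s := by rw [this]; trivial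
  simpa using Module.End.mem_eigenspace_iff.1 hx

end Irreducible

section CliffordRelations

variable {R : Type} [Ring R]

theorem mul_mul_eq_eight {a b c : R} (ha : a * a = 1) (hb : b * b = 1) (hc : c * c = 1)
    (hba : b * a = -(a * b)) (hca : c * a = -(a * c)) (hcb : c * b = -(b * c)) :
    ((a - b) * (b - c)) ^ 3 = 8 := by
  have ha' : ∀ x, a * (a * x) = x := fun x => by rw [← mul_assoc, ha, one_mul]
  have hb' : ∀ x, b * (b * x) = x := fun x => by rw [← mul_assoc, hb, one_mul]
  have hc' : ∀ x, c * (c * x) = x := fun x => by rw [← mul_assoc, hc, one_mul]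
  have hba' : ∀ x, b * (a * x) = -(a * (b * x)) := fun x => by
    rw [← mul_assoc, hba, neg_mul, mul_assoc]
  have hca' : ∀ x, c * (a * x) = -(a * (c * x)) := fun x => by
    rw [← mul_assoc, hca, neg_mul, mul_assoc]
  have hcb' : ∀ x, c * (b * x) = -(b * (c * x)) := fun x => by
    rw [← mul_assoc, hcb, neg_mul, mul_assoc]
  have h1 : (a - b) * (b - c) = -1 + (a * b + b * c - a * c) := by
    simp only [mul_sub, sub_mul, hb]; abel
  have h2 : (a * b + b * c - a * c) * (a * b + b * c - a * c) = -3 := by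
    simp only [mul_sub, sub_mul, mul_add, add_mul, mul_assoc, ha, hb, hc, hba, hcb, ha', hb',
      hba', hca', hcb', mul_neg, neg_neg, mul_one]
    have : (3 : R) = 1 + 1 + 1 := by norm_num
    rw [this]; abel
  rw [h1]
  set L := a * b + b * c - a * c
  have h3 : (-1 + L) ^ 3 = -1 + 3 * L - 3 * (L * L) + (L * L) * L := by noncomm_ring
  rw [h3, h2, neg_mul, mul_neg, sub_neg_eq_add]
  generalize 3 * L = y
  have h4 : -1 + y + 3 * 3 + -y = -1 + 3 * 3 := by abel
  rw [h4]; norm_num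

end CliffordRelations

namespace IsClifford

variable {S : Type} [AddCommGroup S] [Module ℂ S] {n : ℕ} {e : Fin n → Module.End ℂ S}

theorem sub_mul_sub_self (he : IsClifford e) {p q : Fin n} (h : p ≠ q) :
    (e p - e q) * (e p - e q) = (2 : ℂ) • 1 := by
  simp only [mul_sub, sub_mul, he.sq, he.anti q p h.symm, two_smul]; abel

theorem sub_mul_eq (he : IsClifford e) {p q : Fin n} (h : p ≠ q) (j : Fin n) :
    (e p - e q) * e j = -(e (Equiv.swap p q j) * (e p - e q)) := by
  rcases eq_or_ne j p with rfl | hp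
  · rw [Equiv.swap_apply_left]; simp only [mul_sub, sub_mul, he.sq]; abel
  rcases eq_or_ne j q with rfl | hq
  · rw [Equiv.swap_apply_right]; simp only [mul_sub, sub_mul, he.sq]; abel
  · rw [Equiv.swap_apply_of_ne_of_ne hp hq]
    simp only [mul_sub, sub_mul, he.anti p j hp.symm, he.anti q j hq.symm]; abel

end IsClifford

section SpinHom

open Schur

variable {S : Type} [AddCommGroup S] [Module ℂ S] {n : ℕ} {e : Fin n → Module.End ℂ S}

/-- The image of `t_{i+1}` in a Clifford module. -/
noncomputable def spinGen (e : Fin n → Module.End ℂ S) (δ : ℂ) (i : Fin (n - 1)) :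
    Module.End ℂ S :=
  δ • (e ⟨i.1, by have := i.2; omega⟩ - e ⟨i.1 + 1, by have := i.2; omega⟩)

theorem spinGen_mul_self (he : IsClifford e) {δ : ℂ} (hδ : δ * δ = -1 / 2) (i : Fin (n - 1)) :
    spinGen e δ i * spinGen e δ i = -1 := by
  rw [spinGen, smul_mul_smul_comm, he.sub_mul_sub_self (by simp [Fin.ext_iff]), hδ, smul_smul]
  norm_num

theorem spinGen_braid (he : IsClifford e) {δ : ℂ} (hδ : δ * δ = -1 / 2) (i j : Fin (n - 1))
    (hij : (i : ℕ) + 1 = j) : (spinGen e δ i * spinGen e δ j) ^ 3 = -1 := by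
  obtain ⟨i, hi⟩ := i
  obtain ⟨j, hj⟩ := j
  obtain rfl : i + 1 = j := hij
  have := mul_mul_eq_eight (he.sq ⟨i, by omega⟩) (he.sq ⟨i + 1, by omega⟩)
    (he.sq ⟨i + 1 + 1, by omega⟩)
    (he.anti _ _ (by simp [Fin.ext_iff])) (he.anti _ _ (by simp only [ne_eq, Fin.ext_iff]; omega))
    (he.anti _ _ (by simp [Fin.ext_iff]))
  simp only [spinGen]
  rw [smul_mul_smul_comm, smul_pow, this, hδ]
  have h8 : (8 : Module.End ℂ S) = (8 : ℂ) • 1 := by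
    rw [← Algebra.algebraMap_eq_smul_one, map_ofNat]
  rw [h8, smul_smul]
  norm_num

theorem spinGen_far (he : IsClifford e) {δ : ℂ} (hδ : δ * δ = -1 / 2) (i j : Fin (n - 1))
    (hij : (i : ℕ) + 2 ≤ j ∨ (j : ℕ) + 2 ≤ i) : (spinGen e δ i * spinGen e δ j) ^ 2 = -1 := by
  have h1 : spinGen e δ i * spinGen e δ j = -(spinGen e δ j * spinGen e δ i) := by
    simp only [spinGen]
    rw [smul_mul_smul_comm, smul_mul_smul_comm, ← smul_neg]
    congr 1
    rw [mul_sub, he.sub_mul_eq (by simp [Fin.ext_iff]), he.sub_mul_eq (by simp [Fin.ext_iff]),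
      Equiv.swap_apply_of_ne_of_ne, Equiv.swap_apply_of_ne_of_ne]
    · noncomm_ring
    all_goals simp only [ne_eq, Fin.ext_iff]; omega
  calc (spinGen e δ i * spinGen e δ j) ^ 2
      = spinGen e δ i * (spinGen e δ j * spinGen e δ i) * spinGen e δ j := by
        rw [pow_two]; noncomm_ring
    _ = spinGen e δ i * (-(spinGen e δ i * spinGen e δ j)) * spinGen e δ j := by rw [h1, neg_neg]
    _ = -((spinGen e δ i * spinGen e δ i) * (spinGen e δ j * spinGen e δ j)) := by noncomm_ring
    _ = -1 := by rw [spinGen_mul_self he hδ, spinGen_mul_self he hδ]; simp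

theorem exists_spinHom (he : IsClifford e) {δ : ℂ} (hδ : δ * δ = -1 / 2) :
    ∃ φ : Cover n →* Module.End ℂ S, φ (z n) = -1 ∧ ∀ i, φ (t n i) = spinGen e δ i := by
  let f : SchurGen n → (Module.End ℂ S)ˣ := fun o => match o with
    | none => -1
    | some i => ⟨spinGen e δ i, -spinGen e δ i, by rw [mul_neg, spinGen_mul_self he hδ, neg_neg],
        by rw [neg_mul, spinGen_mul_self he hδ, neg_neg]⟩
  have hf : ∀ r ∈ rels n, FreeGroup.lift f r = 1 := by
    rintro r (rfl | ⟨i, rfl⟩ | ⟨i, j, hij, rfl⟩ | ⟨i, j, hij, rfl⟩)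
    · simp [zf, f]
    · rw [map_mul, map_inv, mul_inv_eq_one]
      ext1
      simp [zf, tf, f, pow_two, spinGen_mul_self he hδ]
    · rw [map_mul, map_inv, mul_inv_eq_one]
      ext1
      simp [zf, tf, f, spinGen_braid he hδ i j hij]
    · rw [map_mul, map_inv, mul_inv_eq_one]
      ext1
      simp [zf, tf, f, spinGen_far he hδ i j hij]
  refine ⟨(Units.coeHom _).comp (PresentedGroup.toGroup hf), ?_, fun i => ?_⟩
  · simp [z, f]
  · simp [t, f]

theorem Schur.Cover.induction {p : Cover n → Prop} (hz : p (z n)) (ht : ∀ i, p (t n i))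
    (h1 : p 1) (hmul : ∀ g h, p g → p h → p (g * h)) (hinv : ∀ g, p g → p g⁻¹) (g : Cover n) :
    p g := by
  have hg : g ∈ Subgroup.closure (Set.range (PresentedGroup.of (rels := rels n))) := by
    rw [PresentedGroup.closure_range_of]; trivial
  induction hg using Subgroup.closure_induction with
  | mem x hx =>
    obtain ⟨o, rfl⟩ := hx
    cases o with
    | none => exact hz
    | some i => exact ht i
  | one => exact h1
  | mul x y _ _ hx hy => exact hmul x y hx hy
  | inv x _ hx => exact hinv x hx

theorem spinHom_mul (he : IsClifford e) {δ : ℂ} {φ : Cover n →* Module.End ℂ S}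
    (hz : φ (z n) = -1) (ht : ∀ i, φ (t n i) = spinGen e δ i) {π : Cover n →* Equiv.Perm (Fin n)}
    (hπt : ∀ i : Fin (n - 1), π (t n i) = adj n i) (hπz : π (z n) = 1) (g : Cover n) :
    ∀ j, φ g * e j = ((Equiv.Perm.sign (π g) : ℤ) : ℂ) • (e (π g j) * φ g) := by
  induction g using Schur.Cover.induction with
  | hz => intro j; simp [hz, hπz]
  | ht i =>
    intro j
    rw [ht, hπt, spinGen, adj, smul_mul_assoc, he.sub_mul_eq (by simp [Fin.ext_iff]),
      Equiv.Perm.sign_swap (by simp [Fin.ext_iff])]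
    simp
  | h1 => intro j; simp
  | hmul g h hg hh =>
    intro j
    rw [map_mul, mul_assoc, hh, mul_smul_comm, ← mul_assoc, hg, smul_mul_assoc, smul_smul, map_mul,
      map_mul, mul_assoc]
    simp [mul_comm]
  | hinv g hg =>
    intro j
    have h1 := hg ((π g)⁻¹ j)
    rw [← Equiv.Perm.mul_apply, mul_inv_cancel, Equiv.Perm.one_apply] at h1
    have hl : φ g⁻¹ * φ g = 1 := by rw [← map_mul]; simp
    have hr : φ g * φ g⁻¹ = 1 := by rw [← map_mul]; simp
    have h2 : e ((π g)⁻¹ j) * φ g⁻¹ = ((Equiv.Perm.sign (π g) : ℤ) : ℂ) • (φ g⁻¹ * e j) := by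
      calc e ((π g)⁻¹ j) * φ g⁻¹ = φ g⁻¹ * (φ g * e ((π g)⁻¹ j)) * φ g⁻¹ := by
            rw [← mul_assoc, hl, one_mul]
        _ = _ := by
            rw [h1, mul_smul_comm, smul_mul_assoc]
            rw [mul_assoc, mul_assoc, hr, mul_one]
    rw [map_inv π, map_inv Equiv.Perm.sign, h2, smul_smul]
    rcases Int.units_eq_one_or (Equiv.Perm.sign (π g)) with h | h <;> simp [h]

theorem spinHom_det_pow_four {δ : ℂ} (he : IsClifford e) (hδ : δ * δ = -1 / 2)
    {φ : Cover n →* Module.End ℂ S}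
    (hz : φ (z n) = -1) (ht : ∀ i, φ (t n i) = spinGen e δ i) (g : Cover n) :
    LinearMap.det (φ g) ^ 4 = 1 := by
  have hm : LinearMap.det (-1 : Module.End ℂ S) ^ 2 = 1 := by
    rw [← map_pow]; simp
  induction g using Schur.Cover.induction with
  | hz => rw [hz, show 4 = 2 * 2 from rfl, pow_mul, hm, one_pow]
  | ht i =>
    rw [ht, show 4 = 2 * 2 from rfl, pow_mul, ← map_pow, pow_two (spinGen e δ i),
      spinGen_mul_self he hδ, hm]
  | h1 => simp
  | hmul g h hg hh => rw [map_mul, map_mul, mul_pow, hg, hh, one_mul]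
  | hinv g hg =>
    have : LinearMap.det (φ g⁻¹) ^ 4 * LinearMap.det (φ g) ^ 4 = 1 := by
      rw [← mul_pow, ← map_mul, ← map_mul]; simp
    rwa [hg, mul_one] at this

theorem Schur.Cover.surjective_of_adj {π : Cover n →* Equiv.Perm (Fin n)}
    (hπt : ∀ i : Fin (n - 1), π (t n i) = adj n i) : Function.Surjective π := by
  cases n with
  | zero => intro σ; exact ⟨1, Subsingleton.elim _ _⟩
  | succ m =>
    intro σ
    have hσ : σ ∈ Submonoid.closure (Set.range fun i : Fin m => Equiv.swap i.castSucc i.succ) := by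
      rw [Equiv.Perm.mclosure_swap_castSucc_succ]; trivial
    suffices h : Submonoid.closure (Set.range fun i : Fin m => Equiv.swap i.castSucc i.succ) ≤
        MonoidHom.mrange π from h hσ
    rw [Submonoid.closure_le]
    rintro _ ⟨i, rfl⟩
    exact ⟨t (m + 1) i, by rw [hπt]; rfl⟩

theorem Equiv.Perm.exists_apply_eq_pair {α : Type} [DecidableEq α] {a b p q : α} (hab : a ≠ b)
    (hpq : p ≠ q) : ∃ σ : Equiv.Perm α, σ a = p ∧ σ b = q := by
  refine ⟨Equiv.swap (Equiv.swap a p b) q * Equiv.swap a p, ?_, by simp⟩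
  rw [Equiv.Perm.mul_apply, Equiv.swap_apply_left, Equiv.swap_apply_of_ne_of_ne _ hpq]
  intro h
  rw [← Equiv.swap_apply_left a p] at h
  exact hab ((Equiv.swap a p).injective (by rwa [Equiv.swap_apply_left] at h ⊢))

theorem exists_lift_swap (hn : 2 ≤ n) (he : IsClifford e) {δ : ℂ} (hδ : δ * δ = -1 / 2)
    {φ : Cover n →* Module.End ℂ S}
    (hz : φ (z n) = -1) (ht : ∀ i, φ (t n i) = spinGen e δ i) {π : Cover n →* Equiv.Perm (Fin n)}
    (hπt : ∀ i : Fin (n - 1), π (t n i) = adj n i) (hπz : π (z n) = 1) {p q : Fin n} (hpq : p ≠ q) :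
    ∃ (h : Cover n) (s : ℂ), s ≠ 0 ∧ π h = Equiv.swap p q ∧ φ h = s • (e p - e q) := by
  have hδ0 : δ ≠ 0 := by rintro rfl; norm_num at hδ
  obtain ⟨σ, hσp, hσq⟩ := Equiv.Perm.exists_apply_eq_pair
    (a := (⟨0, by omega⟩ : Fin n)) (b := ⟨0 + 1, by omega⟩) (by simp [Fin.ext_iff]) hpq
  obtain ⟨h, rfl⟩ := Schur.Cover.surjective_of_adj hπt σ
  refine ⟨h * t n ⟨0, by omega⟩ * h⁻¹, ((Equiv.Perm.sign (π h) : ℤ) : ℂ) * δ, ?_, ?_, ?_⟩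
  · refine mul_ne_zero ?_ hδ0
    rcases Int.units_eq_one_or (Equiv.Perm.sign (π h)) with h | h <;> simp [h]
  · rw [map_mul, map_mul, hπt, adj, map_inv, ← hσp, ← hσq, Equiv.swap_apply_apply]
  · have hr : φ h * φ h⁻¹ = 1 := by rw [← map_mul]; simp
    have hm := spinHom_mul he hz ht hπt hπz h
    rw [map_mul, map_mul, ht, spinGen, mul_smul_comm, smul_mul_assoc, mul_sub, hm, hm, hσp, hσq,
      ← smul_sub, ← sub_mul, smul_mul_assoc, mul_assoc, hr, mul_one, smul_smul, mul_comm]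

end SpinHom

section CyclicElement

variable {R : Type} [Ring R] [Algebra ℂ R]

theorem cyclic_sum_mul_self {a b c : R} (ha : a * a = 1) (hb : b * b = 1) (hc : c * c = 1)
    (hba : b * a = -(a * b)) (hca : c * a = -(a * c)) (hcb : c * b = -(b * c)) :
    (a * b + b * c + c * a) * (a * b + b * c + c * a) = (-3 : ℂ) • 1 := by
  have ha' : ∀ x, a * (a * x) = x := fun x => by rw [← mul_assoc, ha, one_mul]
  have hb' : ∀ x, b * (b * x) = x := fun x => by rw [← mul_assoc, hb, one_mul]
  have hba' : ∀ x, b * (a * x) = -(a * (b * x)) := fun x => by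
    rw [← mul_assoc, hba, neg_mul, mul_assoc]
  have hca' : ∀ x, c * (a * x) = -(a * (c * x)) := fun x => by
    rw [← mul_assoc, hca, neg_mul, mul_assoc]
  have hcb' : ∀ x, c * (b * x) = -(b * (c * x)) := fun x => by
    rw [← mul_assoc, hcb, neg_mul, mul_assoc]
  rw [hca]
  simp only [mul_neg, neg_mul, mul_add, add_mul, mul_assoc, ha, hb, hc, hba, hcb, ha', hb',
    hba', hca', hcb', neg_neg, mul_one]
  module

end CyclicElement

section CyclicOperator

variable {S : Type} [AddCommGroup S] [Module ℂ S] {n : ℕ}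

/-- The Clifford operator inducing the 3-cycle `p ↦ q ↦ r ↦ p`; its cube is `1`. -/
noncomputable def cyc (e : Fin n → Module.End ℂ S) (p q r : Fin n) : Module.End ℂ S :=
  (1 / 2 : ℂ) • (e p * e q + e q * e r + e r * e p - 1)

variable {e : Fin n → Module.End ℂ S}

theorem cyc_rotate (p q r : Fin n) : cyc e q r p = cyc e p q r := by
  unfold cyc; congr 2; abel

theorem IsClifford.two_cyc (he : IsClifford e) {p q r : Fin n} (hpr : p ≠ r) :
    (e p - e q) * (e q - e r) = (2 : ℂ) • cyc e p q r := by
  rw [cyc, smul_smul, he.anti r p hpr.symm]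
  simp only [mul_sub, sub_mul, he.sq]
  module

theorem IsClifford.cyc_swap (he : IsClifford e) {p q r : Fin n} (hpq : p ≠ q) (hpr : p ≠ r)
    (hqr : q ≠ r) : cyc e p r q = (-1 : ℂ) • (1 : Module.End ℂ S) - cyc e p q r := by
  rw [cyc, cyc, he.anti r q hqr.symm, he.anti q p hpq.symm, he.anti r p hpr.symm]
  module

theorem IsClifford.cyc_mul_self (he : IsClifford e) {p q r : Fin n} (hpq : p ≠ q) (hpr : p ≠ r)
    (hqr : q ≠ r) : cyc e p q r * cyc e p q r = cyc e p r q := by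
  rw [he.cyc_swap hpq hpr hqr]
  have h := cyclic_sum_mul_self (he.sq p) (he.sq q) (he.sq r) (he.anti q p hpq.symm)
    (he.anti r p hpr.symm) (he.anti r q hqr.symm)
  unfold cyc
  set L := e p * e q + e q * e r + e r * e p
  rw [smul_mul_smul_comm, sub_mul, mul_sub, h]
  simp only [mul_one, one_mul]
  module

theorem IsClifford.cyc_cube (he : IsClifford e) {p q r : Fin n} (hpq : p ≠ q) (hpr : p ≠ r)
    (hqr : q ≠ r) : cyc e p q r * (cyc e p q r * cyc e p q r) = 1 := by
  have h := he.cyc_mul_self hpq hpr hqr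
  rw [he.cyc_swap hpq hpr hqr] at h
  rw [h, mul_sub, h]
  simp only [mul_smul_comm, mul_one]
  module

theorem IsClifford.one_add_cyc (he : IsClifford e) {p q r : Fin n} (hpq : p ≠ q) (hpr : p ≠ r)
    (hqr : q ≠ r) : 1 + cyc e p q r + cyc e p q r * cyc e p q r = 0 := by
  rw [he.cyc_mul_self hpq hpr hqr, he.cyc_swap hpq hpr hqr]
  module

theorem IsClifford.cyc_mul_fst (he : IsClifford e) {p q r : Fin n} (hpq : p ≠ q) :
    cyc e p q r * e p = e q * cyc e p q r := by
  have h1 : ∀ x, e q * (e q * x) = x := fun x => by rw [← mul_assoc, he.sq, one_mul]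
  unfold cyc
  rw [smul_mul_assoc, mul_smul_comm]
  congr 1
  simp only [sub_mul, mul_sub, add_mul, mul_add, mul_assoc, he.sq, h1, he.anti q p hpq.symm,
    mul_neg, mul_one]
  rw [← mul_assoc (e p), he.sq, ← mul_assoc (e q) (e p), he.anti q p hpq.symm, neg_mul, mul_assoc,
    he.sq]
  simp only [mul_one, one_mul]
  abel

theorem IsClifford.cyc_mul_snd (he : IsClifford e) {p q r : Fin n} (hqr : q ≠ r) :
    cyc e p q r * e q = e r * cyc e p q r := by
  rw [← cyc_rotate]; exact he.cyc_mul_fst hqr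

theorem IsClifford.cyc_mul_trd (he : IsClifford e) {p q r : Fin n} (hpr : p ≠ r) :
    cyc e p q r * e r = e p * cyc e p q r := by
  rw [← cyc_rotate]; exact he.cyc_mul_snd hpr.symm

theorem IsClifford.cyc_mul_other (he : IsClifford e) {p q r s : Fin n} (hp : s ≠ p) (hq : s ≠ q)
    (hr : s ≠ r) : cyc e p q r * e s = e s * cyc e p q r := by
  have h : ∀ i j, s ≠ i → s ≠ j → e i * e j * e s = e s * (e i * e j) := fun i j hi hj => by
    rw [mul_assoc, he.anti j s hj.symm, mul_neg, ← mul_assoc, he.anti i s hi.symm]; noncomm_ring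
  unfold cyc
  rw [smul_mul_assoc, mul_smul_comm]
  simp only [sub_mul, add_mul, mul_add, mul_sub, h p q hp hq, h q r hq hr, h r p hr hp, mul_one,
    one_mul]

theorem mul_cyc_of_mul {X : Module.End ℂ S} {σ : Equiv.Perm (Fin n)} {χ : ℂ} (hχ : χ * χ = 1)
    (hX : ∀ j, X * e j = χ • (e (σ j) * X)) (p q r : Fin n) :
    X * cyc e p q r = cyc e (σ p) (σ q) (σ r) * X := by
  have h : ∀ i j, X * (e i * e j) = e (σ i) * e (σ j) * X := fun i j => by
    rw [← mul_assoc, hX, smul_mul_assoc, mul_assoc, hX, mul_smul_comm, smul_smul, hχ, one_smul,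
      mul_assoc]
  unfold cyc
  rw [mul_smul_comm, smul_mul_assoc]
  simp only [mul_sub, mul_add, sub_mul, add_mul, h, mul_one, one_mul]

end CyclicOperator

section SumOperator

variable {S : Type} [AddCommGroup S] [Module ℂ S] {n : ℕ}

/-- The involution attached to the projection of the `j`-th basis vector to the sum-zero
hyperplane. -/
noncomputable def projInv (e : Fin n → Module.End ℂ S) (κ : ℂ) (j : Fin n) : Module.End ℂ S :=
  κ • ((∑ i, e i) * e j - 1)

variable {e : Fin n → Module.End ℂ S}

theorem IsClifford.sum_mul (he : IsClifford e) (j : Fin n) :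
    (∑ i, e i) * e j = (2 : ℂ) • 1 - e j * ∑ i, e i := by
  rw [Finset.sum_mul, Finset.mul_sum, ← Finset.add_sum_erase _ _ (Finset.mem_univ j),
    ← Finset.add_sum_erase _ (fun i => e j * e i) (Finset.mem_univ j),
    Finset.sum_congr rfl (fun i hi => he.anti i j (Finset.ne_of_mem_erase hi)), he.sq,
    Finset.sum_neg_distrib]
  module

theorem IsClifford.sum_mul_sum (he : IsClifford e) :
    (∑ i, e i) * (∑ i, e i) = (n : ℂ) • 1 := by
  have h : (∑ i, e i) * (∑ i, e i) = (2 * n : ℂ) • 1 - (∑ i, e i) * (∑ i, e i) := by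
    conv_lhs => rw [Finset.mul_sum]
    simp_rw [he.sum_mul]
    rw [Finset.sum_sub_distrib, ← Finset.sum_mul, Finset.sum_const]
    simp only [Finset.card_univ, Fintype.card_fin]
    module
  have h2 : (2 : ℂ) • ((∑ i, e i) * (∑ i, e i)) = (2 * n : ℂ) • 1 := by
    nth_rw 1 [two_smul, h]; abel
  have h3 := congrArg (fun x => (1 / 2 : ℂ) • x) h2
  simp only [smul_smul] at h3
  rw [show (1 / 2 * 2 : ℂ) = 1 by norm_num, one_smul, one_div,
    inv_mul_cancel_left₀ two_ne_zero] at h3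
  exact h3

theorem IsClifford.sum_mul_mul (he : IsClifford e) (i j : Fin n) :
    (∑ k, e k) * e i * ((∑ k, e k) * e j) =
      (2 : ℂ) • ((∑ k, e k) * e j) - (n : ℂ) • (e i * e j) := by
  set u := ∑ k, e k with hu
  have h1 : e i * u = (2 : ℂ) • 1 - u * e i := by rw [he.sum_mul]; abel
  calc u * e i * (u * e j) = u * (e i * u) * e j := by noncomm_ring
    _ = (2 : ℂ) • (u * e j) - (u * u) * (e i * e j) := by
      rw [h1, mul_sub, sub_mul]; simp only [mul_smul_comm, mul_one, smul_mul_assoc, mul_assoc]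
    _ = _ := by rw [he.sum_mul_sum]; simp

theorem IsClifford.inv_mul_self (he : IsClifford e) {κ : ℂ} (hκ : κ * κ * (n - 1) = -1)
    (j : Fin n) : projInv e κ j * projInv e κ j = 1 := by
  have h := he.sum_mul_mul j j
  rw [projInv, smul_mul_smul_comm, mul_sub, sub_mul, h, he.sq, mul_one, one_mul]
  have : (1 : Module.End ℂ S) = (-(κ * κ * (n - 1))) • 1 := by rw [hκ]; simp
  conv_rhs => rw [this]
  module

theorem IsClifford.inv_mul_add (he : IsClifford e) {κ : ℂ} {i j : Fin n} (hij : i ≠ j) :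
    projInv e κ i * projInv e κ j + projInv e κ j * projInv e κ i = (2 * (κ * κ)) • 1 := by
  simp only [projInv, smul_mul_smul_comm, mul_sub, sub_mul, he.sum_mul_mul, mul_one, one_mul,
    he.anti j i hij.symm]
  module

theorem IsClifford.sum_mul_inv (he : IsClifford e) (κ : ℂ) (j : Fin n) :
    (∑ i, e i) * projInv e κ j = -(projInv e κ j * ∑ i, e i) := by
  rw [projInv, mul_smul_comm, smul_mul_assoc, ← smul_neg]
  congr 1
  have h1 : e j * (∑ i, e i) = (2 : ℂ) • 1 - (∑ i, e i) * e j := by rw [he.sum_mul]; abel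
  rw [mul_sub, sub_mul, mul_assoc _ (e j), h1, mul_sub]
  simp only [mul_smul_comm, mul_one, one_mul]
  module

variable {κ : ℂ}

theorem inv_apply_eq_iff (hκ : κ ≠ 0) (j : Fin n) (x : S) :
    projInv e κ j x = x ↔ (∑ i, e i) (e j x) = (1 + κ⁻¹) • x := by
  simp only [projInv, LinearMap.smul_apply, LinearMap.sub_apply, Module.End.mul_apply,
    Module.End.one_apply]
  rw [← smul_right_injective S (inv_ne_zero hκ) |>.eq_iff]
  simp only [smul_smul, inv_mul_cancel₀ hκ, one_smul]
  rw [sub_eq_iff_eq_add, add_smul, one_smul, add_comm]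

theorem IsClifford.eq_zero_of_inv_apply (he : IsClifford e) (hκ : κ * κ * (n - 1) = -1) {i j : Fin n}
    (hij : i ≠ j) {s : ℂ} (hs : s * s = 1) {x : S} (hi : projInv e κ i x = s • x)
    (hj : projInv e κ j x = s • x) : x = 0 := by
  have h := LinearMap.congr_fun (he.inv_mul_add (κ := κ) hij) x
  simp only [LinearMap.add_apply, Module.End.mul_apply, hi, hj, map_smul, smul_smul, hs, one_smul,
    LinearMap.smul_apply, Module.End.one_apply] at h
  have h2 : (2 - 2 * (κ * κ)) • x = 0 := by rw [sub_smul, ← h]; module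
  refine (smul_eq_zero.1 h2).resolve_left fun h3 => ?_
  have hn : (n : ℂ) = 0 := by linear_combination hκ + (n - 1) / 2 * h3
  have : n = 0 := by exact_mod_cast hn
  subst this
  exact i.elim0

theorem IsClifford.apply_eq_smul_sum (he : IsClifford e) (hκ : κ ≠ 0) (hn : n ≠ 0) {j : Fin n}
    {x : S} (hx : projInv e κ j x = x) : e j x = ((1 + κ⁻¹) / n) • (∑ i, e i) x := by
  rw [inv_apply_eq_iff hκ] at hx
  have h := LinearMap.congr_fun he.sum_mul_sum (e j x)
  simp only [Module.End.mul_apply, hx, map_smul, LinearMap.smul_apply, Module.End.one_apply] at h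
  have hn' : (n : ℂ) ≠ 0 := by exact_mod_cast hn
  rw [div_eq_inv_mul, ← smul_smul, h, smul_smul, inv_mul_cancel₀ hn', one_smul]

end SumOperator

section SpinLift

variable {S : Type} [AddCommGroup S] [Module ℂ S] {n : ℕ}

open Schur

/-- A representation `φ` of Schur's double cover on a Clifford module, compatible with the
action of the symmetric group on the Clifford generators. -/
structure IsSpinLift (e : Fin n → Module.End ℂ S) (φ : Cover n →* Module.End ℂ S)
    (π : Cover n →* Equiv.Perm (Fin n)) : Prop where
  clifford : IsClifford e
  map_z : φ (z n) = -1
  map_mul : ∀ g j, φ g * e j = ((Equiv.Perm.sign (π g) : ℤ) : ℂ) • (e (π g j) * φ g)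
  exists_swap : ∀ p q, p ≠ q →
    ∃ (h : Cover n) (s : ℂ), s ≠ 0 ∧ π h = Equiv.swap p q ∧ φ h = s • (e p - e q)
  det_pow_four : ∀ g, LinearMap.det (φ g) ^ 4 = 1
  surjective : Function.Surjective π

theorem perm_sign_mul_self (σ : Equiv.Perm (Fin n)) :
    ((Equiv.Perm.sign σ : ℤ) : ℂ) * ((Equiv.Perm.sign σ : ℤ) : ℂ) = 1 := by
  rcases Int.units_eq_one_or (Equiv.Perm.sign σ) with h | h <;> simp [h]

variable {e : Fin n → Module.End ℂ S} {φ : Cover n →* Module.End ℂ S}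
  {π : Cover n →* Equiv.Perm (Fin n)}

theorem IsSpinLift.mul_sum (h : IsSpinLift e φ π) (g : Cover n) :
    φ g * ∑ i, e i = ((Equiv.Perm.sign (π g) : ℤ) : ℂ) • ((∑ i, e i) * φ g) := by
  rw [Finset.mul_sum, Finset.sum_mul, Finset.smul_sum,
    ← Equiv.sum_comp (π g) fun i => ((Equiv.Perm.sign (π g) : ℤ) : ℂ) • (e i * φ g)]
  exact Finset.sum_congr rfl fun i _ => h.map_mul g i

theorem IsSpinLift.mul_inv (h : IsSpinLift e φ π) (κ : ℂ) (g : Cover n) (j : Fin n) :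
    φ g * projInv e κ j = projInv e κ (π g j) * φ g := by
  rw [projInv, projInv, mul_smul_comm, smul_mul_assoc]
  congr 1
  rw [mul_sub, sub_mul, ← mul_assoc, h.mul_sum, smul_mul_assoc, mul_assoc, h.map_mul,
    mul_smul_comm, smul_smul, perm_sign_mul_self, one_smul, mul_one, one_mul, mul_assoc]

theorem map_inv_apply_map (g : Cover n) (x : S) : φ g⁻¹ (φ g x) = x := by
  rw [← Module.End.mul_apply, ← map_mul, inv_mul_cancel, map_one, Module.End.one_apply]

/-- The representation on `S ⊗ ℂⁿ` permuting the coordinates. -/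
def permRep (φ : Cover n →* Module.End ℂ S) (π : Cover n →* Equiv.Perm (Fin n)) :
    Cover n →* Module.End ℂ (Fin n → S) where
  toFun g :=
    { toFun := fun x j => φ g (x ((π g)⁻¹ j))
      map_add' := fun x y => by ext j; simp
      map_smul' := fun c x => by ext j; simp }
  map_one' := by ext; simp
  map_mul' g h := by
    refine LinearMap.ext fun x => funext fun j => ?_
    simp

theorem permRep_apply (g : Cover n) (x : Fin n → S) (j : Fin n) :
    permRep φ π g x j = φ g (x ((π g)⁻¹ j)) := rfl

theorem permRep_apply_apply (g : Cover n) (x : Fin n → S) (j : Fin n) :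
    permRep φ π g x (π g j) = φ g (x j) := by simp [permRep_apply]

/-- The subspace of `S ⊗ ℂⁿ` carrying the basic standard representation. -/
def stdSub (e : Fin n → Module.End ℂ S) (κ : ℂ) : Submodule ℂ (Fin n → S) where
  carrier := {x | (∀ j, projInv e κ j (x j) = x j) ∧ ∑ j, x j = 0}
  add_mem' := fun {x y} hx hy => ⟨fun j => by simp [hx.1 j, hy.1 j], by
    simp [Finset.sum_add_distrib, hx.2, hy.2]⟩
  zero_mem' := by simp
  smul_mem' := fun c x hx => ⟨fun j => by simp [hx.1 j], by simp [← Finset.smul_sum, hx.2]⟩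

theorem IsSpinLift.permRep_mem (h : IsSpinLift e φ π) {κ : ℂ} (g : Cover n) {x : Fin n → S}
    (hx : x ∈ stdSub e κ) : permRep φ π g x ∈ stdSub e κ := by
  refine ⟨fun j => ?_, ?_⟩
  · have := LinearMap.congr_fun (h.mul_inv κ g ((π g)⁻¹ j)) (x ((π g)⁻¹ j))
    rw [Module.End.mul_apply, Module.End.mul_apply, hx.1, ← Equiv.Perm.mul_apply, mul_inv_cancel,
      Equiv.Perm.one_apply] at this
    exact this.symm
  · simp only [permRep_apply]
    rw [← map_sum, Equiv.sum_comp (π g)⁻¹ x, hx.2, map_zero]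

theorem projInv_ne_zero {κ : ℂ} (hκ : κ * κ * (n - 1) = -1) : κ ≠ 0 := by
  rintro rfl; norm_num at hκ

theorem mem_ker_sub_one {N : Module.End ℂ S} {x : S} :
    x ∈ LinearMap.ker (N - 1) ↔ N x = x := by
  rw [LinearMap.mem_ker, LinearMap.sub_apply, Module.End.one_apply, sub_eq_zero]

variable [FiniteDimensional ℂ S]

theorem IsClifford.finrank_ker_inv (he : IsClifford e) {κ : ℂ} (hκ : κ * κ * (n - 1) = -1)
    (hn : 2 ≤ n) (hS : Module.finrank ℂ S = 2 ^ (n / 2)) (j : Fin n) :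
    Module.finrank ℂ (LinearMap.ker (projInv e κ j - 1)) = 2 ^ ((n - 2) / 2) := by
  have h := finrank_eq_two_mul_of_anticomm _ _ (he.inv_mul_self hκ j) (he.sum_mul_inv κ j)
    (c := (n : ℂ)) (by exact_mod_cast (by omega : n ≠ 0)) he.sum_mul_sum
  rw [hS, show n / 2 = (n - 2) / 2 + 1 by omega, pow_succ] at h
  omega

theorem IsClifford.finrank_stdSub (he : IsClifford e) {κ : ℂ} (hκ : κ * κ * (n - 1) = -1)
    (hn : 2 ≤ n) (hS : Module.finrank ℂ S = 2 ^ (n / 2)) :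
    Module.finrank ℂ (stdSub e κ) = (n - 2) * 2 ^ ((n - 2) / 2) := by
  let M : Fin n → Submodule ℂ S := fun j => LinearMap.ker (projInv e κ j - 1)
  have hM : ∀ j, Module.finrank ℂ (M j) = 2 ^ ((n - 2) / 2) := he.finrank_ker_inv hκ hn hS
  let Ψ : (∀ j, M j) →ₗ[ℂ] S := ∑ j, (M j).subtype ∘ₗ LinearMap.proj j
  have hΨ : ∀ x, Ψ x = ∑ j, (x j : S) := fun x => by simp [Ψ]
  let J : (∀ j, M j) →ₗ[ℂ] (Fin n → S) := LinearMap.pi fun j => (M j).subtype ∘ₗ LinearMap.proj j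
  have hJ : Function.Injective J := fun x y hxy => funext fun j => Subtype.ext (congrFun hxy j)
  have hK : stdSub e κ = (LinearMap.ker Ψ).map J := by
    ext x
    rw [Submodule.mem_map]
    constructor
    · intro hx
      exact ⟨fun j => ⟨x j, mem_ker_sub_one.2 (hx.1 j)⟩, by simpa [hΨ] using hx.2, rfl⟩
    · rintro ⟨y, hy, rfl⟩
      exact ⟨fun j => mem_ker_sub_one.1 (y j).2, by simpa [hΨ, J] using hy⟩
  have hrange : LinearMap.range Ψ = ⊤ := by
    let i0 : Fin n := ⟨0, by omega⟩
    let i1 : Fin n := ⟨1, by omega⟩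
    have hne : i0 ≠ i1 := by simp [i0, i1, Fin.ext_iff]
    have hle : ∀ j, M j ≤ LinearMap.range Ψ := fun j x hx => by
      refine ⟨Pi.single j ⟨x, hx⟩, ?_⟩
      rw [hΨ, Finset.sum_eq_single j]
      · simp
      · intro b _ hb; simp [Pi.single_eq_of_ne hb]
      · simp
    have hinf : M i0 ⊓ M i1 = ⊥ := by
      rw [eq_bot_iff]
      rintro x ⟨h0, h1⟩
      exact he.eq_zero_of_inv_apply hκ hne (s := 1) (one_mul 1)
        (by rw [one_smul]; exact mem_ker_sub_one.1 h0)
        (by rw [one_smul]; exact mem_ker_sub_one.1 h1)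
    have hsup := Submodule.finrank_sup_add_finrank_inf_eq (M i0) (M i1)
    rw [hinf, finrank_bot, hM, hM] at hsup
    have htop : M i0 ⊔ M i1 = ⊤ := by
      apply Submodule.eq_top_of_finrank_eq
      rw [hS, show n / 2 = (n - 2) / 2 + 1 by omega, pow_succ]
      omega
    exact top_le_iff.1 (htop ▸ sup_le (hle _) (hle _))
  have h1 := LinearMap.finrank_range_add_finrank_ker Ψ
  rw [hrange, finrank_top, hS, Module.finrank_pi_fintype] at h1
  simp only [hM, Finset.sum_const, Finset.card_univ, Fintype.card_fin, smul_eq_mul] at h1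
  rw [hK, ← (Submodule.equivMapOfInjective J hJ (LinearMap.ker Ψ)).finrank_eq, Nat.sub_mul]
  rw [show n / 2 = (n - 2) / 2 + 1 by omega, pow_succ] at h1
  omega

end SpinLift

section Irreducible

variable {S : Type} [AddCommGroup S] [Module ℂ S] {n : ℕ}

open Schur

/-- The vector supported on `{p, q, r}`, invariant under the 3-cycle `p ↦ q ↦ r ↦ p`, with value
`w` at `r`. -/
noncomputable def tri (e : Fin n → Module.End ℂ S) (p q r : Fin n) (w : S) : Fin n → S :=
  fun j => if j = r then w else if j = p then cyc e p q r w else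
    if j = q then cyc e p q r (cyc e p q r w) else 0

variable {e : Fin n → Module.End ℂ S} {p q r : Fin n}

theorem tri_trd (w : S) : tri e p q r w r = w := by simp [tri]

theorem tri_fst (hpr : p ≠ r) (w : S) : tri e p q r w p = cyc e p q r w := by simp [tri, hpr]

theorem tri_snd (hpq : p ≠ q) (hqr : q ≠ r) (w : S) :
    tri e p q r w q = cyc e p q r (cyc e p q r w) := by simp [tri, hqr, hpq.symm]

theorem tri_other {j : Fin n} (hp : j ≠ p) (hq : j ≠ q) (hr : j ≠ r) (w : S) :
    tri e p q r w j = 0 := by simp [tri, hp, hq, hr]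

theorem tri_add (v w : S) : tri e p q r (v + w) = tri e p q r v + tri e p q r w := by
  funext j
  simp only [tri, Pi.add_apply]
  split_ifs <;> simp

theorem tri_smul (c : ℂ) (w : S) : tri e p q r (c • w) = c • tri e p q r w := by
  funext j
  simp only [tri, Pi.smul_apply]
  split_ifs <;> simp

/-- The space of values at `r` of the vectors `tri e p q r w` in `U`. -/
noncomputable def triSub (e : Fin n → Module.End ℂ S) (U : Submodule ℂ (Fin n → S))
    (p q r : Fin n) : Submodule ℂ S where
  carrier := {w | tri e p q r w ∈ U}
  add_mem' := fun {v w} hv hw => by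
    simp only [Set.mem_ofPred_eq, tri_add]; exact U.add_mem hv hw
  zero_mem' := by
    have := tri_smul (e := e) (p := p) (q := q) (r := r) 0 0
    rw [zero_smul, zero_smul] at this
    simp only [Set.mem_ofPred_eq, this]; exact U.zero_mem
  smul_mem' := fun c w hw => by
    simp only [Set.mem_ofPred_eq, tri_smul]; exact U.smul_mem c hw

theorem mem_triSub {U : Submodule ℂ (Fin n → S)} {w : S} :
    w ∈ triSub e U p q r ↔ tri e p q r w ∈ U := Iff.rfl

theorem cyc_eq_ite (he : IsClifford e) (hqr : p = q ∨ p = r ∨ q = r) :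
    cyc e p q r = if p = q ∧ q = r then 1 else 0 := by
  have h1 : ∀ i j, i ≠ j → (1 / 2 : ℂ) • (e i * e j + e j * e i) = 0 := fun i j hij => by
    rw [he.anti i j hij, neg_add_cancel, smul_zero]
  unfold cyc
  by_cases h : p = q
  · subst h
    by_cases h' : p = r
    · subst h'
      simp only [he.sq, and_self, if_true]; module
    · rw [if_neg (by simp [h']), ← h1 p r h', he.sq]; congr 1; abel
  · rw [if_neg (by simp [h]), ← h1 p q h]
    rcases hqr with h' | rfl | rfl
    · exact absurd h' h
    · rw [he.sq]; congr 1; abel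
    · rw [he.sq]; congr 1; abel

theorem IsClifford.sum_cyc (_ : IsClifford e) (p r : Fin n) :
    ∑ q, cyc e p q r =
      (1 / 2 : ℂ) • (e p * ∑ i, e i + (∑ i, e i) * e r + (n : ℂ) • (e r * e p) - (n : ℂ) • 1) := by
  simp only [cyc, ← Finset.smul_sum, Finset.sum_sub_distrib, Finset.sum_add_distrib,
    Finset.sum_const, Finset.card_univ, Fintype.card_fin, Finset.mul_sum, Finset.sum_mul,
    Nat.cast_smul_eq_nsmul]

theorem IsClifford.eq_zero_of_tri_eq_zero (he : IsClifford e) {κ : ℂ} (hκ : κ * κ * (n - 1) = -1)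
    (hn : 2 ≤ n) {x : Fin n → S} (hx : x ∈ stdSub e κ)
    (h : ∀ p q r, p ≠ q → p ≠ r → q ≠ r →
      x p + cyc e p q r (x r) + cyc e p r q (x q) = 0) : x = 0 := by
  funext p
  have hκ0 := projInv_ne_zero hκ
  have hF : ∀ q r, x p + cyc e p q r (x r) + cyc e p r q (x q) =
      ((if p = q then (1 : ℂ) else 0) + (if p = r then 1 else 0) + if q = r then 1 else 0) • x p := by
    intro q r
    by_cases hpq : p = q
    · subst hpq
      rw [cyc_eq_ite he (Or.inl rfl), cyc_eq_ite he (Or.inr (Or.inl rfl))]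
      by_cases hpr : p = r
      · subst hpr; simp; module
      · simp [hpr, Ne.symm hpr]
    by_cases hpr : p = r
    · subst hpr
      rw [cyc_eq_ite he (Or.inr (Or.inl rfl)), cyc_eq_ite he (Or.inl rfl)]
      simp [hpq, Ne.symm hpq]
    by_cases hqr : q = r
    · subst hqr
      rw [cyc_eq_ite he (Or.inr (Or.inr rfl))]
      simp [hpq]
    · rw [h p q r hpq hpr hqr]; simp [hpq, hpr, hqr]
  have hG : ∑ r, (∑ q, cyc e p q r) (x r) = (n : ℂ) • x p := by
    have h1 : ∀ r, (∑ q, cyc e p q r) (x r) = (1 / 2 : ℂ) • ((e p * ∑ i, e i) (x r) +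
        (1 + κ⁻¹) • x r - (n : ℂ) • x r + (n : ℂ) • (if p = r then (2 : ℂ) • x p else 0) -
        ((n : ℂ) * ((1 + κ⁻¹) / n)) • e p ((∑ i, e i) (x r))) := by
      intro r
      rw [he.sum_cyc]
      have h2 := (inv_apply_eq_iff hκ0 r (x r)).1 (hx.1 r)
      have h3 := he.apply_eq_smul_sum hκ0 (by omega) (hx.1 r)
      have h4 : e r (e p (x r)) =
          (if p = r then (2 : ℂ) • x p else 0) - ((1 + κ⁻¹) / n) • e p ((∑ i, e i) (x r)) := by
        rw [← map_smul, ← h3, ← Module.End.mul_apply, ← Module.End.mul_apply]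
        split_ifs with hpr
        · subst hpr; rw [he.sq, Module.End.one_apply]; module
        · rw [he.anti r p (Ne.symm hpr)]; simp
      simp only [LinearMap.smul_apply, LinearMap.sub_apply, LinearMap.add_apply,
        Module.End.mul_apply, Module.End.one_apply, h2, h4]
      module
    simp_rw [h1]
    rw [← Finset.smul_sum]
    simp only [Finset.sum_sub_distrib, Finset.sum_add_distrib, ← Finset.smul_sum, ← map_sum, hx.2,
      map_zero, smul_zero, Finset.sum_ite_eq, Finset.mem_univ, if_true]
    module
  have hsum : ∑ q, ∑ r, (x p + cyc e p q r (x r) + cyc e p r q (x q)) =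
      ((n : ℂ) * n) • x p + (n : ℂ) • x p + (n : ℂ) • x p := by
    simp only [Finset.sum_add_distrib]
    congr 1
    · congr 1
      · simp [← Nat.cast_smul_eq_nsmul ℂ, smul_smul]
      · rw [Finset.sum_comm, ← hG]
        simp only [LinearMap.sum_apply]
    · rw [← hG]
      simp only [LinearMap.sum_apply]
  simp_rw [hF] at hsum
  simp only [← Finset.sum_smul, Finset.sum_add_distrib, Finset.sum_ite_eq, Finset.mem_univ,
    if_true, Finset.sum_const, Finset.card_univ, Fintype.card_fin, nsmul_eq_mul, mul_one] at hsum
  have h5 : ((n : ℂ) * (n - 1)) • x p = 0 := by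
    have : ((n : ℂ) * (n - 1)) • x p = ((n : ℂ) * n) • x p + (n : ℂ) • x p + (n : ℂ) • x p -
      (3 * n : ℂ) • x p := by module
    rw [this, ← hsum]
    simp only [← Finset.mul_sum, Finset.sum_ite_eq, Finset.mem_univ, if_true]
    module
  refine (smul_eq_zero.1 h5).resolve_left ?_
  refine mul_ne_zero (by exact_mod_cast (by omega : n ≠ 0)) fun h6 => ?_
  have : (n : ℂ) = 1 := sub_eq_zero.1 h6
  have : n = 1 := by exact_mod_cast this
  omega

end Irreducible

section Irreducible

variable {S : Type} [AddCommGroup S] [Module ℂ S] {n : ℕ}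

open Schur

variable {e : Fin n → Module.End ℂ S} {φ : Cover n →* Module.End ℂ S}
  {π : Cover n →* Equiv.Perm (Fin n)} {U : Submodule ℂ (Fin n → S)}

theorem IsSpinLift.swap_mem (h : IsSpinLift e φ π) (hU : ∀ g, ∀ x ∈ U, permRep φ π g x ∈ U)
    {p q : Fin n} (hpq : p ≠ q) {x : Fin n → S} (hx : x ∈ U) :
    (fun j => (e p - e q) (x (Equiv.swap p q j))) ∈ U := by
  obtain ⟨g, s, hs, hπ, hφ⟩ := h.exists_swap p q hpq
  have : (fun j => (e p - e q) (x (Equiv.swap p q j))) = s⁻¹ • permRep φ π g x := by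
    funext j
    rw [Pi.smul_apply, permRep_apply, hπ, hφ, Equiv.swap_inv, LinearMap.smul_apply, smul_smul,
      inv_mul_cancel₀ hs, one_smul]
  rw [this]
  exact U.smul_mem _ (hU g x hx)

theorem IsSpinLift.mem_triSub_of_mem (h : IsSpinLift e φ π)
    (hU : ∀ g, ∀ x ∈ U, permRep φ π g x ∈ U)
    {p q r : Fin n} (hpq : p ≠ q) (hpr : p ≠ r) (hqr : q ≠ r) {x : Fin n → S} (hx : x ∈ U) :
    x r + cyc e p q r (x q) + cyc e p q r (cyc e p q r (x p)) ∈ triSub e U p q r := by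
  have he := h.clifford
  set A := cyc e p q r with hA
  have hrot : ∀ y ∈ U, (fun j => A (y (Equiv.swap q r (Equiv.swap p q j)))) ∈ U := by
    intro y hy
    have h1 := h.swap_mem hU hpq (h.swap_mem hU hqr hy)
    have : (fun j => A (y (Equiv.swap q r (Equiv.swap p q j)))) = (1 / 2 : ℂ) • fun j =>
        (e p - e q) ((e q - e r) (y (Equiv.swap q r (Equiv.swap p q j)))) := by
      funext j
      rw [Pi.smul_apply, ← Module.End.mul_apply, he.two_cyc hpr, LinearMap.smul_apply, smul_smul]
      norm_num
      rfl
    rw [this]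
    exact U.smul_mem _ h1
  have h3 : ∀ v, A (A (A v)) = v := fun v => by
    simpa using LinearMap.congr_fun (he.cyc_cube hpq hpr hqr) v
  have h0 : ∀ v, v + A v + A (A v) = 0 := fun v => by
    simpa using LinearMap.congr_fun (he.one_add_cyc hpq hpr hqr) v
  have h1 := U.add_mem (U.add_mem hx (hrot x hx)) (hrot _ (hrot x hx))
  rw [mem_triSub]
  convert h1 using 1
  funext j
  simp only [Pi.add_apply]
  have sp : Equiv.swap q r (Equiv.swap p q p) = r := by simp
  have sq : Equiv.swap q r (Equiv.swap p q q) = p := by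
    rw [Equiv.swap_apply_right, Equiv.swap_apply_of_ne_of_ne hpq hpr]
  have sr : Equiv.swap q r (Equiv.swap p q r) = q := by
    rw [Equiv.swap_apply_of_ne_of_ne hpr.symm hqr.symm, Equiv.swap_apply_right]
  by_cases hjr : j = r
  · subst hjr; rw [tri_trd, sr, sq]
  by_cases hjp : j = p
  · subst hjp; rw [tri_fst hpr, sp, sr, ← hA, map_add, map_add, h3]; abel
  by_cases hjq : j = q
  · subst hjq; rw [tri_snd hpq hqr, sq, sp, ← hA]; simp only [map_add, h3]; abel
  · rw [tri_other hjp hjq hjr, Equiv.swap_apply_of_ne_of_ne hjp hjq,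
      Equiv.swap_apply_of_ne_of_ne hjq hjr, Equiv.swap_apply_of_ne_of_ne hjp hjq,
      Equiv.swap_apply_of_ne_of_ne hjq hjr, h0]

theorem IsSpinLift.map_mem_triSub (h : IsSpinLift e φ π)
    (hU : ∀ g, ∀ x ∈ U, permRep φ π g x ∈ U) {p q r : Fin n} (g : Cover n) {w : S}
    (hw : w ∈ triSub e U p q r) : φ g w ∈ triSub e U (π g p) (π g q) (π g r) := by
  have h1 := hU g _ hw
  rw [mem_triSub]
  convert h1 using 1
  have hc : ∀ v, φ g (cyc e p q r v) = cyc e (π g p) (π g q) (π g r) (φ g v) := fun v =>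
    LinearMap.congr_fun (mul_cyc_of_mul (perm_sign_mul_self (π g)) (h.map_mul g) p q r) v
  funext j
  obtain ⟨i, rfl⟩ := (π g).surjective j
  rw [permRep_apply_apply]
  simp only [tri, (π g).injective.eq_iff]
  split_ifs <;> simp [hc]

theorem IsSpinLift.sub_sub_mem_triSub (h : IsSpinLift e φ π)
    (hU : ∀ g, ∀ x ∈ U, permRep φ π g x ∈ U)
    {p q r s : Fin n} (hpq : p ≠ q) (hpr : p ≠ r) (hqr : q ≠ r) (hsp : s ≠ p) (hsq : s ≠ q)
    (hsr : s ≠ r) {w : S} (hw : w ∈ triSub e U p q r) :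
    e p w + e q w - (2 : ℂ) • e s w ∈ triSub e U p q r := by
  have he := h.clifford
  have h3 : ∀ v, cyc e p q r (cyc e p q r (cyc e p q r v)) = v := fun v => by
    simpa using LinearMap.congr_fun (he.cyc_cube hpq hpr hqr) v
  have c3 : ∀ v, cyc e p q r (e r v) = e p (cyc e p q r v) := fun v =>
    LinearMap.congr_fun (he.cyc_mul_trd hpr) v
  have c1 : ∀ v, cyc e p q r (e p v) = e q (cyc e p q r v) := fun v =>
    LinearMap.congr_fun (he.cyc_mul_fst hpq) v
  have c4 : ∀ v, cyc e p q r (e s v) = e s (cyc e p q r v) := fun v =>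
    LinearMap.congr_fun (he.cyc_mul_other hsp hsq hsr) v
  have h1 := h.mem_triSub_of_mem hU hpq hpr hqr (h.swap_mem hU hsr.symm (mem_triSub.1 hw))
  simp only [Equiv.swap_apply_left, Equiv.swap_apply_of_ne_of_ne hqr hsq.symm,
    Equiv.swap_apply_of_ne_of_ne hpr hsp.symm, tri_other hsp hsq hsr, tri_fst hpr,
    tri_snd hpq hqr, map_zero, LinearMap.sub_apply, map_sub, c3, c1, c4, h3] at h1
  convert h1 using 1
  module

theorem IsSpinLift.sub_mem_triSub (h : IsSpinLift e φ π)
    (hU : ∀ g, ∀ x ∈ U, permRep φ π g x ∈ U)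
    {p q r : Fin n} (hpq : p ≠ q) (hpr : p ≠ r) (hqr : q ≠ r) {w : S}
    (hw : w ∈ triSub e U p q r) : e p w - e q w ∈ triSub e U p q r := by
  have he := h.clifford
  have h3 : ∀ v, cyc e p q r (cyc e p q r (cyc e p q r v)) = v := fun v => by
    simpa using LinearMap.congr_fun (he.cyc_cube hpq hpr hqr) v
  have c3 : ∀ v, cyc e p q r (e r v) = e p (cyc e p q r v) := fun v =>
    LinearMap.congr_fun (he.cyc_mul_trd hpr) v
  have c2 : ∀ v, cyc e p q r (e q v) = e r (cyc e p q r v) := fun v =>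
    LinearMap.congr_fun (he.cyc_mul_snd hqr) v
  have c1 : ∀ v, cyc e p q r (e p v) = e q (cyc e p q r v) := fun v =>
    LinearMap.congr_fun (he.cyc_mul_fst hpq) v
  have d : ∀ a b c : Fin n, a ≠ b → a ≠ c → b ≠ c → ∀ v,
      (e a - e b) (cyc e a b c v) = e b v - e c v := fun a b c hab hac hbc v => by
    have h4 := LinearMap.congr_fun (he.two_cyc hac (q := b)) v
    have h5 := LinearMap.congr_fun (he.sub_mul_sub_self hab) ((e b - e c) v)
    simp only [Module.End.mul_apply] at h4 h5
    rw [h4] at h5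
    simp only [LinearMap.smul_apply, map_smul, Module.End.one_apply] at h5
    have := smul_right_injective S (two_ne_zero (α := ℂ)) h5
    simpa using this
  have d1 : ∀ v, e r (cyc e p q r v) = e p v - e q v + e p (cyc e p q r v) := fun v => by
    have := d r p q hpr.symm hqr.symm hpq v
    rw [← cyc_rotate, LinearMap.sub_apply] at this
    rw [← cyc_rotate, ← cyc_rotate, ← this]
    simp only [cyc_rotate]
    abel
  have d2 : ∀ v, e q (cyc e p q r v) = e r v - e p v + e r (cyc e p q r v) := fun v => by
    have := d q r p hqr hpq.symm hpr.symm v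
    rw [cyc_rotate, LinearMap.sub_apply] at this
    rw [← this]
    abel
  have h1 := h.mem_triSub_of_mem hU hpq hpr hqr (h.swap_mem hU hpq (mem_triSub.1 hw))
  simp only [Equiv.swap_apply_left, Equiv.swap_apply_right,
    Equiv.swap_apply_of_ne_of_ne hpr.symm hqr.symm, tri_trd, tri_fst hpr,
    tri_snd hpq hqr, LinearMap.sub_apply, map_sub, c1, c2, c3, h3] at h1
  have h2 := (triSub e U p q r).smul_mem (1 / 3 : ℂ) h1
  convert h2 using 1
  simp only [d2, d1]
  module

theorem IsSpinLift.triSub_eq [FiniteDimensional ℂ S] (h : IsSpinLift e φ π)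
    (hU : ∀ g, ∀ x ∈ U, permRep φ π g x ∈ U)
    {κ : ℂ} (hκ : κ * κ * (n - 1) = -1) (hn : 2 ≤ n)
    (hS : Module.finrank ℂ S = 2 ^ (n / 2)) (hUK : U ≤ stdSub e κ)
    {p q r : Fin n} (hpq : p ≠ q) (hpr : p ≠ r) (hqr : q ≠ r) (hW : triSub e U p q r ≠ ⊥) {y : S}
    (hy : projInv e κ r y = y) : y ∈ triSub e U p q r := by
  have he := h.clifford
  have hκ0 := projInv_ne_zero hκ
  set W := triSub e U p q r with hWdef
  set u := ∑ i, e i with hu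
  have hWr : ∀ w ∈ W, projInv e κ r w = w := fun w hw => by
    have := (hUK hw).1 r
    rwa [tri_trd] at this
  have huu : ∀ v, u (u v) = (n : ℂ) • v := fun v =>
    LinearMap.congr_fun he.sum_mul_sum v
  have hue : ∀ j v, e j (u v) = (2 : ℂ) • v - u (e j v) := fun j v => by
    have := LinearMap.congr_fun (he.sum_mul j) v
    simp only [Module.End.mul_apply, LinearMap.sub_apply, LinearMap.smul_apply,
      Module.End.one_apply] at this
    rw [← hu] at this
    rw [this]; abel
  have hWW : W ≤ W ⊔ W.map u := le_sup_left
  have huW : ∀ w ∈ W, u w ∈ W ⊔ W.map u := fun w hw =>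
    (le_sup_right : W.map u ≤ _) (Submodule.mem_map_of_mem hw)
  have huT : ∀ v ∈ W ⊔ W.map u, u v ∈ W ⊔ W.map u := by
    intro v hv
    obtain ⟨w, hw, v', hv', rfl⟩ := Submodule.mem_sup.1 hv
    obtain ⟨w', hw', rfl⟩ := Submodule.mem_map.1 hv'
    rw [map_add, huu]
    exact Submodule.add_mem _ (huW w hw) (Submodule.smul_mem _ _ (hWW hw'))
  have her : ∀ w ∈ W, e r w ∈ W ⊔ W.map u := fun w hw => by
    rw [he.apply_eq_smul_sum hκ0 (by omega) (hWr w hw)]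
    exact Submodule.smul_mem _ _ (huW w hw)
  have hs : ∀ s, s ≠ r → ∀ w ∈ W, e p w + e q w - (2 : ℂ) • e s w ∈ W := by
    intro s hsr w hw
    have h1 := h.sub_mem_triSub hU hpq hpr hqr hw
    by_cases hsp : s = p
    · subst hsp
      convert W.neg_mem h1 using 1
      module
    by_cases hsq : s = q
    · subst hsq
      convert h1 using 1
      module
    · exact h.sub_sub_mem_triSub hU hpq hpr hqr hsp hsq hsr hw
  have ha : ∀ w ∈ W, e p w + e q w ∈ W ⊔ W.map u := by
    intro w hw
    have h1 : ∑ s ∈ Finset.univ.erase r, (e p w + e q w - (2 : ℂ) • e s w) ∈ W :=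
      Submodule.sum_mem _ fun s hs' => hs s (Finset.ne_of_mem_erase hs') w hw
    have h2 : ∑ s ∈ Finset.univ.erase r, (e p w + e q w - (2 : ℂ) • e s w) =
        ((n : ℂ) - 1) • (e p w + e q w) - (2 : ℂ) • u w + (2 : ℂ) • e r w := by
      have h3 := Finset.add_sum_erase Finset.univ
        (fun s => e p w + e q w - (2 : ℂ) • e s w) (Finset.mem_univ r)
      rw [← eq_sub_iff_add_eq'] at h3
      rw [h3, Finset.sum_sub_distrib, ← Finset.smul_sum, ← LinearMap.sum_apply, ← hu,
        Finset.sum_const, Finset.card_univ, Fintype.card_fin]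
      module
    have hn1 : (n : ℂ) - 1 ≠ 0 := fun h0 => by rw [h0] at hκ; norm_num at hκ
    have h3 : e p w + e q w = ((n : ℂ) - 1)⁻¹ • (∑ s ∈ Finset.univ.erase r,
        (e p w + e q w - (2 : ℂ) • e s w) + (2 : ℂ) • u w - (2 : ℂ) • e r w) := by
      rw [h2, eq_inv_smul_iff₀ hn1]; abel
    rw [h3]
    exact Submodule.smul_mem _ _ (Submodule.sub_mem _ (Submodule.add_mem _ (hWW h1)
      (Submodule.smul_mem _ _ (huW w hw))) (Submodule.smul_mem _ _ (her w hw)))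
  have hall : ∀ j, ∀ w ∈ W, e j w ∈ W ⊔ W.map u := by
    intro j w hw
    by_cases hj : j = r
    · subst hj; exact her w hw
    · have : e j w = (1 / 2 : ℂ) • ((e p w + e q w) - (e p w + e q w - (2 : ℂ) • e j w)) := by
        module
      rw [this]
      exact Submodule.smul_mem _ _ (Submodule.sub_mem _ (ha w hw) (hWW (hs j hj w hw)))
  have htop : W ⊔ W.map u = ⊤ := by
    refine he.eq_top_of_invariant hS _ (fun h0 => hW ?_) fun j v hv => ?_
    · exact eq_bot_iff.2 (h0 ▸ hWW)
    · obtain ⟨w, hw, v', hv', rfl⟩ := Submodule.mem_sup.1 hv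
      obtain ⟨w', hw', rfl⟩ := Submodule.mem_map.1 hv'
      rw [map_add, hue]
      exact Submodule.add_mem _ (hall j w hw) (Submodule.sub_mem _
        (Submodule.smul_mem _ _ (hWW hw')) (huT _ (hall j w' hw')))
  obtain ⟨w, hw, v', hv', rfl⟩ := Submodule.mem_sup.1 (htop ▸ Submodule.mem_top : y ∈ W ⊔ W.map u)
  obtain ⟨w', hw', rfl⟩ := Submodule.mem_map.1 hv'
  have h1 : projInv e κ r (u w') = -u w' := by
    have := LinearMap.congr_fun (he.sum_mul_inv κ r) w'
    simp only [Module.End.mul_apply, LinearMap.neg_apply, hWr w' hw'] at this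
    rw [← hu] at this
    exact (neg_eq_iff_eq_neg.2 this).symm
  rw [map_add, hWr w hw, h1] at hy
  have h2 : u w' = -u w' := (add_left_cancel hy).symm
  have h3 : u w' = 0 := by
    have h4 : (2 : ℂ) • u w' = 0 := by rw [two_smul]; exact eq_neg_iff_add_eq_zero.1 h2
    exact (smul_eq_zero.1 h4).resolve_left two_ne_zero
  rw [h3, add_zero]
  exact hw

theorem IsSpinLift.stdSub_le [FiniteDimensional ℂ S] (h : IsSpinLift e φ π)
    (hU : ∀ g, ∀ x ∈ U, permRep φ π g x ∈ U)
    {κ : ℂ} (hκ : κ * κ * (n - 1) = -1) (hn : 2 ≤ n)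
    (hS : Module.finrank ℂ S = 2 ^ (n / 2)) (hUK : U ≤ stdSub e κ) (hU0 : U ≠ ⊥) :
    stdSub e κ ≤ U := by
  have he := h.clifford
  obtain ⟨p, q, r, hpq, hpr, hqr, hW⟩ : ∃ p q r : Fin n, p ≠ q ∧ p ≠ r ∧ q ≠ r ∧
      triSub e U p q r ≠ ⊥ := by
    by_contra! hcon
    refine hU0 (eq_bot_iff.2 fun x hx => ?_)
    refine he.eq_zero_of_tri_eq_zero hκ hn (hUK hx) fun p q r hpq hpr hqr => ?_
    have h1 := h.mem_triSub_of_mem hU hqr hpq.symm hpr.symm hx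
    rw [hcon q r p hqr hpq.symm hpr.symm, Submodule.mem_bot, ← Module.End.mul_apply (cyc e q r p),
      he.cyc_mul_self hqr hpq.symm hpr.symm, cyc_rotate] at h1
    rw [← h1, ← cyc_rotate q p r, cyc_rotate]
  have hW' : ∀ s, s ≠ p → s ≠ q → triSub e U p q s ≠ ⊥ := by
    intro s hsp hsq hbot
    obtain ⟨g, hg⟩ := h.surjective (Equiv.swap r s)
    refine hW (eq_bot_iff.2 fun w hw => ?_)
    have h1 := h.map_mem_triSub hU g hw
    rw [hg, Equiv.swap_apply_of_ne_of_ne hpr hsp.symm, Equiv.swap_apply_of_ne_of_ne hqr hsq.symm,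
      Equiv.swap_apply_left, hbot, Submodule.mem_bot] at h1
    rw [Submodule.mem_bot, ← map_inv_apply_map (φ := φ) g w, h1, map_zero]
  intro y hy
  have hx : ∑ s, (if s = p ∨ s = q then 0 else tri e p q s (y s)) ∈ U := by
    refine Submodule.sum_mem _ fun s _ => ?_
    split_ifs with hs
    · exact U.zero_mem
    · push Not at hs
      exact h.triSub_eq hU hκ hn hS hUK hpq hs.1.symm hs.2.symm (hW' s hs.1 hs.2) (hy.1 s)
  set x := ∑ s, (if s = p ∨ s = q then 0 else tri e p q s (y s)) with hxdef
  have hK := (stdSub e κ).sub_mem hy (hUK hx)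
  have hz : ∀ j, j ≠ p → j ≠ q → (y - x) j = 0 := by
    intro j hjp hjq
    rw [Pi.sub_apply, hxdef, Finset.sum_apply, Finset.sum_eq_single j, if_neg (by tauto), tri_trd,
      sub_self]
    · intro s _ hsj
      split_ifs
      · rfl
      · exact tri_other hjp hjq hsj.symm _
    · simp
  have hpq0 : (y - x) q = -(y - x) p := by
    have h1 := hK.2
    rw [← Finset.add_sum_erase _ _ (Finset.mem_univ p), Finset.sum_eq_single q] at h1
    · exact eq_neg_of_add_eq_zero_right h1
    · intro j hj hjq
      exact hz j (Finset.ne_of_mem_erase hj) hjq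
    · intro h2; exact absurd (Finset.mem_erase.2 ⟨hpq.symm, Finset.mem_univ q⟩) h2
  have hp0 : (y - x) p = 0 := by
    refine he.eq_zero_of_inv_apply hκ hpq (s := 1) (one_mul 1) ?_ ?_
    · rw [one_smul]; exact hK.1 p
    · have := hK.1 q
      rw [hpq0, map_neg, neg_inj] at this
      rw [one_smul]; exact this
  have : y - x = 0 := by
    funext j
    by_cases hjp : j = p
    · rw [hjp]; exact hp0
    by_cases hjq : j = q
    · rw [hjq, hpq0, hp0, neg_zero]; rfl
    · exact hz j hjp hjq
  rw [sub_eq_zero.1 this]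
  exact hx

end Irreducible

section FiveCycle

variable {R : Type} [Ring R]

theorem five_cycle_identity {B C : R} (hB : 1 + B + B * B = 0) (hC : 1 + C + C * C = 0)
    (hZ : (B * C + (1 + C) * (1 + B)) * (B * C + (1 + C) * (1 + B)) =
      (B * C + (1 + C) * (1 + B)) + 1) :
    1 + -(B * C) + (-(B * C)) ^ 2 + (-(B * C)) ^ 3 + (-(B * C)) ^ 4 = 0 := by
  have hB' : B * (1 + B) = -1 := by
    rw [mul_add, mul_one]; exact eq_neg_of_add_eq_zero_left (by rw [← hB]; abel)
  have hB'' : (1 + B) * B = -1 := by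
    rw [add_mul, one_mul]; exact eq_neg_of_add_eq_zero_left (by rw [← hB]; abel)
  have hC' : C * (1 + C) = -1 := by
    rw [mul_add, mul_one]; exact eq_neg_of_add_eq_zero_left (by rw [← hC]; abel)
  have hC'' : (1 + C) * C = -1 := by
    rw [add_mul, one_mul]; exact eq_neg_of_add_eq_zero_left (by rw [← hC]; abel)
  set T := B * C with hT
  set T' := (1 + C) * (1 + B) with hT'
  have h1 : T * T' = 1 := by
    calc T * T' = B * (C * (1 + C)) * (1 + B) := by rw [hT, hT']; noncomm_ring
      _ = 1 := by rw [hC', mul_neg, mul_one, neg_mul, hB', neg_neg]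
  have h2 : T' * T = 1 := by
    calc T' * T = (1 + C) * ((1 + B) * B) * C := by rw [hT, hT']; noncomm_ring
      _ = 1 := by rw [hB'', mul_neg, mul_one, neg_mul, hC'', neg_neg]
  have h3 : T * (T + T') = T * T + 1 := by rw [mul_add, h1]
  have h4 : (T + T') * T = T * T + 1 := by rw [add_mul, h2]
  have h5 : (T * T + 1) * (T * T + 1) = T * T * T + T + T * T := by
    calc (T * T + 1) * (T * T + 1) = T * ((T + T') * (T + T')) * T := by
          nth_rw 1 [← h3]; rw [← h4]; noncomm_ring
      _ = T * (T + T') * T + T * T := by rw [hZ]; noncomm_ring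
      _ = _ := by rw [h3, add_mul, one_mul]
  have h6 : 1 + -T + (-T) ^ 2 + (-T) ^ 3 + (-T) ^ 4 =
      (T * T + 1) * (T * T + 1) - (T * T * T + T + T * T) := by
    noncomm_ring
  rw [h6, h5, sub_self]

variable [Algebra ℂ R]

theorem anticomm_four_mul {a b c d f : R} (ha : a * a = 1) (hb : b * b = 1) (hc : c * c = 1)
    (hd : d * d = 1) (hf : f * f = 1)
    (hba : b * a = -(a * b)) (hca : c * a = -(a * c)) (hda : d * a = -(a * d))
    (hfa : f * a = -(a * f)) (hcb : c * b = -(b * c)) (hdb : d * b = -(b * d))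
    (hfb : f * b = -(b * f)) (hdc : d * c = -(c * d)) (hfc : f * c = -(c * f))
    (hfd : f * d = -(d * f)) :
    (a * b + b * c + c * a) * (c * d + d * f + f * c) +
      (c * d + d * f + f * c) * (a * b + b * c + c * a) =
      (2 : ℂ) • (a * (b * (c * d)) - a * (b * (c * f)) + a * (b * (d * f)) - a * (c * (d * f)) +
        b * (c * (d * f))) ∧
    (a * (b * (c * d)) - a * (b * (c * f)) + a * (b * (d * f)) - a * (c * (d * f)) +
        b * (c * (d * f))) * (a * (b * (c * d)) - a * (b * (c * f)) + a * (b * (d * f)) -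
        a * (c * (d * f)) + b * (c * (d * f))) = (5 : ℂ) • 1 := by
  have sq : ∀ {v : R}, v * v = 1 → ∀ x, v * (v * x) = x := fun h x => by
    rw [← mul_assoc, h, one_mul]
  have sw : ∀ {v w : R}, w * v = -(v * w) → ∀ x, w * (v * x) = -(v * (w * x)) := fun h x => by
    rw [← mul_assoc, h, neg_mul, mul_assoc]
  constructor <;>
  · simp only [mul_neg, neg_mul, mul_add, add_mul, mul_sub, sub_mul, mul_assoc, ha, hb, hc, hd, hf,
      hba, hca, hcb, hdb, hfb, hdc, hfc, hfd, sq ha, sq hb, sq hc, sq hd,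
      sw hba, sw hca, sw hda, sw hfa, sw hcb, sw hdb, sw hfb, sw hdc, sw hfc, sw hfd,
      neg_neg, mul_one]
    module

end FiveCycle

section NoFixedVector

variable {S : Type} [AddCommGroup S] [Module ℂ S] {n : ℕ} {e : Fin n → Module.End ℂ S}

theorem IsClifford.one_add_five_cycle (he : IsClifford e) {a : Fin 5 → Fin n}
    (ha : Function.Injective a) (A : Module.End ℂ S)
    (hA : A = -(cyc e (a 0) (a 1) (a 2) * cyc e (a 2) (a 3) (a 4))) :
    1 + A + A ^ 2 + A ^ 3 + A ^ 4 = 0 := by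
  have hne : ∀ i j, i ≠ j → a i ≠ a j := fun i j h h' => h (ha h')
  have han : ∀ i j, i ≠ j → e (a i) * e (a j) = -(e (a j) * e (a i)) := fun i j h =>
    he.anti _ _ (hne i j h)
  obtain ⟨h1, h2⟩ := anticomm_four_mul (he.sq (a 0)) (he.sq (a 1)) (he.sq (a 2)) (he.sq (a 3))
    (he.sq (a 4)) (han 1 0 (by decide)) (han 2 0 (by decide)) (han 3 0 (by decide))
    (han 4 0 (by decide)) (han 2 1 (by decide)) (han 3 1 (by decide)) (han 4 1 (by decide))
    (han 3 2 (by decide)) (han 4 2 (by decide)) (han 4 3 (by decide))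
  rw [hA]
  refine five_cycle_identity
    (he.one_add_cyc (hne 0 1 (by decide)) (hne 0 2 (by decide)) (hne 1 2 (by decide)))
    (he.one_add_cyc (hne 2 3 (by decide)) (hne 2 4 (by decide)) (hne 3 4 (by decide))) ?_
  unfold cyc
  set L := e (a 0) * e (a 1) + e (a 1) * e (a 2) + e (a 2) * e (a 0)
  set M := e (a 2) * e (a 3) + e (a 3) * e (a 4) + e (a 4) * e (a 2)
  set Q := e (a 0) * (e (a 1) * (e (a 2) * e (a 3))) - e (a 0) * (e (a 1) * (e (a 2) * e (a 4))) +
    e (a 0) * (e (a 1) * (e (a 3) * e (a 4))) - e (a 0) * (e (a 2) * (e (a 3) * e (a 4))) +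
    e (a 1) * (e (a 2) * (e (a 3) * e (a 4)))
  have hZ : ((1 / 2 : ℂ) • (L - 1) * (1 / 2 : ℂ) • (M - 1) +
      (1 + (1 / 2 : ℂ) • (M - 1)) * (1 + (1 / 2 : ℂ) • (L - 1))) = (1 / 2 : ℂ) • (1 + Q) := by
    have h3 : (1 / 2 : ℂ) • (1 + Q) = (1 / 4 : ℂ) • (L * M + M * L) + (1 / 2 : ℂ) • 1 := by
      rw [h1]; module
    rw [h3]
    simp only [add_mul, mul_add, sub_mul, mul_sub, smul_mul_assoc, mul_smul_comm, mul_one, one_mul,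
      smul_sub, smul_add]
    module
  rw [hZ, smul_mul_smul_comm, add_mul, one_mul, mul_add Q, h2, mul_one]
  module

theorem pow_eq_one_of_geom {A : Module.End ℂ S} {m : ℕ}
    (hA : ∑ i ∈ Finset.range m, A ^ i = 0) : A ^ m = 1 := by
  have := geom_sum_mul A m
  rw [hA, zero_mul] at this
  exact (sub_eq_zero.1 this.symm)

theorem eq_zero_of_geom {A : Module.End ℂ S} {m : ℕ} (hm : m ≠ 0)
    (hA : ∑ i ∈ Finset.range m, A ^ i = 0) {x : S} (hx : A x = x) : x = 0 := by
  have h := LinearMap.congr_fun hA x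
  have hp : ∀ i, (A ^ i) x = x := fun i => by
    induction i with
    | zero => simp
    | succ i ih => rw [pow_succ, Module.End.mul_apply, hx, ih]
  simp only [LinearMap.sum_apply, hp, Finset.sum_const, Finset.card_range, LinearMap.zero_apply,
    ← Nat.cast_smul_eq_nsmul ℂ] at h
  exact (smul_eq_zero.1 h).resolve_left (by exact_mod_cast hm)

variable [FiniteDimensional ℂ S]

theorem IsClifford.det_cyc_sq (he : IsClifford e) {p q r : Fin n} (hpq : p ≠ q) (hpr : p ≠ r)
    (hqr : q ≠ r) : LinearMap.det (cyc e p q r) ^ 2 = 1 := by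
  have h : ∀ i j, i ≠ j → LinearMap.det (e i - e j) ^ 2 = (2 : ℂ) ^ Module.finrank ℂ S := by
    intro i j hij
    rw [← map_pow, pow_two, he.sub_mul_sub_self hij, LinearMap.det_smul, map_one, mul_one]
  have h1 := congrArg (fun f => LinearMap.det f ^ 2) (he.two_cyc (q := q) hpr)
  simp only [map_mul, mul_pow, h p q hpq, h q r hqr, LinearMap.det_smul] at h1
  have h2 : (2 : ℂ) ^ Module.finrank ℂ S ≠ 0 := pow_ne_zero _ two_ne_zero
  have h3 : (2 : ℂ) ^ Module.finrank ℂ S * 2 ^ Module.finrank ℂ S ≠ 0 := mul_ne_zero h2 h2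
  rw [pow_two] at h1
  exact mul_left_cancel₀ h3 (by rw [mul_one]; exact h1.symm)

theorem IsClifford.eq_of_pow_eq_one [Nontrivial S] (he : IsClifford e)
    (hS : Module.finrank ℂ S = 2 ^ (n / 2)) {τ : Equiv.Perm (Fin n)} {X A : Module.End ℂ S} {m : ℕ}
    (hm : Odd m) (hX : ∀ j, X * e j = e (τ j) * X) (hA : ∀ j, A * e j = e (τ j) * A)
    (hXm : X ^ m = 1) (hAm : A ^ m = 1) (hXd : LinearMap.det X ^ 4 = 1)
    (hAd : LinearMap.det A ^ 4 = 1) : X = A := by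
  obtain ⟨l, hl⟩ : ∃ l, m = l + 1 := ⟨m - 1, by have := hm.pos; omega⟩
  have hA1 : A ^ l * A = 1 := by rw [← pow_succ, ← hl, hAm]
  have hA2 : A * A ^ l = 1 := by rw [← pow_succ', ← hl, hAm]
  have hA' : ∀ j, A ^ l * e (τ j) = e j * A ^ l := fun j => by
    calc A ^ l * e (τ j) = A ^ l * (e (τ j) * A) * A ^ l := by
          rw [mul_assoc, mul_assoc, hA2, mul_one]
      _ = _ := by rw [← hA, ← mul_assoc, hA1, one_mul]
  obtain ⟨s, hs⟩ := he.eq_smul_of_commute hS (A ^ l * X) fun j => by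
    rw [mul_assoc, hX, ← mul_assoc, hA', mul_assoc]
  have hXs : X = s • A := by
    calc X = A * (A ^ l * X) := by rw [← mul_assoc, hA2, one_mul]
      _ = s • A := by rw [hs, mul_smul_comm, mul_one]
  have h1 : s ^ m = 1 := by
    rw [hXs, smul_pow, hAm] at hXm
    obtain ⟨v, hv⟩ := exists_ne (0 : S)
    have h2 := LinearMap.congr_fun hXm v
    simp only [LinearMap.smul_apply, Module.End.one_apply] at h2
    have h3 : (s ^ m - 1) • v = 0 := by rw [sub_smul, h2, one_smul, sub_self]
    exact sub_eq_zero.1 ((smul_eq_zero.1 h3).resolve_right hv)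
  have h2 : s ^ 2 ^ (n / 2 + 2) = 1 := by
    rw [hXs, LinearMap.det_smul, mul_pow, hAd, mul_one, hS, ← pow_mul] at hXd
    rw [pow_add]
    exact hXd
  have h3 := pow_gcd_eq_one.2 ⟨h1, h2⟩
  have h4 : m.gcd (2 ^ (n / 2 + 2)) = 1 := Nat.Coprime.pow_right _ (Nat.coprime_two_right.2 hm)
  rw [h4, pow_one] at h3
  rw [hXs, h3, one_smul]

theorem IsClifford.eq_zero_of_three_cycle [Nontrivial S] (he : IsClifford e)
    (hS : Module.finrank ℂ S = 2 ^ (n / 2)) {τ : Equiv.Perm (Fin n)} {X : Module.End ℂ S}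
    {a : Fin 3 → Fin n} (ha : Function.Injective a) (hτ : ∀ i, τ (a i) = a (i + 1))
    (hτ' : ∀ j, (∀ i, j ≠ a i) → τ j = j)
    (hX : ∀ j, X * e j = e (τ j) * X) (hXm : X ^ 3 = 1) (hXd : LinearMap.det X ^ 4 = 1) {x : S}
    (hx : X x = x) : x = 0 := by
  have hne : ∀ i j, i ≠ j → a i ≠ a j := fun i j h h' => h (ha h')
  have h01 := hne 0 1 (by decide)
  have h02 := hne 0 2 (by decide)
  have h12 := hne 1 2 (by decide)
  have hg : ∑ i ∈ Finset.range 3, cyc e (a 0) (a 1) (a 2) ^ i = 0 := by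
    simpa [Finset.sum_range_succ, pow_two] using he.one_add_cyc h01 h02 h12
  have hXA : X = cyc e (a 0) (a 1) (a 2) := by
    refine he.eq_of_pow_eq_one hS (by decide : Odd 3) hX (fun j => ?_) hXm (pow_eq_one_of_geom hg)
      hXd ?_
    · by_cases h0 : j = a 0
      · rw [h0, hτ]; exact he.cyc_mul_fst h01
      by_cases h1 : j = a 1
      · rw [h1, hτ]; exact he.cyc_mul_snd h12
      by_cases h2 : j = a 2
      · rw [h2, hτ]; exact he.cyc_mul_trd h02
      · rw [hτ' j (fun i => by fin_cases i <;> assumption)]; exact he.cyc_mul_other h0 h1 h2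
    · rw [show 4 = 2 * 2 from rfl, pow_mul, he.det_cyc_sq h01 h02 h12, one_pow]
  rw [← hXA] at hg
  exact eq_zero_of_geom (by decide) hg hx

theorem IsClifford.eq_zero_of_five_cycle [Nontrivial S] (he : IsClifford e)
    (hS : Module.finrank ℂ S = 2 ^ (n / 2)) {τ : Equiv.Perm (Fin n)} {X : Module.End ℂ S}
    {a : Fin 5 → Fin n} (ha : Function.Injective a) (hτ : ∀ i, τ (a i) = a (i + 1))
    (hτ' : ∀ j, (∀ i, j ≠ a i) → τ j = j)
    (hX : ∀ j, X * e j = e (τ j) * X) (hXm : X ^ 5 = 1) (hXd : LinearMap.det X ^ 4 = 1) {x : S}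
    (hx : X x = x) : x = 0 := by
  have hne : ∀ i j, i ≠ j → a i ≠ a j := fun i j h h' => h (ha h')
  have h01 := hne 0 1 (by decide)
  have h02 := hne 0 2 (by decide)
  have h12 := hne 1 2 (by decide)
  have h23 := hne 2 3 (by decide)
  have h24 := hne 2 4 (by decide)
  have h34 := hne 3 4 (by decide)
  set A := -(cyc e (a 0) (a 1) (a 2) * cyc e (a 2) (a 3) (a 4)) with hA
  have hg : ∑ i ∈ Finset.range 5, A ^ i = 0 := by
    simpa [Finset.sum_range_succ] using he.one_add_five_cycle ha A hA
  have hXA : X = A := by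
    refine he.eq_of_pow_eq_one hS (by decide : Odd 5) hX (fun j => ?_) hXm (pow_eq_one_of_geom hg)
      hXd ?_
    · rw [hA, neg_mul, mul_neg, neg_inj]
      by_cases h0 : j = a 0
      · rw [h0, hτ, mul_assoc, he.cyc_mul_other h02 (hne 0 3 (by decide)) (hne 0 4 (by decide)),
          ← mul_assoc, he.cyc_mul_fst h01, mul_assoc]; rfl
      by_cases h1 : j = a 1
      · rw [h1, hτ, mul_assoc, he.cyc_mul_other h12 (hne 1 3 (by decide)) (hne 1 4 (by decide)),
          ← mul_assoc, he.cyc_mul_snd h12, mul_assoc]; rfl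
      by_cases h2 : j = a 2
      · rw [h2, hτ, mul_assoc, he.cyc_mul_fst h23, ← mul_assoc,
          he.cyc_mul_other (hne 3 0 (by decide)) (hne 3 1 (by decide)) (hne 3 2 (by decide)),
          mul_assoc]; rfl
      by_cases h3 : j = a 3
      · rw [h3, hτ, mul_assoc, he.cyc_mul_snd h34, ← mul_assoc,
          he.cyc_mul_other (hne 4 0 (by decide)) (hne 4 1 (by decide)) (hne 4 2 (by decide)),
          mul_assoc]; rfl
      by_cases h4 : j = a 4
      · rw [h4, hτ, mul_assoc, he.cyc_mul_trd h24, ← mul_assoc, he.cyc_mul_trd h02, mul_assoc]; rfl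
      · rw [hτ' j (fun i => by fin_cases i <;> assumption), mul_assoc,
          he.cyc_mul_other h2 h3 h4, ← mul_assoc, he.cyc_mul_other h0 h1 h2, mul_assoc]
    · have h4 : ∀ c : ℂ, c ^ 2 = 1 → c ^ 4 = 1 := fun c hc => by linear_combination (c ^ 2 + 1) * hc
      rw [hA, ← neg_one_smul ℂ, LinearMap.det_smul, map_mul, mul_pow, mul_pow, ← pow_mul,
        h4 _ (he.det_cyc_sq h01 h02 h12), h4 _ (he.det_cyc_sq h23 h24 h34), mul_one, mul_one, mul_comm, pow_mul]
      norm_num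
  rw [← hXA] at hg
  exact eq_zero_of_geom (by decide) hg hx

end NoFixedVector

section Modes

variable {S : Type} [AddCommGroup S] [Module ℂ S] {n : ℕ} {e : Fin n → Module.End ℂ S}

/-- The `ω`-Fourier mode of the Clifford generators along a cycle of length `m` of `σ` at `p`. -/
noncomputable def cycMode (e : Fin n → Module.End ℂ S) (σ : Equiv.Perm (Fin n)) (p : Fin n) (m : ℕ)
    (ω : ℂ) : Module.End ℂ S :=
  ∑ r ∈ Finset.range m, (ω⁻¹) ^ r • e (σ^[r] p)

variable {σ : Equiv.Perm (Fin n)} {p : Fin n} {m : ℕ} {χ : ℂ} {G : Module.End ℂ S}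

theorem mul_cycMode (hG : ∀ j, G * e j = χ • (e (σ j) * G)) (hm : Function.minimalPeriod σ p = m)
    {ω : ℂ} (hω : ω ^ m = 1) (hω0 : ω ≠ 0) :
    G * cycMode e σ p m ω = (χ * ω) • (cycMode e σ p m ω * G) := by
  have h1 : ∀ r, ω * (ω⁻¹) ^ (r + 1) = (ω⁻¹) ^ r := fun r => by
    rw [pow_succ']; field_simp
  have h2 : ω • cycMode e σ p m ω = ∑ r ∈ Finset.range m, (ω⁻¹) ^ r • e (σ^[r + 1] p) := by
    rw [cycMode, Finset.smul_sum]
    have h3 := Finset.sum_range_succ (fun r => ω • (ω⁻¹) ^ r • e (σ^[r] p)) m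
    rw [Finset.sum_range_succ'] at h3
    have h4 : σ^[m] p = p := hm ▸ Function.iterate_minimalPeriod
    rw [h4, inv_pow ω m, hω, inv_one, pow_zero, Function.iterate_zero_apply] at h3
    rw [← add_right_cancel h3]
    refine Finset.sum_congr rfl fun r _ => ?_
    rw [smul_smul, h1]
  rw [mul_smul, ← smul_mul_assoc, h2, cycMode, Finset.mul_sum, Finset.sum_mul, Finset.smul_sum]
  refine Finset.sum_congr rfl fun r _ => ?_
  rw [mul_smul_comm, hG, Function.iterate_succ_apply', smul_mul_assoc, smul_comm]

theorem IsClifford.cycMode_mul_add (he : IsClifford e) (hm : Function.minimalPeriod σ p = m)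
    (ω ω' : ℂ) :
    cycMode e σ p m ω * cycMode e σ p m ω' + cycMode e σ p m ω' * cycMode e σ p m ω =
      (2 * ∑ r ∈ Finset.range m, ((ω * ω')⁻¹) ^ r) • 1 := by
  have h1 : ∀ r ∈ Finset.range m, ∀ s ∈ Finset.range m,
      e (σ^[r] p) * e (σ^[s] p) + e (σ^[s] p) * e (σ^[r] p) = (if r = s then (2 : ℂ) else 0) • 1 := by
    intro r hr s hs
    split_ifs with h
    · subst h; rw [he.sq, two_smul]
    · rw [he.anti, neg_add_cancel, zero_smul]
      intro h2
      refine h (Function.iterate_injOn_Iio_minimalPeriod (f := σ) (x := p) ?_ ?_ h2)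
      · simpa [hm] using hr
      · simpa [hm] using hs
  simp only [cycMode, Finset.sum_mul_sum]
  rw [Finset.sum_comm (s := Finset.range m) (t := Finset.range m)
    (f := fun i j => (ω'⁻¹) ^ i • e (σ^[i] p) * (ω⁻¹) ^ j • e (σ^[j] p)),
    ← Finset.sum_add_distrib, Finset.mul_sum, Finset.sum_smul]
  refine Finset.sum_congr rfl fun r hr => ?_
  rw [← Finset.sum_add_distrib, Finset.sum_eq_single r]
  · have := h1 r hr r hr
    rw [if_pos rfl] at this
    rw [smul_mul_smul_comm, smul_mul_smul_comm, mul_inv, mul_pow, mul_comm (2 : ℂ),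
      mul_smul _ (2 : ℂ), ← this, smul_add, mul_comm ((ω'⁻¹) ^ r)]
  · intro s hs hsr
    have := h1 r hr s hs
    rw [if_neg (Ne.symm hsr), zero_smul] at this
    rw [smul_mul_smul_comm, smul_mul_smul_comm, mul_comm ((ω'⁻¹) ^ s), ← smul_add, this, smul_zero]
  · intro h; exact absurd hr h

theorem IsClifford.cycMode_anti (he : IsClifford e) (hm : Function.minimalPeriod σ p = m)
    {ω ω' : ℂ} (hω : ω ^ m = 1) (hω' : ω' ^ m = 1) (h : ω * ω' ≠ 1) :
    cycMode e σ p m ω * cycMode e σ p m ω' + cycMode e σ p m ω' * cycMode e σ p m ω = 0 := by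
  rw [he.cycMode_mul_add hm]
  have h1 : ((ω * ω')⁻¹) ≠ 1 := fun h' => h (inv_eq_one.1 h')
  rw [geom_sum_eq h1, inv_pow, mul_pow, hω, hω']
  simp

theorem IsClifford.cycMode_inv (he : IsClifford e) (hm : Function.minimalPeriod σ p = m)
    {ω : ℂ} (hω0 : ω ≠ 0) :
    cycMode e σ p m ω * cycMode e σ p m ω⁻¹ + cycMode e σ p m ω⁻¹ * cycMode e σ p m ω =
      (2 * m : ℂ) • 1 := by
  rw [he.cycMode_mul_add hm, mul_inv_cancel₀ hω0]
  simp

/-- `x` is annihilated by the lowering modes `1, …, h`. -/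
def IsVacuum (e : Fin n → Module.End ℂ S) (σ : Equiv.Perm (Fin n)) (p : Fin n) (m : ℕ) (ζ : ℂ)
    (h : ℕ) (x : S) : Prop :=
  ∀ j, 1 ≤ j → j ≤ h → 2 * j < m → cycMode e σ p m (ζ ^ j)⁻¹ x = 0

variable {ζ : ℂ}

theorem mode_apply (hG : ∀ j, G * e j = χ • (e (σ j) * G)) (hm : Function.minimalPeriod σ p = m)
    {ω : ℂ} (hω : ω ^ m = 1) (hω0 : ω ≠ 0) {x : S} {μ : ℂ} (hx : G x = μ • x) :
    G (cycMode e σ p m ω x) = (χ * ω * μ) • cycMode e σ p m ω x := by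
  have := LinearMap.congr_fun (mul_cycMode hG hm hω hω0) x
  simp only [Module.End.mul_apply, LinearMap.smul_apply, hx, map_smul, smul_smul] at this
  exact this

theorem IsClifford.isVacuum_mode (he : IsClifford e) (hm : Function.minimalPeriod σ p = m)
    (hζ : IsPrimitiveRoot ζ m) {h : ℕ} {ω : ℂ} (hω : ω ^ m = 1)
    (hne : ∀ j, 1 ≤ j → j ≤ h → 2 * j < m → ω ≠ ζ ^ j)
    {x : S} (hx : IsVacuum e σ p m ζ h x) : IsVacuum e σ p m ζ h (cycMode e σ p m ω x) := by
  intro j h1 h2 h3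
  have hz : ζ ≠ 0 := hζ.ne_zero (by omega)
  have := LinearMap.congr_fun (he.cycMode_anti hm (ω := (ζ ^ j)⁻¹) (ω' := ω) (by
    rw [inv_pow, ← pow_mul, mul_comm, pow_mul, hζ.pow_eq_one, one_pow, inv_one]) hω (fun h' => by
    refine hne j h1 h2 h3 ?_
    rwa [inv_mul_eq_one₀ (pow_ne_zero _ hz), eq_comm] at h')) x
  simpa [hx j h1 h2 h3] using this

theorem IsClifford.exists_isVacuum (he : IsClifford e)
    (hG : ∀ j, G * e j = χ • (e (σ j) * G)) (hm : Function.minimalPeriod σ p = m)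
    (hζ : IsPrimitiveRoot ζ m) {x : S} (hx0 : x ≠ 0) {μ : ℂ} (hx : G x = μ • x) (h : ℕ) :
    ∃ (a : ℕ) (ω : ℂ) (y : S), ω ^ m = 1 ∧ y ≠ 0 ∧ G y = (χ ^ a * ω * μ) • y ∧
      IsVacuum e σ p m ζ h y := by
  induction h with
  | zero => exact ⟨0, 1, x, one_pow _, hx0, by simpa using hx, fun j h1 h2 => by omega⟩
  | succ h ih =>
    obtain ⟨a, ω, y, hω, hy0, hy, hv⟩ := ih
    by_cases hc : 2 * (h + 1) < m → cycMode e σ p m (ζ ^ (h + 1))⁻¹ y = 0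
    · refine ⟨a, ω, y, hω, hy0, hy, fun j h1 h2 h3 => ?_⟩
      rcases Nat.lt_or_ge h j with h4 | h4
      · obtain rfl : j = h + 1 := by omega
        exact hc h3
      · exact hv j h1 h4 h3
    · push Not at hc
      obtain ⟨hlt, hc⟩ := hc
      have hz : ζ ≠ 0 := hζ.ne_zero (by omega)
      have hζ' : ((ζ ^ (h + 1))⁻¹) ^ m = 1 := by
        rw [inv_pow, ← pow_mul, mul_comm, pow_mul, hζ.pow_eq_one, one_pow, inv_one]
      have hne : ∀ j, 1 ≤ j → j ≤ h + 1 → 2 * j < m → (ζ ^ (h + 1))⁻¹ ≠ ζ ^ j := by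
        intro j h1 h2 h3 h4
        have h4 : ζ ^ (h + 1 + j) = 1 := by
          rw [pow_add, ← h4, mul_inv_cancel₀ (pow_ne_zero _ hz)]
        have := Nat.le_of_dvd (by omega) ((hζ.pow_eq_one_iff_dvd _).1 h4)
        omega
      refine ⟨a + 1, (ζ ^ (h + 1))⁻¹ * ω, _, by rw [mul_pow, hζ', hω, one_mul], hc, ?_, ?_⟩
      · rw [mode_apply hG hm hζ' (inv_ne_zero (pow_ne_zero _ hz)) hy]
        congr 1; ring
      · intro j h1 h2 h3
        rcases Nat.lt_or_ge h j with h4 | h4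
        · obtain rfl : j = h + 1 := by omega
          have := LinearMap.congr_fun (he.cycMode_anti hm hζ' hζ' (fun h5 => by
            refine hne (h + 1) h1 h2 h3 ?_
            rw [eq_inv_of_mul_eq_one_left h5, inv_inv])) y
          simp only [LinearMap.zero_apply,
            ← two_smul ℂ] at this
          exact (smul_eq_zero.1 this).resolve_left two_ne_zero
        · exact he.isVacuum_mode hm hζ hζ' (fun i h5 h6 h7 => hne i h5 (by omega) h7) hv j h1 h4 h3

theorem IsClifford.exists_of_isVacuum (he : IsClifford e)
    (hG : ∀ j, G * e j = χ • (e (σ j) * G)) (hm : Function.minimalPeriod σ p = m)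
    (hζ : IsPrimitiveRoot ζ m) (h : ℕ) : 2 * h ≤ m → ∀ (x : S) (μ : ℂ), x ≠ 0 → G x = μ • x →
    IsVacuum e σ p m ζ h x → ∀ t ≤ h * (h + 1) / 2,
    ∃ (a : ℕ) (y : S), y ≠ 0 ∧ G y = (χ ^ a * ζ ^ t * μ) • y := by
  induction h with
  | zero =>
    intro _ x μ hx0 hx _ t ht
    obtain rfl : t = 0 := by omega
    exact ⟨0, x, hx0, by simpa using hx⟩
  | succ h ih =>
    intro hh x μ hx0 hx hv t ht
    have hv' : IsVacuum e σ p m ζ h x := fun j h1 h2 h3 => hv j h1 (by omega) h3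
    by_cases hth : t ≤ h * (h + 1) / 2
    · exact ih (by omega) x μ hx0 hx hv' t hth
    have h1 : (h + 1) * (h + 1 + 1) / 2 = h * (h + 1) / 2 + (h + 1) := by
      rw [show (h + 1) * (h + 1 + 1) = h * (h + 1) + (h + 1) * 2 by ring,
        Nat.add_mul_div_right _ _ two_pos]
    have h2 : h + 1 ≤ t := by
      rcases Nat.eq_zero_or_pos h with rfl | h3
      · omega
      · have : h ≤ h * (h + 1) / 2 := by
          rw [Nat.le_div_iff_mul_le two_pos]
          exact Nat.mul_le_mul_left _ (by omega)
        omega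
    have hz : ζ ≠ 0 := hζ.ne_zero (by omega)
    have hm0 : (m : ℂ) ≠ 0 := by exact_mod_cast (by omega : m ≠ 0)
    have hζ' : (ζ ^ (h + 1)) ^ m = 1 := by
      rw [← pow_mul, mul_comm, pow_mul, hζ.pow_eq_one, one_pow]
    have hinv := LinearMap.congr_fun (he.cycMode_inv hm (pow_ne_zero (h + 1) hz)) x
    simp only [LinearMap.add_apply, Module.End.mul_apply, LinearMap.smul_apply,
      Module.End.one_apply] at hinv
    have hy0 : cycMode e σ p m (ζ ^ (h + 1)) x ≠ 0 := by
      intro h0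
      have hneg : cycMode e σ p m (ζ ^ (h + 1))⁻¹ x = 0 := by
        by_cases h4 : 2 * (h + 1) < m
        · exact hv (h + 1) (by omega) le_rfl h4
        · have h5 : (ζ ^ (h + 1))⁻¹ = ζ ^ (h + 1) := by
            refine inv_eq_of_mul_eq_one_left ?_
            rw [← pow_add, show h + 1 + (h + 1) = m by omega, hζ.pow_eq_one]
          rw [h5, h0]
      rw [hneg, h0, map_zero, map_zero, add_zero] at hinv
      exact hx0 ((smul_eq_zero.1 hinv.symm).resolve_left (mul_ne_zero two_ne_zero hm0))
    obtain ⟨a, y, hy, hGy⟩ := ih (by omega) _ _ hy0 (mode_apply hG hm hζ' (pow_ne_zero _ hz) hx)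
      (he.isVacuum_mode hm hζ hζ' (fun j h3 h4 h5 h6 => by
        have := hζ.pow_inj (by omega) (by omega) h6
        omega) hv') (t - (h + 1)) (by omega)
    refine ⟨a + 1, y, hy, ?_⟩
    rw [hGy]
    congr 1
    have h3 : ζ ^ t = ζ ^ (t - (h + 1)) * ζ ^ (h + 1) := by rw [← pow_add]; congr 1; omega
    rw [h3]; ring

theorem IsClifford.exists_eigenvalue_run (he : IsClifford e) (hn : n ≠ 0) (hχ : χ * χ = 1)
    (hG : ∀ j, G * e j = χ • (e (σ j) * G)) (hm : Function.minimalPeriod σ p = m)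
    (hζ : IsPrimitiveRoot ζ m) {μ : ℂ} (hμ : ∃ x ≠ 0, G x = μ • x) :
    ∃ ω : ℂ, ω ^ m = 1 ∧ ∀ t ≤ (m / 2) * (m / 2 + 1) / 2, ∃ x ≠ 0, G x = (μ * (ω * ζ ^ t)) • x := by
  have hχ0 : χ ≠ 0 := by rintro rfl; simp at hχ
  have hu : G * ∑ i, e i = χ • ((∑ i, e i) * G) := by
    rw [Finset.mul_sum, Finset.sum_mul, Finset.smul_sum,
      ← Equiv.sum_comp σ fun i => χ • (e i * G)]
    exact Finset.sum_congr rfl fun i _ => hG i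
  have hflip : ∀ ν, (∃ x ≠ 0, G x = (χ * ν) • x) → ∃ x ≠ 0, G x = ν • x := by
    rintro ν ⟨x, hx0, hx⟩
    refine ⟨(∑ i, e i) x, fun h0 => hx0 ?_, ?_⟩
    · have h1 : (∑ i, e i) ((∑ i, e i) x) = (n : ℂ) • x := LinearMap.congr_fun he.sum_mul_sum x
      rw [h0, map_zero] at h1
      exact (smul_eq_zero.1 h1.symm).resolve_left (by exact_mod_cast hn)
    · have h1 : G ((∑ i, e i) x) = χ • (∑ i, e i) (G x) := LinearMap.congr_fun hu x
      rw [h1, hx, map_smul, smul_smul, ← mul_assoc, hχ, one_mul]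
  have hflip' : ∀ a ν, (∃ x ≠ 0, G x = (χ ^ a * ν) • x) → ∃ x ≠ 0, G x = ν • x := by
    intro a
    induction a with
    | zero => intro ν h; simpa using h
    | succ a ih =>
      intro ν h
      refine hflip ν (ih _ ?_)
      rwa [← mul_assoc, ← pow_succ]
  obtain ⟨x, hx0, hx⟩ := hμ
  obtain ⟨a, ω, y, hω, hy0, hy, hv⟩ := he.exists_isVacuum hG hm hζ hx0 hx (m / 2)
  refine ⟨ω, hω, fun t ht => ?_⟩
  obtain ⟨b, w, hw0, hw⟩ := he.exists_of_isVacuum hG hm hζ (m / 2) (by omega) y _ hy0 hy hv t ht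
  refine hflip' (b + a) _ ⟨w, hw0, ?_⟩
  rw [hw]; congr 1; ring

end Modes

section CycleType

variable {α : Type*} [Fintype α] [DecidableEq α] {σ : Equiv.Perm α}

theorem Equiv.Perm.minimalPeriod_eq_card_support_cycleOf {j : α} (hj : σ j ≠ j) :
    Function.minimalPeriod σ j = (σ.cycleOf j).support.card := by
  have hc := σ.isCycle_cycleOf hj
  have key : ∀ t, Function.minimalPeriod σ j ∣ t ↔ (σ.cycleOf j).support.card ∣ t := by
    intro t
    rw [← hc.orderOf, orderOf_dvd_iff_pow_eq_one, ← Function.isPeriodicPt_iff_minimalPeriod_dvd,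
      Function.IsPeriodicPt, Function.IsFixedPt, Equiv.Perm.iterate_eq_pow]
    constructor
    · intro h
      exact hc.pow_eq_one_iff.2 ⟨j, by simpa using hj, by rwa [σ.cycleOf_pow_apply_self]⟩
    · intro h
      rw [← σ.cycleOf_pow_apply_self, h, Equiv.Perm.one_apply]
  exact Nat.dvd_antisymm ((key _).2 dvd_rfl) ((key _).1 dvd_rfl)

theorem Equiv.Perm.minimalPeriod_mem_cycleType {j : α} (hj : σ j ≠ j) :
    Function.minimalPeriod σ j ∈ σ.cycleType := by
  rw [minimalPeriod_eq_card_support_cycleOf hj, cycleType_def]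
  exact Multiset.mem_map_of_mem _
    (cycleOf_mem_cycleFactorsFinset_iff.2 (mem_support.2 hj))

theorem Equiv.Perm.exists_minimalPeriod_eq {m : ℕ} (hm : m ∈ σ.cycleType) :
    ∃ j, σ j ≠ j ∧ Function.minimalPeriod σ j = m := by
  rw [cycleType_def, Multiset.mem_map] at hm
  obtain ⟨c, hc, rfl⟩ := hm
  obtain ⟨hc1, hc2⟩ := mem_cycleFactorsFinset_iff.1 hc
  obtain ⟨j, hj, -⟩ := hc1
  have hj' := hc2 j (mem_support.2 hj)
  refine ⟨j, by rwa [← hj'], ?_⟩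
  rw [minimalPeriod_eq_card_support_cycleOf (by rwa [← hj']), Function.comp,
    ← cycle_is_cycleOf (mem_support.2 hj) hc]

theorem Equiv.Perm.sameCycle_of_count_eq_one {i j : α} (hi : σ i ≠ i)
    (hij : Function.minimalPeriod σ i = Function.minimalPeriod σ j)
    (h1 : σ.cycleType.count (Function.minimalPeriod σ i) = 1) : σ.SameCycle i j := by
  have hj : σ j ≠ j := fun h => hi <| by
    have h2 : Function.minimalPeriod σ j = 1 := Function.minimalPeriod_eq_one_iff_isFixedPt.2 h
    exact Function.minimalPeriod_eq_one_iff_isFixedPt.1 (hij.trans h2)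
  rw [cycleType_def, Multiset.count_map] at h1
  have h2 := (Finset.card_le_one (s := σ.cycleFactorsFinset.filter
    (fun c => Function.minimalPeriod σ i = (Finset.card ∘ support) c))).1 h1.le
  have h3 := h2 (σ.cycleOf i)
    (Finset.mem_filter.2 ⟨cycleOf_mem_cycleFactorsFinset_iff.2 (mem_support.2 hi),
      minimalPeriod_eq_card_support_cycleOf hi⟩) (σ.cycleOf j)
    (Finset.mem_filter.2 ⟨cycleOf_mem_cycleFactorsFinset_iff.2 (mem_support.2 hj),
      hij.trans (minimalPeriod_eq_card_support_cycleOf hj)⟩)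
  have h4 : j ∈ (σ.cycleOf i).support := by
    rw [h3, mem_support, cycleOf_apply_self]; exact hj
  exact (mem_support_cycleOf_iff.1 h4).1

/-- `σ` has a unique `3`-cycle, through `q`, a unique `5`-cycle, through `p`, and its other cycles
have lengths prime to `15` with least common multiple `l`. -/
structure IsThreeFive (σ : Equiv.Perm α) (l : ℕ) (q p : α) : Prop where
  coprime : l.Coprime 15
  orderOf_eq : orderOf σ = 15 * l
  period_three : Function.minimalPeriod σ q = 3
  period_five : Function.minimalPeriod σ p = 5
  pow_three : ∀ j, (∀ r, j ≠ σ^[r] q) → (σ ^ (5 * l)) j = j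
  pow_five : ∀ j, (∀ r, j ≠ σ^[r] p) → (σ ^ (3 * l)) j = j
  exists_lcm : ∃ L : Multiset ℕ, L.lcm = l ∧
    ∀ m ∈ L, m.Coprime 15 ∧ ∃ j, Function.minimalPeriod σ j = m

theorem IsThreeFive.exists_not_sameCycle {l : ℕ} {q p : α} (h : IsThreeFive σ l q p)
    (hα : 8 < Fintype.card α) :
    ¬ σ.SameCycle q p ∧ ∃ o, ¬ σ.SameCycle q o ∧ ¬ σ.SameCycle p o := by
  have hne : ∀ j, Function.minimalPeriod σ j ≠ 1 → σ j ≠ j := fun j hj hj' =>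
    hj (Function.minimalPeriod_eq_one_iff_isFixedPt.2 hj')
  have hq := hne q (by rw [h.period_three]; norm_num)
  have hp := hne p (by rw [h.period_five]; norm_num)
  have cq := Equiv.Perm.minimalPeriod_eq_card_support_cycleOf hq
  have cp := Equiv.Perm.minimalPeriod_eq_card_support_cycleOf hp
  rw [h.period_three] at cq
  rw [h.period_five] at cp
  refine ⟨fun hs => ?_, ?_⟩
  · rw [hs.cycleOf_eq, ← cp] at cq
    norm_num at cq
  · have hcard : ((σ.cycleOf q).support ∪ (σ.cycleOf p).support).card < Fintype.card α :=
      (Finset.card_union_le _ _).trans_lt (by omega)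
    obtain ⟨o, ho⟩ := Finset.exists_mem_notMem_of_card_lt_card (t := Finset.univ) hcard
    rw [Finset.mem_union, not_or] at ho
    exact ⟨o, fun hs => ho.2.1 (Equiv.Perm.mem_support_cycleOf_iff.2
      ⟨hs, Equiv.Perm.mem_support.2 hq⟩), fun hs => ho.2.2 (Equiv.Perm.mem_support_cycleOf_iff.2
      ⟨hs, Equiv.Perm.mem_support.2 hp⟩)⟩

theorem exists_isThreeFive
    (h : σ.cycleType.filter (fun l => 3 ∣ l ∨ 5 ∣ l) = {3, 5}) :
    ∃ l q p, IsThreeFive σ l q p := by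
  have hsplit := Multiset.filter_add_not (fun l => 3 ∣ l ∨ 5 ∣ l) σ.cycleType
  rw [h] at hsplit
  set L := Multiset.filter (fun l => ¬ (3 ∣ l ∨ 5 ∣ l)) σ.cycleType with hL
  have hLm : ∀ m ∈ L, m.Coprime 15 ∧ m ∈ σ.cycleType := by
    intro m hm
    rw [hL, Multiset.mem_filter] at hm
    refine ⟨?_, hm.1⟩
    rw [show 15 = 3 * 5 from rfl]
    exact Nat.Coprime.mul_right
      ((Nat.Prime.coprime_iff_not_dvd (by norm_num)).2 fun h => hm.2 (Or.inl h)).symm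
      ((Nat.Prime.coprime_iff_not_dvd (by norm_num)).2 fun h => hm.2 (Or.inr h)).symm
  have hcop : L.lcm.Coprime 15 := by
    have : ∀ M : Multiset ℕ, (∀ m ∈ M, m.Coprime 15) → M.lcm.Coprime 15 := by
      intro M
      induction M using Multiset.induction with
      | empty => simp
      | cons a M ih =>
        intro hM
        rw [Multiset.lcm_cons]
        exact Nat.Coprime.coprime_dvd_left (Nat.lcm_dvd_mul a M.lcm)
          ((hM a (by simp)).mul_left (ih fun m hm => hM m (by simp [hm])))
    exact this L fun m hm => (hLm m hm).1
  have h3 : 3 ∈ σ.cycleType := by rw [← hsplit]; simp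
  have h5 : 5 ∈ σ.cycleType := by rw [← hsplit]; simp
  have hnot : ∀ m, (3 ∣ m ∨ 5 ∣ m) → L.count m = 0 := fun m hm =>
    Multiset.count_eq_zero.2 fun h' => (Multiset.mem_filter.1 h').2 hm
  have c3 : σ.cycleType.count 3 = 1 := by
    rw [← hsplit, Multiset.count_add, hnot 3 (Or.inl dvd_rfl)]; rfl
  have c5 : σ.cycleType.count 5 = 1 := by
    rw [← hsplit, Multiset.count_add, hnot 5 (Or.inr dvd_rfl)]; rfl
  obtain ⟨q, hq, hq3⟩ := Equiv.Perm.exists_minimalPeriod_eq h3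
  obtain ⟨p, hp, hp5⟩ := Equiv.Perm.exists_minimalPeriod_eq h5
  have hmem : ∀ m ∈ σ.cycleType, m = 3 ∨ m = 5 ∨ m ∣ L.lcm := by
    intro m hm
    rw [← hsplit, Multiset.mem_add] at hm
    rcases hm with hm | hm
    · simp at hm; tauto
    · exact Or.inr (Or.inr (Multiset.dvd_lcm hm))
  have hper : ∀ j t, Function.minimalPeriod σ j ∣ t → (σ ^ t) j = j := by
    intro j t ht
    rw [← Equiv.Perm.iterate_eq_pow]
    exact Function.isPeriodicPt_iff_minimalPeriod_dvd.2 ht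
  have hfix : ∀ j t, σ j = j → (σ ^ t) j = j := fun j t hj =>
    Equiv.Perm.pow_apply_eq_self_of_apply_eq_self hj t
  have hex : ∀ i j, σ.SameCycle i j → ∃ r, j = σ^[r] i := by
    intro i j hij
    obtain ⟨r, -, hr⟩ := hij.exists_pow_eq'
    exact ⟨r, by rw [Equiv.Perm.iterate_eq_pow, hr]⟩
  refine ⟨L.lcm, q, p, hcop, ?_, hq3, hp5, ?_, ?_, L, rfl, fun m hm => ⟨(hLm m hm).1, ?_⟩⟩
  · rw [← Equiv.Perm.lcm_cycleType, ← hsplit, Multiset.lcm_add]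
    have : ({3, 5} : Multiset ℕ).lcm = 15 := by decide
    rw [this]
    exact Nat.Coprime.lcm_eq_mul hcop.symm
  · intro j hj
    by_cases hjf : σ j = j
    · exact hfix j _ hjf
    refine hper j _ ?_
    rcases hmem _ (Equiv.Perm.minimalPeriod_mem_cycleType hjf) with h' | h' | h'
    · obtain ⟨r, hr⟩ := hex q j
        (Equiv.Perm.sameCycle_of_count_eq_one hq (hq3.trans h'.symm) (hq3.symm ▸ c3))
      exact absurd hr (hj r)
    · rw [h']; exact Dvd.intro _ rfl
    · exact h'.mul_left 5
  · intro j hj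
    by_cases hjf : σ j = j
    · exact hfix j _ hjf
    refine hper j _ ?_
    rcases hmem _ (Equiv.Perm.minimalPeriod_mem_cycleType hjf) with h' | h' | h'
    · rw [h']; exact Dvd.intro _ rfl
    · obtain ⟨r, hr⟩ := hex p j
        (Equiv.Perm.sameCycle_of_count_eq_one hp (hp5.trans h'.symm) (hp5.symm ▸ c5))
      exact absurd hr (hj r)
    · exact h'.mul_left 3
  · obtain ⟨j, -, hj⟩ := Equiv.Perm.exists_minimalPeriod_eq (hLm m hm).2
    exact ⟨j, hj⟩

end CycleType

section CycleParam

variable {α : Type*} {σ : Equiv.Perm α} {l : ℕ} {q p : α}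

theorem exists_param_of_minimalPeriod {m K : ℕ} [NeZero m] (hm : 1 < m)
    (hp : Function.minimalPeriod σ p = m)
    (hK : K.Coprime m) :
    ∃ a : Fin m → α, Function.Injective a ∧ (∀ i, (σ ^ K) (a i) = a (i + 1)) ∧
      ∀ j, (∀ i, j ≠ a i) → ∀ r, j ≠ σ^[r] p := by
  have hK0 : K ≠ 0 := by rintro rfl; simp at hK; omega
  have hper : Function.minimalPeriod (σ ^ K) p = m := by
    rw [← Equiv.Perm.iterate_eq_pow, Function.minimalPeriod_iterate_eq_div_gcd hK0, hp,
      Nat.Coprime.gcd_eq_one hK.symm, Nat.div_one]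
  have hmod : ∀ t, (σ ^ K)^[t % m] p = (σ ^ K)^[t] p := fun t => by
    rw [← hper, Function.iterate_mod_minimalPeriod_eq]
  refine ⟨fun i => (σ ^ K)^[i] p, ?_, ?_, ?_⟩
  · intro i j hij
    exact Fin.ext (Function.iterate_injOn_Iio_minimalPeriod
      (by rw [hper]; exact i.2) (by rw [hper]; exact j.2) hij)
  · intro i
    change _ = (σ ^ K)^[(i + 1 : Fin m)] p
    rw [← Function.iterate_succ_apply' (σ ^ K), ← hmod, Fin.val_add]
    congr 2
    simp [Nat.mod_eq_of_lt hm]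
  · rintro j hj r rfl
    obtain ⟨a, -, ha⟩ := Nat.exists_mul_mod_eq_one_of_coprime hK hm
    refine hj ⟨(a * r) % m, Nat.mod_lt _ (by omega)⟩ ?_
    change _ = (σ ^ K)^[(a * r) % m] p
    rw [hmod, ← Equiv.Perm.iterate_eq_pow, ← Function.iterate_mul,
      ← Function.iterate_mod_minimalPeriod_eq (n := r),
      ← Function.iterate_mod_minimalPeriod_eq (n := K * (a * r)), hp, ← mul_assoc, Nat.mul_mod, ha]
    simp

theorem IsThreeFive.exists_param_three (h : IsThreeFive σ l q p) :
    ∃ a : Fin 3 → α, Function.Injective a ∧ (∀ i, (σ ^ (5 * l)) (a i) = a (i + 1)) ∧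
      ∀ j, (∀ i, j ≠ a i) → (σ ^ (5 * l)) j = j := by
  obtain ⟨a, h1, h2, h3⟩ := exists_param_of_minimalPeriod (K := 5 * l) (by norm_num) h.period_three
    (Nat.Coprime.mul_left (by norm_num) (h.coprime.coprime_dvd_right (by norm_num)))
  exact ⟨a, h1, h2, fun j hj => h.pow_three j (h3 j hj)⟩

theorem IsThreeFive.exists_param_five (h : IsThreeFive σ l q p) :
    ∃ a : Fin 5 → α, Function.Injective a ∧ (∀ i, (σ ^ (3 * l)) (a i) = a (i + 1)) ∧
      ∀ j, (∀ i, j ≠ a i) → (σ ^ (3 * l)) j = j := by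
  obtain ⟨a, h1, h2, h3⟩ := exists_param_of_minimalPeriod (K := 3 * l) (by norm_num) h.period_five
    (Nat.Coprime.mul_left (by norm_num) (h.coprime.coprime_dvd_right (by norm_num)))
  exact ⟨a, h1, h2, fun j hj => h.pow_five j (h3 j hj)⟩

end CycleParam

section RootsOfUnity

theorem exists_mul_of_pow_lcm_eq_one {ξ : ℂ} {a b : ℕ} (ha : 0 < a) (hb : 0 < b)
    (h : ξ ^ (a.lcm b) = 1) :
    ∃ x y : ℂ, x ^ a = 1 ∧ y ^ b = 1 ∧ ξ = x * y := by
  obtain ⟨a', b', hco, ha', hb'⟩ := Nat.exists_coprime a b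
  set d := a.gcd b with hd
  have hξ0 : ξ ≠ 0 := by
    rintro rfl
    rw [zero_pow (Nat.lcm_pos ha hb).ne'] at h
    exact zero_ne_one h
  have h1 : a.lcm b = a' * b := by
    apply Nat.eq_of_mul_eq_mul_left (Nat.gcd_pos_of_pos_left b ha)
    rw [Nat.gcd_mul_lcm, ← hd]
    conv_lhs => rw [ha']
    ring
  have h2 : a.lcm b = b' * a := by
    apply Nat.eq_of_mul_eq_mul_left (Nat.gcd_pos_of_pos_left b ha)
    rw [Nat.gcd_mul_lcm, ← hd]
    conv_lhs => rw [hb']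
    ring
  have hbez := Nat.gcd_eq_gcd_ab a' b'
  rw [hco.gcd_eq_one] at hbez
  refine ⟨(ξ ^ b') ^ (Nat.gcdB a' b'), (ξ ^ a') ^ (Nat.gcdA a' b'), ?_, ?_, ?_⟩
  · rw [← zpow_natCast, zpow_comm, zpow_natCast, ← pow_mul, ← h2, h, one_zpow]
  · rw [← zpow_natCast, zpow_comm, zpow_natCast, ← pow_mul, ← h1, h, one_zpow]
  · rw [← zpow_natCast, ← zpow_natCast, ← zpow_mul, ← zpow_mul, ← zpow_add₀ hξ0, add_comm, ← hbez]
    simp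

theorem exists_pow_mul_pow_eq_one {β : ℂ} {m K : ℕ} (hm : 1 < m) (hK : K.Coprime m)
    (hβ : β ^ m = 1) : ∃ ν : ℂ, ν ^ m = 1 ∧ β * ν ^ K = 1 := by
  obtain ⟨a, -, ha⟩ := Nat.exists_mul_mod_eq_one_of_coprime hK hm
  have hβ0 : β ≠ 0 := by
    rintro rfl
    rw [zero_pow (by omega)] at hβ
    exact zero_ne_one hβ
  refine ⟨(β⁻¹) ^ a, ?_, ?_⟩
  · rw [← pow_mul, mul_comm, pow_mul, inv_pow, hβ, inv_one, one_pow]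
  · have h1 : (β⁻¹) ^ (K * a) = β⁻¹ := by
      rw [← Nat.div_add_mod (K * a) m, ha, pow_add, pow_mul, inv_pow β m, hβ, inv_one, one_pow,
        one_mul, pow_one]
    rw [← pow_mul, mul_comm a K, h1, mul_inv_cancel₀ hβ0]

end RootsOfUnity

section Spectrum

variable {S : Type} [AddCommGroup S] [Module ℂ S] {n : ℕ} {e : Fin n → Module.End ℂ S}
variable {σ : Equiv.Perm (Fin n)} {p q : Fin n} {m : ℕ} {χ : ℂ} {G : Module.End ℂ S}

theorem IsClifford.exists_eigenvalue_mul_root (he : IsClifford e) (hn : n ≠ 0) (hχ : χ * χ = 1)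
    (hG : ∀ j, G * e j = χ • (e (σ j) * G)) (hm : Function.minimalPeriod σ p = m)
    (hm' : m.Coprime 15) {μ ξ : ℂ} (hμ : ∃ x ≠ 0, G x = μ • x) (hξ : ξ ^ m = 1) :
    ∃ x ≠ 0, G x = (μ * ξ) • x := by
  have hm0 : m ≠ 0 := by rintro rfl; norm_num at hm'
  obtain ⟨ω, hω, hrun⟩ := he.exists_eigenvalue_run hn hχ hG hm (Complex.isPrimitiveRoot_exp m hm0) hμ
  have hω0 : ω ≠ 0 := by
    rintro rfl
    rw [zero_pow hm0] at hω
    exact zero_ne_one hω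
  have : NeZero m := ⟨hm0⟩
  obtain ⟨t, ht, htξ⟩ := (Complex.isPrimitiveRoot_exp m hm0).eq_pow_of_pow_eq_one
    (ξ := ξ * ω⁻¹) (by rw [mul_pow, hξ, inv_pow, hω, inv_one, one_mul])
  have hb : m ≤ (m / 2) * (m / 2 + 1) / 2 + 1 := by
    have h3 : m ≠ 3 := by rintro rfl; norm_num at hm'
    have h5 : m ≠ 5 := by rintro rfl; norm_num at hm'
    rcases Nat.lt_or_ge m 8 with h | h
    · interval_cases m <;> omega
    · have : m / 2 * 4 ≤ m / 2 * (m / 2 + 1) := Nat.mul_le_mul_left _ (by omega)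
      omega
  have := hrun t (by omega)
  rwa [htξ, mul_comm ω, mul_assoc, inv_mul_cancel₀ hω0, mul_one] at this

theorem IsClifford.exists_eigenvalue_mul_root_lcm (he : IsClifford e) (hn : n ≠ 0)
    (hχ : χ * χ = 1) (hG : ∀ j, G * e j = χ • (e (σ j) * G)) (L : Multiset ℕ)
    (hL : ∀ m ∈ L, m.Coprime 15 ∧ ∃ j, Function.minimalPeriod σ j = m) :
    ∀ {μ ξ : ℂ}, (∃ x ≠ 0, G x = μ • x) → ξ ^ L.lcm = 1 → ∃ x ≠ 0, G x = (μ * ξ) • x := by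
  induction L using Multiset.induction with
  | empty =>
    intro μ ξ hμ hξ
    rw [Multiset.lcm_zero, pow_one] at hξ
    simpa [hξ] using hμ
  | cons a L ih =>
    intro μ ξ hμ hξ
    have hL' : ∀ m ∈ L, m.Coprime 15 ∧ ∃ j, Function.minimalPeriod σ j = m :=
      fun m hm => hL m (Multiset.mem_cons_of_mem hm)
    have hpos : ∀ m : ℕ, m.Coprime 15 → 0 < m := fun m hm =>
      Nat.pos_of_ne_zero (by rintro rfl; norm_num at hm)
    obtain ⟨ha, j, hj⟩ := hL a (Multiset.mem_cons_self a L)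
    rw [Multiset.lcm_cons] at hξ
    have hLpos : 0 < L.lcm := Nat.pos_of_ne_zero fun h0 => by
      rw [Multiset.lcm_eq_zero_iff] at h0
      exact absurd (hpos 0 (hL' 0 h0).1) (lt_irrefl 0)
    obtain ⟨x, y, hx, hy, rfl⟩ := exists_mul_of_pow_lcm_eq_one (hpos a ha) hLpos hξ
    rw [← mul_assoc]
    exact ih hL' (he.exists_eigenvalue_mul_root hn hχ hG hj ha hμ hx) hy

theorem IsClifford.exists_eigenvalue_mul_root_of_ne (he : IsClifford e) (hn : n ≠ 0)
    (hχ : χ * χ = 1) (hG : ∀ j, G * e j = χ • (e (σ j) * G))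
    (hm : Function.minimalPeriod σ p = m) (hm35 : m = 3 ∨ m = 5) {K : ℕ} (hK : K.Coprime m)
    {ε : ℂ} (hroot : ∀ μ : ℂ, (∃ x ≠ 0, G x = μ • x) → (ε * μ ^ K) ^ m = 1 ∧ ε * μ ^ K ≠ 1)
    {μ ξ : ℂ} (hμ : ∃ x ≠ 0, G x = μ • x) (hξ : ξ ^ m = 1) (hne : ε * (μ * ξ) ^ K ≠ 1) :
    ∃ x ≠ 0, G x = (μ * ξ) • x := by
  have hm1 : 1 < m := by omega
  obtain ⟨ω, hω, hrun⟩ := he.exists_eigenvalue_run hn hχ hG hm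
    (Complex.isPrimitiveRoot_exp m (by omega)) hμ
  have hω0 : ω ≠ 0 := by
    rintro rfl
    rw [zero_pow (by omega)] at hω
    exact zero_ne_one hω
  have : NeZero m := ⟨by omega⟩
  have hb : m ≤ (m / 2) * (m / 2 + 1) / 2 + 2 := by rcases hm35 with rfl | rfl <;> norm_num
  have key : ∀ η : ℂ, η ^ m = 1 → (∃ x ≠ 0, G x = (μ * η) • x) ∨
      η = ω * Complex.exp (2 * Real.pi * Complex.I / m) ^ (m - 1) := by
    intro η hη
    obtain ⟨t, ht, htη⟩ := (Complex.isPrimitiveRoot_exp m (by omega)).eq_pow_of_pow_eq_one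
      (ξ := η * ω⁻¹) (by rw [mul_pow, hη, inv_pow, hω, inv_one, one_mul])
    have hη' : η = ω * Complex.exp (2 * Real.pi * Complex.I / m) ^ t := by
      rw [htη, mul_comm ω, mul_assoc, inv_mul_cancel₀ hω0, mul_one]
    by_cases htm : t = m - 1
    · exact Or.inr (htm ▸ hη')
    · exact Or.inl (hη' ▸ hrun t (by omega))
  obtain ⟨ν, hν, hν1⟩ := exists_pow_mul_pow_eq_one hm1 hK (hroot μ hμ).1
  have hν2 : ε * (μ * ν) ^ K = 1 := by rw [mul_pow, ← mul_assoc, hν1]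
  rcases key ξ hξ with h | h
  · exact h
  rcases key ν hν with h' | h'
  · exact absurd hν2 (hroot _ h').2
  · exact absurd (by rwa [h, ← h']) hne

end Spectrum

section Cover

variable {S : Type} [AddCommGroup S] [Module ℂ S] {n : ℕ} {e : Fin n → Module.End ℂ S}
variable {p q : Fin n} {l : ℕ}

open Schur

variable {φ : Cover n →* Module.End ℂ S} {π : Cover n →* Equiv.Perm (Fin n)}

theorem pow_apply_of_eigenvector {G : Module.End ℂ S} {x : S} {μ : ℂ} (h : G x = μ • x) (t : ℕ) :
    (G ^ t) x = μ ^ t • x := by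
  induction t with
  | zero => simp
  | succ t ih => rw [pow_succ', Module.End.mul_apply, ih, map_smul, h, smul_smul, pow_succ]

theorem IsSpinLift.mul_of_odd (h : IsSpinLift e φ π) {g : Cover n} {t : ℕ} (ht : Odd t)
    (hg : π g ^ t = 1) (j : Fin n) : φ g * e j = e (π g j) * φ g := by
  have h1 : Equiv.Perm.sign (π g) ^ t = 1 := by rw [← map_pow, hg, map_one]
  have h2 : Equiv.Perm.sign (π g) = 1 := by
    rcases Int.units_eq_one_or (Equiv.Perm.sign (π g)) with h3 | h3
    · exact h3
    · rw [h3, ht.neg_one_pow] at h1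
      exact absurd h1 (by decide)
  rw [h.map_mul, h2]
  simp

theorem det_smul_pow_four {ε : ℂ} (hε : ε ^ 2 = 1) {X : Module.End ℂ S} (hX : LinearMap.det X ^ 4 = 1) :
    LinearMap.det (ε • X) ^ 4 = 1 := by
  rw [LinearMap.det_smul, mul_pow, hX, mul_one, ← pow_mul, mul_comm _ 4, pow_mul,
    show 4 = 2 * 2 from rfl, pow_mul, hε, one_pow, one_pow]

variable [FiniteDimensional ℂ S] [Nontrivial S] {g : Cover n} {ε : ℂ}

theorem IsSpinLift.eq_zero_of_pow_three (h : IsSpinLift e φ π)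
    (hS : Module.finrank ℂ S = 2 ^ (n / 2)) (hg : IsThreeFive (π g) l q p) (hε : ε ^ 2 = 1)
    (hk : φ g ^ (15 * l) = ε • 1) {x : S} (hx : ε • (φ g ^ (5 * l)) x = x) : x = 0 := by
  obtain ⟨a, ha, ha1, ha2⟩ := hg.exists_param_three
  have hπ : π (g ^ (5 * l)) ^ 3 = 1 := by
    rw [map_pow, ← pow_mul, show 5 * l * 3 = 15 * l by ring, ← hg.orderOf_eq, pow_orderOf_eq_one]
  refine h.clifford.eq_zero_of_three_cycle hS (X := ε • φ (g ^ (5 * l))) ha ha1 ha2 ?_ ?_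
    (det_smul_pow_four hε (h.det_pow_four _)) (by simpa using hx)
  · intro j
    rw [smul_mul_assoc, h.mul_of_odd (by decide) hπ, mul_smul_comm, map_pow]
  · rw [map_pow, smul_pow, ← pow_mul, show 5 * l * 3 = 15 * l by ring, hk, smul_smul, ← pow_succ,
      show 3 + 1 = 2 * 2 from rfl, pow_mul, hε, one_pow, one_smul]

theorem IsSpinLift.eq_zero_of_pow_five (h : IsSpinLift e φ π)
    (hS : Module.finrank ℂ S = 2 ^ (n / 2)) (hg : IsThreeFive (π g) l q p) (hε : ε ^ 2 = 1)
    (hk : φ g ^ (15 * l) = ε • 1) {x : S} (hx : ε • (φ g ^ (3 * l)) x = x) : x = 0 := by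
  obtain ⟨a, ha, ha1, ha2⟩ := hg.exists_param_five
  have hπ : π (g ^ (3 * l)) ^ 5 = 1 := by
    rw [map_pow, ← pow_mul, show 3 * l * 5 = 15 * l by ring, ← hg.orderOf_eq, pow_orderOf_eq_one]
  refine h.clifford.eq_zero_of_five_cycle hS (X := ε • φ (g ^ (3 * l))) ha ha1 ha2 ?_ ?_
    (det_smul_pow_four hε (h.det_pow_four _)) (by simpa using hx)
  · intro j
    rw [smul_mul_assoc, h.mul_of_odd (by decide) hπ, mul_smul_comm, map_pow]
  · rw [map_pow, smul_pow, ← pow_mul, show 3 * l * 5 = 15 * l by ring, hk, smul_smul, ← pow_succ,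
      show 5 + 1 = 2 * 3 from rfl, pow_mul, hε, one_pow, one_smul]

theorem IsSpinLift.exists_eigenvector (h : IsSpinLift e φ π)
    (hS : Module.finrank ℂ S = 2 ^ (n / 2)) (hg : IsThreeFive (π g) l q p) (hε : ε ^ 2 = 1)
    (hk : φ g ^ (15 * l) = ε • 1) {μ : ℂ} (hμ : μ ^ (15 * l) = ε)
    (h3 : ε * μ ^ (5 * l) ≠ 1) (h5 : ε * μ ^ (3 * l) ≠ 1) : ∃ x ≠ 0, φ g x = μ • x := by
  have hn : n ≠ 0 := by rintro rfl; exact p.elim0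
  have hl0 : l ≠ 0 := by rintro rfl; exact absurd hg.coprime (by norm_num)
  have hε0 : ε ≠ 0 := by rintro rfl; simp at hε
  have hχ := perm_sign_mul_self (π g)
  have hroot : ∀ ν : ℂ, (∃ x ≠ 0, φ g x = ν • x) → ν ^ (15 * l) = ε := by
    rintro ν ⟨x, hx0, hx⟩
    have h1 := pow_apply_of_eigenvector hx (15 * l)
    rw [hk] at h1
    exact (smul_left_injective ℂ hx0 h1).symm
  have hroot3 : ∀ ν : ℂ, (∃ x ≠ 0, φ g x = ν • x) →
      (ε * ν ^ (5 * l)) ^ 3 = 1 ∧ ε * ν ^ (5 * l) ≠ 1 := by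
    intro ν hν
    refine ⟨?_, fun h1 => ?_⟩
    · rw [mul_pow, ← pow_mul, show 5 * l * 3 = 15 * l by ring, hroot ν hν, ← pow_succ,
        show 3 + 1 = 2 * 2 from rfl, pow_mul, hε, one_pow]
    · obtain ⟨x, hx0, hx⟩ := hν
      refine hx0 (h.eq_zero_of_pow_three hS hg hε hk ?_)
      rw [pow_apply_of_eigenvector hx, smul_smul, h1, one_smul]
  have hroot5 : ∀ ν : ℂ, (∃ x ≠ 0, φ g x = ν • x) →
      (ε * ν ^ (3 * l)) ^ 5 = 1 ∧ ε * ν ^ (3 * l) ≠ 1 := by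
    intro ν hν
    refine ⟨?_, fun h1 => ?_⟩
    · rw [mul_pow, ← pow_mul, show 3 * l * 5 = 15 * l by ring, hroot ν hν, ← pow_succ,
        show 5 + 1 = 2 * 3 from rfl, pow_mul, hε, one_pow]
    · obtain ⟨x, hx0, hx⟩ := hν
      refine hx0 (h.eq_zero_of_pow_five hS hg hε hk ?_)
      rw [pow_apply_of_eigenvector hx, smul_smul, h1, one_smul]
  obtain ⟨ν, hν⟩ := Module.End.exists_eigenvalue (φ g)
  obtain ⟨x, hx⟩ := hν.exists_hasEigenvector
  have hν : ∃ x ≠ 0, φ g x = ν • x := ⟨x, hx.2, hx.apply_eq_smul⟩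
  have hν0 : ν ≠ 0 := by
    rintro rfl
    have := hroot 0 hν
    rw [zero_pow (by omega)] at this
    exact hε0 this.symm
  have hq : (μ / ν) ^ ((3 * 5) * l) = 1 := by
    rw [div_pow, hμ, hroot ν hν, div_self hε0]
  rw [← Nat.Coprime.lcm_eq_mul hg.coprime.symm] at hq
  obtain ⟨y, w, hy, hw, hyw⟩ := exists_mul_of_pow_lcm_eq_one (by norm_num) (Nat.pos_of_ne_zero hl0) hq
  obtain ⟨u, v, hu, hv, rfl⟩ := exists_mul_of_pow_lcm_eq_one (a := 3) (b := 5) (by norm_num)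
    (by norm_num) hy
  have hμ' : μ = ν * w * u * v := by
    rw [div_eq_iff hν0] at hyw
    rw [hyw]; ring
  obtain ⟨L, hLl, hL⟩ := hg.exists_lcm
  have s1 := h.clifford.exists_eigenvalue_mul_root_lcm hn hχ (h.map_mul g) L hL hν (ξ := w)
    (by rw [hLl, hw])
  have s2 := h.clifford.exists_eigenvalue_mul_root_of_ne hn hχ (h.map_mul g) hg.period_three
    (Or.inl rfl) (Nat.Coprime.mul_left (by norm_num) (hg.coprime.coprime_dvd_right (by norm_num)))
    hroot3 s1 hu (by
      rw [hμ', mul_pow _ v, pow_mul v, hv, one_pow, mul_one] at h3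
      exact h3)
  rw [hμ']
  exact h.clifford.exists_eigenvalue_mul_root_of_ne hn hχ (h.map_mul g) hg.period_five
    (Or.inr rfl) (Nat.Coprime.mul_left (by norm_num) (hg.coprime.coprime_dvd_right (by norm_num)))
    hroot5 s2 hv (by rwa [hμ'] at h5)

end Cover

section CliffordVector

variable {S : Type} [AddCommGroup S] [Module ℂ S] {n : ℕ} {e : Fin n → Module.End ℂ S}

/-- The vector `v` as an element of the Clifford algebra. -/
noncomputable def cliffordVec (e : Fin n → Module.End ℂ S) (v : Fin n → ℂ) : Module.End ℂ S :=
  ∑ i, v i • e i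

theorem IsClifford.cliffordVec_mul (he : IsClifford e) (v : Fin n → ℂ) (j : Fin n) :
    cliffordVec e v * e j + e j * cliffordVec e v = (2 * v j) • 1 := by
  rw [cliffordVec, Finset.sum_mul, Finset.mul_sum, ← Finset.sum_add_distrib,
    Finset.sum_eq_single j]
  · rw [smul_mul_assoc, mul_smul_comm, he.sq]; module
  · intro i _ hij
    rw [smul_mul_assoc, mul_smul_comm, he.anti i j hij, smul_neg, neg_add_cancel]
  · intro h; exact absurd (Finset.mem_univ j) h

theorem IsClifford.cliffordVec_mul_add (he : IsClifford e) (v w : Fin n → ℂ) :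
    cliffordVec e v * cliffordVec e w + cliffordVec e w * cliffordVec e v =
      (2 * ∑ i, w i * v i) • 1 := by
  conv_lhs => rw [cliffordVec.eq_def e w]
  rw [Finset.sum_mul, Finset.mul_sum, ← Finset.sum_add_distrib, Finset.mul_sum, Finset.sum_smul]
  refine Finset.sum_congr rfl fun j _ => ?_
  rw [smul_mul_assoc, mul_smul_comm, ← smul_add, he.cliffordVec_mul, smul_smul]
  congr 1; ring

theorem IsClifford.cliffordVec_mul_self (he : IsClifford e) (v : Fin n → ℂ) :
    cliffordVec e v * cliffordVec e v = (∑ i, v i * v i) • 1 := by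
  have h := he.cliffordVec_mul_add v v
  rw [← two_smul ℂ, mul_smul] at h
  exact smul_right_injective _ (two_ne_zero (α := ℂ)) h

theorem sum_eq_cliffordVec : ∑ i, e i = cliffordVec e 1 := by simp [cliffordVec]

theorem IsClifford.cliffordVec_mul_inv (he : IsClifford e) (κ : ℂ) {v : Fin n → ℂ}
    (hv : ∑ i, v i = 0) {q : Fin n} (hq : v q = 0) :
    cliffordVec e v * projInv e κ q = projInv e κ q * cliffordVec e v := by
  have h1 := he.cliffordVec_mul v q
  have h2 := he.cliffordVec_mul_add v 1
  rw [hq, mul_zero, zero_smul] at h1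
  simp only [Pi.one_apply, one_mul, hv, mul_zero, zero_smul] at h2
  rw [projInv, sum_eq_cliffordVec, mul_smul_comm, smul_mul_assoc, mul_sub, sub_mul, ← mul_assoc,
    eq_neg_of_add_eq_zero_left h2, neg_mul, mul_assoc, eq_neg_of_add_eq_zero_left h1, mul_neg,
    neg_neg, mul_assoc, mul_one, one_mul]

theorem mul_cliffordVec {σ : Equiv.Perm (Fin n)} {χ : ℂ} {G : Module.End ℂ S}
    (hG : ∀ j, G * e j = χ • (e (σ j) * G)) {v : Fin n → ℂ} (hv : ∀ j, v (σ j) = v j) :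
    G * cliffordVec e v = χ • (cliffordVec e v * G) := by
  rw [cliffordVec, Finset.mul_sum, Finset.sum_mul, Finset.smul_sum,
    ← Equiv.sum_comp σ fun i => χ • (v i • e i * G)]
  refine Finset.sum_congr rfl fun j _ => ?_
  rw [mul_smul_comm, hG, hv, smul_mul_assoc, smul_comm]

theorem IsClifford.exists_inv_fixed (he : IsClifford e) {κ : ℂ} (hκ : κ * κ * (n - 1) = -1)
    (hn : n ≠ 0)
    {G : Module.End ℂ S} {σ : Equiv.Perm (Fin n)} {χ : ℂ} (hχ : χ * χ = 1)
    (hG : ∀ j, G * e j = χ • (e (σ j) * G)) {v : Fin n → ℂ} (hv : ∀ j, v (σ j) = v j)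
    (hv1 : ∑ i, v i = 0) (hv2 : ∑ i, v i * v i ≠ 0) {q : Fin n} (hq : v q = 0) {m : ℕ}
    (hN : G ^ m * projInv e κ q = projInv e κ q * G ^ m)
    {μ : ℂ} {y : S} (hy0 : y ≠ 0) (hy : (G ^ m) y = μ • y) :
    ∃ x ≠ 0, (G ^ m) x = μ • x ∧ projInv e κ q x = x := by
  set N := projInv e κ q with hNdef
  have hNN := he.inv_mul_self hκ q
  by_cases h0 : y + N y = 0
  · set D := cliffordVec e 1 * cliffordVec e v with hD
    have hGD : Commute (G ^ m) D := by
      refine Commute.pow_left ?_ m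
      change G * D = D * G
      rw [hD, ← mul_assoc, mul_cliffordVec hG (v := 1) (fun _ => rfl), smul_mul_assoc, mul_assoc,
        mul_cliffordVec hG hv, mul_smul_comm, smul_smul, hχ, one_smul, mul_assoc]
    have hND : N * D = -(D * N) := by
      have h1 := he.sum_mul_inv κ q
      rw [sum_eq_cliffordVec] at h1
      rw [hD, mul_assoc, he.cliffordVec_mul_inv κ hv1 hq, ← mul_assoc, ← mul_assoc, h1, neg_mul,
        neg_neg]
    refine ⟨D y, fun hD0 => hy0 ?_, ?_, ?_⟩
    · have h1 := LinearMap.congr_fun (he.cliffordVec_mul_self (1 : Fin n → ℂ)) (cliffordVec e v y)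
      rw [Module.End.mul_apply, ← Module.End.mul_apply _ _ y, ← hD, hD0, map_zero] at h1
      have h2 := LinearMap.congr_fun (he.cliffordVec_mul_self v) y
      have h3 : cliffordVec e v y = 0 := by
        have h4 : (∑ i : Fin n, (1 : Fin n → ℂ) i * (1 : Fin n → ℂ) i) ≠ 0 := by simpa using hn
        exact (smul_eq_zero.1 h1.symm).resolve_left h4
      rw [Module.End.mul_apply, h3, map_zero] at h2
      exact (smul_eq_zero.1 h2.symm).resolve_left hv2
    · rw [← Module.End.mul_apply, hGD.eq, Module.End.mul_apply, hy, map_smul]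
    · rw [← Module.End.mul_apply, hND, LinearMap.neg_apply, Module.End.mul_apply,
        eq_neg_of_add_eq_zero_right h0, map_neg, neg_neg]
  · refine ⟨y + N y, h0, ?_, ?_⟩
    · rw [map_add, ← Module.End.mul_apply, hN, Module.End.mul_apply, hy, map_smul, smul_add]
    · rw [map_add, ← Module.End.mul_apply N N, hNN, Module.End.one_apply, add_comm]

theorem exists_balanced {σ : Equiv.Perm (Fin n)} (A B : Set (Fin n))
    (hA : ∀ j, σ j ∈ A ↔ j ∈ A) (hB : ∀ j, σ j ∈ B ↔ j ∈ B) (hAB : ∀ j, j ∈ A → j ∉ B)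
    (hA0 : A.Nonempty) (hB0 : B.Nonempty) {q : Fin n} (hqA : q ∉ A) (hqB : q ∉ B) :
    ∃ v : Fin n → ℂ, (∀ j, v (σ j) = v j) ∧ ∑ i, v i = 0 ∧ ∑ i, v i * v i ≠ 0 ∧ v q = 0 := by
  classical
  set a : ℕ := (Finset.univ.filter (· ∈ A)).card with ha
  set b : ℕ := (Finset.univ.filter (· ∈ B)).card with hb
  obtain ⟨i, hi⟩ := hA0
  have hb0 : b ≠ 0 := by
    obtain ⟨j, hj⟩ := hB0
    exact (Finset.card_pos.2 ⟨j, by simpa using hj⟩).ne'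
  let w : Fin n → ℝ := fun j => (if j ∈ A then (b : ℝ) else 0) - (if j ∈ B then (a : ℝ) else 0)
  refine ⟨fun j => (w j : ℂ), fun j => ?_, ?_, ?_, ?_⟩
  · simp only [w, hA, hB]
  · rw [← Complex.ofReal_sum]
    simp only [w]
    rw [Finset.sum_sub_distrib, ← Finset.sum_filter, ← Finset.sum_filter, Finset.sum_const,
      Finset.sum_const, ← ha, ← hb, nsmul_eq_mul, nsmul_eq_mul, mul_comm, sub_self,
      Complex.ofReal_zero]
  · have h1 : ∑ j, ((w j : ℂ) * (w j : ℂ)) = ((∑ j, w j * w j : ℝ) : ℂ) := by push_cast; rfl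
    rw [h1, Complex.ofReal_ne_zero]
    refine (Finset.sum_pos' (fun j _ => mul_self_nonneg _) ⟨i, Finset.mem_univ i, ?_⟩).ne'
    have h2 : w i = b := by simp [w, hi, hAB i hi]
    have h3 : 0 < (b : ℝ) := Nat.cast_pos.2 (Nat.pos_of_ne_zero hb0)
    rw [h2]
    exact mul_pos h3 h3
  · simp [w, hqA, hqB]

end CliffordVector

section StdEigenvectors

variable {S : Type} [AddCommGroup S] [Module ℂ S] {n : ℕ} {e : Fin n → Module.End ℂ S}

open Schur

variable {φ : Cover n →* Module.End ℂ S} {π : Cover n →* Equiv.Perm (Fin n)} {g : Cover n}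

theorem IsSpinLift.exists_stdSub_of_two_orbits [FiniteDimensional ℂ S] (h : IsSpinLift e φ π)
    {κ : ℂ} (hκ : κ * κ * (n - 1) = -1) {a b : Fin n → ℂ} (ha : ∀ j, a (π g j) = a j)
    (hb : ∀ j, b (π g j) = b j) {p q : Fin n} (hq : π g q ≠ q) (hp : π g p ≠ p)
    (haq : a q = 1) (hbq : b q = 0) (hap : a p = 0) (hbp : b p = 1) {μ : ℂ}
    (hμ : ∃ y ≠ 0, φ g y = μ • y) :
    ∃ x ∈ stdSub e κ, x ≠ 0 ∧ permRep φ π g x = μ • x := by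
  let E := LinearMap.ker (φ g - μ • 1)
  have hE : ∀ y, y ∈ E ↔ φ g y = μ • y := fun y => by
    rw [LinearMap.mem_ker, LinearMap.sub_apply, LinearMap.smul_apply, Module.End.one_apply,
      sub_eq_zero]
  let P : Fin n → Module.End ℂ S := fun j => 1 + projInv e κ j
  have hP : ∀ j y, φ g (P j y) = P (π g j) (φ g y) := fun j y => by
    have := LinearMap.congr_fun (h.mul_inv κ g j) y
    simp only [Module.End.mul_apply] at this
    simp [P, this]
  have hNP : ∀ j y, projInv e κ j (P j y) = P j y := fun j y => by
    have := LinearMap.congr_fun (h.clifford.inv_mul_self hκ j) y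
    simp only [Module.End.mul_apply, Module.End.one_apply] at this
    simp [P, this, add_comm]
  have hP0 : ∀ j y, P (π g j) y = 0 → P j y = 0 → π g j ≠ j → y = 0 := fun j y h1 h2 h3 => by
    refine h.clifford.eq_zero_of_inv_apply hκ h3 (s := -1) (by norm_num) ?_ ?_
    · rw [neg_one_smul]; exact eq_neg_of_add_eq_zero_right (by simpa [P] using h1)
    · rw [neg_one_smul]; exact eq_neg_of_add_eq_zero_right (by simpa [P] using h2)
  have hsum : ∀ c : Fin n → ℂ, (∀ j, c (π g j) = c j) → ∀ y ∈ E, (∑ j, c j • P j) y ∈ E := by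
    intro c hc y hy
    rw [hE] at hy ⊢
    simp only [LinearMap.sum_apply, LinearMap.smul_apply, map_sum, map_smul, hP, hy]
    rw [Finset.smul_sum, ← Equiv.sum_comp (π g) fun j => μ • c j • P j y]
    exact Finset.sum_congr rfl fun j _ => by rw [hc, smul_comm]
  let F : (E × E) →ₗ[ℂ] E := LinearMap.coprod ((∑ j, a j • P j).restrict (hsum a ha))
    ((∑ j, b j • P j).restrict (hsum b hb))
  obtain ⟨y0, hy0, hy0'⟩ := hμ
  have hlt : Module.finrank ℂ E < Module.finrank ℂ (E × E) := by
    have : Nontrivial E := ⟨⟨⟨y0, (hE _).2 hy0'⟩, 0, fun h0 => hy0 (by simpa using h0)⟩⟩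
    have := Module.finrank_pos (R := ℂ) (M := E)
    rw [Module.finrank_prod]
    omega
  obtain ⟨⟨y, w⟩, hyw, hyw0⟩ := (Submodule.ne_bot_iff _).1 (LinearMap.ker_ne_bot_of_finrank_lt (f := F) hlt)
  have hy := (hE _).1 y.2
  have hw := (hE _).1 w.2
  refine ⟨fun j => P j (a j • (y : S) + b j • (w : S)), ⟨fun j => hNP j _, ?_⟩, ?_, ?_⟩
  · have h1 := congrArg Subtype.val (LinearMap.mem_ker.1 hyw)
    simpa [F, Finset.sum_add_distrib] using h1
  · intro hx
    have hx' := fun j => congrFun hx j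
    simp only [Pi.zero_apply] at hx'
    have h1 : (y : S) = 0 := by
      refine hP0 q _ ?_ ?_ hq
      · simpa [ha, hb, haq, hbq] using hx' (π g q)
      · simpa [haq, hbq] using hx' q
    have h2 : (w : S) = 0 := by
      refine hP0 p _ ?_ ?_ hp
      · simpa [ha, hb, hap, hbp] using hx' (π g p)
      · simpa [hap, hbp] using hx' p
    exact hyw0 (Prod.ext (Subtype.ext h1) (Subtype.ext h2))
  · funext j
    obtain ⟨i, rfl⟩ := (π g).surjective j
    rw [permRep_apply_apply, hP, Pi.smul_apply, ha, hb, ← map_smul]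
    congr 1
    rw [map_add, map_smul, map_smul, hy, hw, smul_add, smul_comm μ, smul_comm μ]

theorem IsSpinLift.exists_stdSub_of_orbit (h : IsSpinLift e φ π) {κ : ℂ} {q : Fin n} {m : ℕ}
    (hm : Function.minimalPeriod (π g) q = m) (hm0 : 0 < m) {μ : ℂ} (hμ0 : μ ≠ 0) {x : S} (hx0 : x ≠ 0)
    (hx : (φ g ^ m) x = μ ^ m • x) (hN : projInv e κ q x = x)
    (hz : ∀ s, φ g s = μ • s → s = 0) :
    ∃ x ∈ stdSub e κ, x ≠ 0 ∧ permRep φ π g x = μ • x := by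
  let f : ℕ → Fin n → S := fun r => Pi.single ((π g)^[r] q) ((μ⁻¹) ^ r • (φ g ^ r) x)
  have hf : ∀ r, permRep φ π g (f r) = μ • f (r + 1) := by
    intro r
    funext j
    obtain ⟨i, rfl⟩ := (π g).surjective j
    rw [permRep_apply_apply, Pi.smul_apply]
    simp only [f, Function.iterate_succ_apply']
    by_cases hi : i = (π g)^[r] q
    · subst hi
      rw [Pi.single_eq_same, Pi.single_eq_same, map_smul, smul_smul, pow_succ' μ⁻¹, ← mul_assoc,
        mul_inv_cancel₀ hμ0, one_mul, pow_succ' (φ g), Module.End.mul_apply]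
    · rw [Pi.single_eq_of_ne hi, Pi.single_eq_of_ne (fun h' => hi ((π g).injective h')), map_zero,
        smul_zero]
  have hfm : f m = f 0 := by
    have h4 : (π g)^[m] q = q := hm ▸ Function.iterate_minimalPeriod
    simp only [f, h4, hx, smul_smul, inv_pow, inv_mul_cancel₀ (pow_ne_zero m hμ0)]
    simp
  have hNf : ∀ r j, projInv e κ j (f r j) = f r j := by
    intro r j
    simp only [f]
    by_cases hj : j = (π g)^[r] q
    · subst hj
      have h1 := LinearMap.congr_fun (h.mul_inv κ (g ^ r) q) x
      simp only [Module.End.mul_apply, hN, map_pow, Equiv.Perm.iterate_eq_pow] at h1 ⊢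
      rw [Pi.single_eq_same, map_smul, ← h1]
    · rw [Pi.single_eq_of_ne hj, map_zero]
  let X : Fin n → S := ∑ r ∈ Finset.range m, f r
  have hX : permRep φ π g X = μ • X := by
    have h3 := Finset.sum_range_succ f m
    rw [Finset.sum_range_succ', hfm] at h3
    simp only [X, map_sum, hf]
    rw [← Finset.smul_sum, add_right_cancel h3]
  refine ⟨X, ⟨fun j => ?_, hz _ ?_⟩, fun hX0 => hx0 ?_, hX⟩
  · simp only [X, Finset.sum_apply, map_sum, hNf]
  · rw [map_sum, Finset.smul_sum, ← Equiv.sum_comp (π g) fun j => μ • X j]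
    refine Finset.sum_congr rfl fun j _ => ?_
    rw [← permRep_apply_apply (π := π), hX, Pi.smul_apply]
  · have h1 := congrFun hX0 q
    simp only [X, Finset.sum_apply] at h1
    rw [Finset.sum_eq_single_of_mem 0 (Finset.mem_range.2 hm0)] at h1
    · simpa [f] using h1
    · intro r hr hr0
      refine Pi.single_eq_of_ne (fun h' => hr0 ?_) _
      exact Function.iterate_injOn_Iio_minimalPeriod (f := π g) (x := q)
        (by simpa [hm] using hr) (by simpa [hm] using hm0) h'.symm

end StdEigenvectors

section StdSpectrum

variable {S : Type} [AddCommGroup S] [Module ℂ S] {n : ℕ} {e : Fin n → Module.End ℂ S}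

open Schur

variable {φ : Cover n →* Module.End ℂ S} {π : Cover n →* Equiv.Perm (Fin n)} {g : Cover n}
  {κ : ℂ} {p q o : Fin n} {l : ℕ} {ε μ : ℂ}

theorem IsSpinLift.exists_stdSub_of_cycle (h : IsSpinLift e φ π) (hκ : κ * κ * (n - 1) = -1)
    {m : ℕ} (hm : Function.minimalPeriod (π g) q = m) (hm0 : 0 < m)
    (hqp : ¬ (π g).SameCycle q p) (hqo : ¬ (π g).SameCycle q o) (hpo : ¬ (π g).SameCycle p o)
    (hμ0 : μ ≠ 0) {ω : ℂ} (hω : ω ^ m = 1) (hμ : ∃ y ≠ 0, φ g y = (μ * ω) • y)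
    (hz : ∀ s, φ g s = μ • s → s = 0) :
    ∃ x ∈ stdSub e κ, x ≠ 0 ∧ permRep φ π g x = μ • x := by
  have hn : n ≠ 0 := by rintro rfl; exact p.elim0
  obtain ⟨v, hv, hv1, hv2, hvq⟩ := exists_balanced (σ := π g) {i | (π g).SameCycle p i}
    {i | ¬ (π g).SameCycle q i ∧ ¬ (π g).SameCycle p i} (by simp) (by simp)
    (fun j hj hj' => hj'.2 hj) ⟨p, Equiv.Perm.SameCycle.refl _ _⟩ ⟨o, hqo, hpo⟩ (q := q)
    (fun h' => hqp (Equiv.Perm.SameCycle.symm h')) (fun h' => h'.1 (Equiv.Perm.SameCycle.refl _ _))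
  obtain ⟨y, hy0, hy⟩ := hμ
  have hym := pow_apply_of_eigenvector hy m
  rw [mul_pow, hω, mul_one] at hym
  have hN : φ g ^ m * projInv e κ q = projInv e κ q * φ g ^ m := by
    have h1 := h.mul_inv κ (g ^ m) q
    have h4 : (π g)^[m] q = q := hm ▸ Function.iterate_minimalPeriod
    rwa [map_pow, map_pow, ← Equiv.Perm.iterate_eq_pow, h4] at h1
  obtain ⟨x, hx0, hx, hxN⟩ := h.clifford.exists_inv_fixed hκ hn (perm_sign_mul_self (π g))
    (h.map_mul g) hv hv1 hv2 hvq hN hy0 hym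
  exact h.exists_stdSub_of_orbit hm hm0 hμ0 hx0 hx hxN hz

variable [FiniteDimensional ℂ S] [Nontrivial S]

theorem IsSpinLift.exists_stdSub_eigenvector (h : IsSpinLift e φ π) (hκ : κ * κ * (n - 1) = -1)
    (hS : Module.finrank ℂ S = 2 ^ (n / 2)) (hn : 8 < n) (hg : IsThreeFive (π g) l q p)
    (hε : ε ^ 2 = 1) (hk : φ g ^ (15 * l) = ε • 1) (hμ : μ ^ (15 * l) = ε) (hμl : μ ^ l ≠ ε) :
    ∃ x ∈ stdSub e κ, x ≠ 0 ∧ permRep φ π g x = μ • x := by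
  have hl0 : l ≠ 0 := by rintro rfl; exact absurd hg.coprime (by norm_num)
  have hε0 : ε ≠ 0 := by rintro rfl; simp at hε
  have hμ0 : μ ≠ 0 := by
    rintro rfl
    rw [zero_pow (by omega)] at hμ
    exact hε0 hμ.symm
  obtain ⟨hqp, o, hqo, hpo⟩ := hg.exists_not_sameCycle (by simpa using hn)
  have hq : π g q ≠ q := fun h' => by
    have := Function.minimalPeriod_eq_one_iff_isFixedPt.2 h'
    rw [hg.period_three] at this; norm_num at this
  have hp : π g p ≠ p := fun h' => by
    have := Function.minimalPeriod_eq_one_iff_isFixedPt.2 h'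
    rw [hg.period_five] at this; norm_num at this
  have hcop : ∀ m, m ∣ 15 → l.Coprime m := fun m hm => hg.coprime.coprime_dvd_right hm
  by_cases h3 : ε * μ ^ (5 * l) = 1
  · have h5 : ε * μ ^ (3 * l) ≠ 1 := by
      intro h5
      refine hμl ?_
      have e1 : μ ^ (6 * l) = 1 := by
        have : (ε * μ ^ (3 * l)) ^ 2 = 1 := by rw [h5, one_pow]
        rwa [mul_pow, hε, one_mul, ← pow_mul, show 3 * l * 2 = 6 * l by ring] at this
      have e2 : μ ^ (5 * l) = ε := by
        calc μ ^ (5 * l) = ε ^ 2 * μ ^ (5 * l) := by rw [hε, one_mul]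
          _ = ε := by rw [pow_two, mul_assoc, h3, mul_one]
      have e3 : μ ^ l * ε = 1 := by rw [← e2, ← pow_add, ← e1]; congr 1; ring
      calc μ ^ l = μ ^ l * ε ^ 2 := by rw [hε, mul_one]
        _ = ε := by rw [pow_two, ← mul_assoc, e3, one_mul]
    have hω := Complex.isPrimitiveRoot_exp 3 (by norm_num)
    refine h.exists_stdSub_of_cycle hκ hg.period_three (by norm_num) hqp hqo hpo hμ0 hω.pow_eq_one
      (h.exists_eigenvector hS hg hε hk ?_ ?_ ?_) fun s hs => ?_
    · rw [mul_pow, hμ, (hω.pow_eq_one_iff_dvd _).2 (Dvd.dvd.mul_right (by norm_num) l), mul_one]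
    · rw [mul_pow, ← mul_assoc, h3, one_mul, Ne, hω.pow_eq_one_iff_dvd]
      intro h'
      exact absurd (Nat.Coprime.eq_one_of_dvd (Nat.Coprime.mul_right (by norm_num)
        (hcop 3 (by norm_num)).symm) h') (by norm_num)
    · rwa [mul_pow, (hω.pow_eq_one_iff_dvd _).2 (Dvd.intro _ rfl), mul_one]
    · refine h.eq_zero_of_pow_three hS hg hε hk ?_
      rw [pow_apply_of_eigenvector hs, smul_smul, h3, one_smul]
  · by_cases h5 : ε * μ ^ (3 * l) = 1
    · have hω := Complex.isPrimitiveRoot_exp 5 (by norm_num)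
      refine h.exists_stdSub_of_cycle hκ hg.period_five (by norm_num) (fun h' => hqp h'.symm) hpo
        hqo hμ0 hω.pow_eq_one
        (h.exists_eigenvector hS hg hε hk ?_ ?_ ?_) fun s hs => ?_
      · rw [mul_pow, hμ, (hω.pow_eq_one_iff_dvd _).2 (Dvd.dvd.mul_right (by norm_num) l), mul_one]
      · rwa [mul_pow, (hω.pow_eq_one_iff_dvd _).2 (Dvd.intro _ rfl), mul_one]
      · rw [mul_pow, ← mul_assoc, h5, one_mul, Ne, hω.pow_eq_one_iff_dvd]
        intro h'
        exact absurd (Nat.Coprime.eq_one_of_dvd (Nat.Coprime.mul_right (by norm_num)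
          (hcop 5 (by norm_num)).symm) h') (by norm_num)
      · refine h.eq_zero_of_pow_five hS hg hε hk ?_
        rw [pow_apply_of_eigenvector hs, smul_smul, h5, one_smul]
    · classical
      exact h.exists_stdSub_of_two_orbits hκ
        (a := fun j => if (π g).SameCycle q j then 1 else 0)
        (b := fun j => if (π g).SameCycle p j then 1 else 0) (by simp) (by simp) hq hp
        (if_pos (Equiv.Perm.SameCycle.refl _ _)) (if_neg fun h' => hqp h'.symm) (if_neg hqp)
        (if_pos (Equiv.Perm.SameCycle.refl _ _)) (h.exists_eigenvector hS hg hε hk hμ h3 h5)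

theorem IsSpinLift.eq_zero_of_permRep_pow (h : IsSpinLift e φ π)
    (hS : Module.finrank ℂ S = 2 ^ (n / 2)) (hn : 8 < n) (hg : IsThreeFive (π g) l q p)
    (hε : ε ^ 2 = 1) (hk : φ g ^ (15 * l) = ε • 1) {x : Fin n → S}
    (hx : (permRep φ π g ^ l) x = ε • x) : x = 0 := by
  obtain ⟨hqp, -⟩ := hg.exists_not_sameCycle (by simpa using hn)
  have key : ∀ t, Odd t → ∀ j, (π g ^ (t * l)) j = j → ε • (φ g ^ (t * l)) (x j) = x j := by
    intro t ht j hj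
    have h1 : (permRep φ π g ^ (l * t)) x = ε ^ t • x := by
      rw [pow_mul]; exact pow_apply_of_eigenvector hx t
    have hεt : ε ^ t = ε := by
      obtain ⟨s, rfl⟩ := ht
      rw [pow_succ, pow_mul, hε, one_pow, one_mul]
    rw [hεt, mul_comm l, ← map_pow] at h1
    have h2 := congrFun h1 j
    conv_lhs at h2 => rw [← hj]
    rw [← map_pow, permRep_apply_apply, Pi.smul_apply, map_pow] at h2
    rw [h2, smul_smul, ← pow_two, hε, one_smul]
  funext j
  by_cases hj : (π g ^ (5 * l)) j = j
  · exact h.eq_zero_of_pow_three hS hg hε hk (key 5 (by decide) j hj)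
  · refine h.eq_zero_of_pow_five hS hg hε hk (key 3 (by decide) j ?_)
    refine hg.pow_five j fun r hr => hj (hg.pow_three j fun s hs => hqp ?_)
    rw [Equiv.Perm.iterate_eq_pow] at hr hs
    have hs' : (π g).SameCycle q j := ⟨s, by rw [zpow_natCast, hs]⟩
    have hr' : (π g).SameCycle p j := ⟨r, by rw [zpow_natCast, hr]⟩
    exact hs'.trans hr'.symm

end StdSpectrum

section MinimalPolynomial

open Polynomial

theorem minpoly_mul_eq {V : Type} [AddCommGroup V] [Module ℂ V] [FiniteDimensional ℂ V]
    {T : Module.End ℂ V} {l m : ℕ} {ε : ℂ} (hl : l ≠ 0) (hm : m ≠ 0) (hε : ε ≠ 0)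
    (hεm : ε ^ m = ε) (hT : T ^ (m * l) = ε • 1)
    (hinj : ∀ x, (T ^ l) x = ε • x → x = 0)
    (heig : ∀ μ : ℂ, μ ^ (m * l) = ε → μ ^ l ≠ ε → ∃ x ≠ 0, T x = μ • x) :
    minpoly ℂ T * (X ^ l - C ε) = X ^ (m * l) - C ε := by
  have hml : m * l ≠ 0 := mul_ne_zero hm hl
  obtain ⟨Q, hQ⟩ : (X ^ l - C ε : ℂ[X]) ∣ X ^ (m * l) - C ε := by
    have := sub_dvd_pow_sub_pow (X ^ l : ℂ[X]) (C ε) m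
    rwa [← pow_mul, ← C_pow, hεm, mul_comm l] at this
  have hQm : Q.Monic := (monic_X_pow_sub_C ε hl).of_mul_monic_left
    (hQ ▸ monic_X_pow_sub_C ε hml)
  have hsep : ((X ^ l - C ε) * Q).Separable := by
    rw [← hQ]; exact separable_X_pow_sub_C ε (by exact_mod_cast hml) hε
  have haQ : aeval T Q = 0 := by
    refine LinearMap.ext fun x => hinj _ ?_
    have h1 : aeval T ((X ^ l - C ε) * Q) = 0 := by
      rw [← hQ]
      simp [hT, Algebra.algebraMap_eq_smul_one]
    have h2 := LinearMap.congr_fun h1 x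
    rw [map_mul, Module.End.mul_apply] at h2
    simpa [Algebra.algebraMap_eq_smul_one, sub_eq_zero] using h2
  have hdvd : Q ∣ minpoly ℂ T := by
    refine (IsAlgClosed.splits Q).dvd_of_roots_le_roots hQm.ne_zero ?_
    rw [Multiset.le_iff_subset (nodup_roots hsep.of_mul_right)]
    intro μ hμ
    have hμQ : Q.eval μ = 0 := (mem_roots hQm.ne_zero).1 hμ
    have h1 : μ ^ (m * l) = ε := by
      have := congrArg (eval μ) hQ
      simpa [hμQ, sub_eq_zero] using this
    have h2 : μ ^ l ≠ ε := by
      intro h2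
      obtain ⟨a, b, hab⟩ := hsep.isCoprime
      have := congrArg (eval μ) hab
      simp [hμQ, h2] at this
    obtain ⟨x, hx0, hx⟩ := heig μ h1 h2
    rw [mem_roots (minpoly.ne_zero (Algebra.IsIntegral.isIntegral T)),
      ← Module.End.hasEigenvalue_iff_isRoot]
    exact Module.End.hasEigenvalue_of_hasEigenvector
      ⟨Module.End.mem_eigenspace_iff.2 hx, hx0⟩
  have heq : minpoly ℂ T = Q :=
    eq_of_monic_of_associated (minpoly.monic (Algebra.IsIntegral.isIntegral T)) hQm
      (associated_of_dvd_dvd (minpoly.dvd ℂ T haQ) hdvd)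
  rw [heq, hQ, mul_comm]

end MinimalPolynomial

section StdRep

variable {S : Type} [AddCommGroup S] [Module ℂ S] {n : ℕ}

open Schur

variable {e : Fin n → Module.End ℂ S} {φ : Cover n →* Module.End ℂ S}
  {π : Cover n →* Equiv.Perm (Fin n)} {κ : ℂ}

/-- The restriction of `permRep φ π` to the invariant subspace `stdSub e κ`: the basic standard
spin representation. -/
def IsSpinLift.stdRep (h : IsSpinLift e φ π) (κ : ℂ) :
    Cover n →* Module.End ℂ (stdSub e κ) where
  toFun g := (permRep φ π g).restrict fun _ hx => h.permRep_mem g hx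
  map_one' := by
    refine LinearMap.ext fun x => Subtype.ext ?_
    rw [LinearMap.coe_restrict_apply, map_one]; rfl
  map_mul' a b := by
    refine LinearMap.ext fun x => Subtype.ext ?_
    rw [LinearMap.coe_restrict_apply, _root_.map_mul]; rfl

theorem IsSpinLift.coe_stdRep_apply (h : IsSpinLift e φ π) (g : Cover n) (x : stdSub e κ) :
    (h.stdRep κ g x : Fin n → S) = permRep φ π g x := rfl

theorem IsSpinLift.stdRep_irreducible [FiniteDimensional ℂ S] (h : IsSpinLift e φ π)
    (hκ : κ * κ * (n - 1) = -1) (hn : 2 ≤ n) (hS : Module.finrank ℂ S = 2 ^ (n / 2))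
    (U : Submodule ℂ (stdSub e κ)) (hU : ∀ g, U.map (h.stdRep κ g) ≤ U) : U = ⊥ ∨ U = ⊤ := by
  refine or_iff_not_imp_left.2 fun hU0 => eq_top_iff.2 fun x _ => ?_
  have hle := h.stdSub_le (U := U.map (stdSub e κ).subtype) (fun g x hx => ?_) hκ hn hS
    (Submodule.map_subtype_le _ _) fun hb => hU0 ?_
  · obtain ⟨y, hy, hyx⟩ := hle x.2
    rwa [← Subtype.ext hyx]
  · obtain ⟨y, hy, rfl⟩ := hx
    exact ⟨h.stdRep κ g y, hU g ⟨y, hy, rfl⟩, rfl⟩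
  · exact Submodule.map_injective_of_injective (Submodule.subtype_injective _)
      (hb.trans (Submodule.map_bot _).symm)

theorem IsSpinLift.stdRep_eq_smul (h : IsSpinLift e φ π) {g : Cover n} {c : ℂ} (hπ : π g = 1)
    (hφ : φ g = c • 1) : h.stdRep κ g = c • 1 := by
  refine LinearMap.ext fun x => Subtype.ext (funext fun j => ?_)
  rw [h.coe_stdRep_apply, permRep_apply, hπ, hφ]
  simp

end StdRep

section SpinLiftExistence

open Schur

theorem exists_isSpinLift {n : ℕ} (hn : 2 ≤ n) {π : Cover n →* Equiv.Perm (Fin n)}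
    (hπt : ∀ i : Fin (n - 1), π (t n i) = adj n i) (hπz : π (z n) = 1) :
    ∃ (S : Type) (_ : AddCommGroup S) (_ : Module ℂ S) (_ : FiniteDimensional ℂ S)
      (e : Fin n → Module.End ℂ S) (φ : Cover n →* Module.End ℂ S),
      IsSpinLift e φ π ∧ Module.finrank ℂ S = 2 ^ (n / 2) := by
  obtain ⟨S, _, _, _, e, he, hS⟩ := exists_isClifford n
  obtain ⟨δ, hδ⟩ := IsAlgClosed.exists_pow_nat_eq (-1 / 2 : ℂ) (n := 2) two_pos
  rw [sq] at hδ
  obtain ⟨φ, hz, ht⟩ := exists_spinHom he hδ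
  exact ⟨S, _, _, inferInstance, e, φ, ⟨he, hz, spinHom_mul he hz ht hπt hπz,
    fun p q hpq => exists_lift_swap hn he hδ hz ht hπt hπz hpq,
    spinHom_det_pow_four he hδ hz ht, Schur.Cover.surjective_of_adj hπt⟩, hS⟩

end SpinLiftExistence

open Schur Polynomial in
/-- Theorem: for `n > 8` and `g ∈ S̃_n` such that `π(g)` has one cycle of length 3 and one
of length 5 while every other cycle has length divisible by neither 3 nor 5, one has
`15 ∣ k` and there is an irreducible spin representation `(ρ, V)` of `S̃_n` of dimension
`(n−2)·2^⌊(n−2)/2⌋` (a basic standard spin representation) in which the minimal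
polynomial of `ρ(g)` is `(X^k − ε_g)/(X^{k/15} − ε_g)`, where `k` is the order of
`π(g)`. -/
theorem schur_basic_standard_spin_minpoly_three_and_five (n : ℕ) (hn : 8 < n)
    (π : Cover n →* Equiv.Perm (Fin n))
    (hπt : ∀ i : Fin (n - 1), π (t n i) = adj n i)
    (hπz : π (z n) = 1)
    (g : Cover n) (k : ℕ) (hk : k = orderOf (π g))
    (hcyc : (π g).cycleType.filter (fun l => 3 ∣ l ∨ 5 ∣ l) = {3, 5})
    (ε : ℂ) (hε : (g ^ k = 1 ∧ ε = 1) ∨ (g ^ k = z n ∧ ε = -1)) :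
    15 ∣ k ∧
      ∃ (V : Type) (_ : AddCommGroup V) (_ : Module ℂ V)
        (ρ : Cover n →* Module.End ℂ V),
        FiniteDimensional ℂ V ∧ Nontrivial V ∧
        Module.finrank ℂ V = (n - 2) * 2 ^ ((n - 2) / 2) ∧
        (∀ U : Submodule ℂ V, (∀ h : Cover n, U.map (ρ h) ≤ U) → U = ⊥ ∨ U = ⊤) ∧
        ρ (z n) = -1 ∧
        minpoly ℂ (ρ g) * (X ^ (k / 15) - C ε) = X ^ k - C ε := by
  obtain ⟨l, q, p, hg⟩ := exists_isThreeFive hcyc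
  have hkl : k = 15 * l := hk.trans hg.orderOf_eq
  have hl0 : l ≠ 0 := by rintro rfl; exact absurd hg.coprime (by norm_num)
  refine ⟨⟨l, hkl⟩, ?_⟩
  obtain ⟨S, _, _, _, e, φ, h, hS⟩ := exists_isSpinLift (by omega) hπt hπz
  have : Nontrivial S := Module.nontrivial_of_finrank_pos (R := ℂ) (by rw [hS]; positivity)
  have hn1 : (n - 1 : ℂ) ≠ 0 := by
    rw [sub_ne_zero]; exact_mod_cast (by omega : n ≠ 1)
  obtain ⟨κ, hκ⟩ := IsAlgClosed.exists_pow_nat_eq (-1 / (n - 1) : ℂ) (n := 2) two_pos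
  rw [sq, eq_div_iff hn1] at hκ
  have hdim := h.clifford.finrank_stdSub hκ (by omega) hS
  have hε2 : ε ^ 2 = 1 := by rcases hε with ⟨-, rfl⟩ | ⟨-, rfl⟩ <;> norm_num
  have hφk : φ (g ^ k) = ε • 1 := by
    rcases hε with ⟨hgk, rfl⟩ | ⟨hgk, rfl⟩
    · rw [hgk, map_one, one_smul]
    · rw [hgk, h.map_z, neg_one_smul]
  have hπk : π (g ^ k) = 1 := by rw [map_pow, hk, pow_orderOf_eq_one]
  have hφkl : φ g ^ (15 * l) = ε • 1 := by rw [← hkl, ← map_pow, hφk]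
  refine ⟨stdSub e κ, inferInstance, inferInstance, h.stdRep κ, inferInstance,
    Module.nontrivial_of_finrank_pos (R := ℂ) ?_, hdim,
    h.stdRep_irreducible hκ (by omega) hS, ?_, ?_⟩
  · rw [hdim]
    exact Nat.mul_pos (by omega) (by positivity)
  · rw [h.stdRep_eq_smul (c := -1) hπz (by rw [h.map_z, neg_one_smul])]
    exact neg_one_smul ℂ _
  · rw [hkl, Nat.mul_div_cancel_left l (by norm_num)]
    refine minpoly_mul_eq hl0 (by norm_num) (by rintro rfl; norm_num at hε2) ?_ ?_
      (fun x hx => ?_) fun μ hμ hμl => ?_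
    · rw [show 15 = 2 * 7 + 1 from rfl, pow_succ, pow_mul, hε2, one_pow, one_mul]
    · rw [← map_pow, ← hkl]
      exact h.stdRep_eq_smul hπk hφk
    · refine Subtype.ext (h.eq_zero_of_permRep_pow hS hn hg hε2 hφkl ?_)
      rw [← map_pow, ← h.coe_stdRep_apply, map_pow, hx]
      rfl
    · obtain ⟨x, hx, hx0, hgx⟩ := h.exists_stdSub_eigenvector hκ hS hn hg hε2 hφkl hμ hμl
      exact ⟨⟨x, hx⟩, fun h0 => hx0 (congrArg Subtype.val h0), Subtype.ext hgx⟩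
end

section
/- Let n = 2m with m even, let S̃_n be Schur's double cover of S_n with projection π, and let A ≤ S_n be the subgroup generated by the two disjoint m-cycles c₁ = (1, 2, …, m) and c₂ = (m+1, m+2, …, 2m). Set G = π^{-1}(A) ≤ S̃_n. Then every finite-dimensional irreducible complex representation (ρ, V) of G with ρ(z) = −Id has dim_ℂ V = 2. -/
namespace Schur

section Descent

variable {Γ : Type*} [Group Γ]

/-- The subgroup generated by `z` and the first `k` terms of the sequence `s`. -/
def parabolic (z : Γ) (s : ℕ → Γ) (k : ℕ) : Subgroup Γ :=
  Subgroup.closure (insert z (s '' Set.Iio k))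

/-- The descending product `s K * s (K - 1) * ⋯` with `d` factors. -/
def descProd (s : ℕ → Γ) (K : ℕ) : ℕ → Γ
  | 0 => 1
  | d + 1 => descProd s K d * s (K - d)

/-- The ascending product `s a * s (a + 1) * ⋯` with `l` factors. -/
def ascProd (s : ℕ → Γ) (a : ℕ) : ℕ → Γ
  | 0 => 1
  | l + 1 => ascProd s a l * s (a + l)

/-- The relations of Schur's double cover, for the first `N` terms of a sequence. -/
structure SpinRelations (z : Γ) (s : ℕ → Γ) (N : ℕ) : Prop where
  z_sq : z * z = 1
  z_comm : ∀ g, z * g = g * z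
  s_sq : ∀ i < N, s i * s i = z
  braid : ∀ i, i + 1 < N → s (i + 1) * s i * s (i + 1) = s i * s (i + 1) * s i
  far : ∀ i j, i < N → j < N → (i + 2 ≤ j ∨ j + 2 ≤ i) → s i * s j = z * (s j * s i)

variable {z : Γ} {s : ℕ → Γ} {N : ℕ}

theorem z_mem_parabolic (k : ℕ) : z ∈ parabolic z s k :=
  Subgroup.subset_closure (Set.mem_insert _ _)

theorem s_mem_parabolic {i k : ℕ} (h : i < k) : s i ∈ parabolic z s k :=
  Subgroup.subset_closure (Set.mem_insert_of_mem _ ⟨i, h, rfl⟩)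

theorem descProd_mul_of_lt (R : SpinRelations z s N) {K : ℕ} (hK : K < N) {i : ℕ} :
    ∀ d, i + d < K → ∃ h ∈ parabolic z s K, descProd s K d * s i = h * descProd s K d := by
  intro d
  induction d with
  | zero =>
    intro hi
    exact ⟨s i, s_mem_parabolic (by omega), by simp [descProd]⟩
  | succ d ih =>
    intro hi
    obtain ⟨h, hh, e⟩ := ih (by omega)
    refine ⟨z * h, mul_mem (z_mem_parabolic K) hh, ?_⟩
    calc descProd s K d * s (K - d) * s i
        = descProd s K d * (s (K - d) * s i) := by group
      _ = descProd s K d * z * s i * s (K - d) := by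
          rw [R.far _ _ (by omega) (by omega) (by omega)]; group
      _ = z * (descProd s K d * s i) * s (K - d) := by
          rw [← R.z_comm]; group
      _ = z * h * (descProd s K d * s (K - d)) := by rw [e]; group

theorem descProd_mul_of_gt (R : SpinRelations z s N) {K : ℕ} (hK : K < N) {i : ℕ}
    (hiK : i ≤ K) :
    ∀ d ≤ K + 1, K + 1 < i + d →
      ∃ h ∈ parabolic z s K, descProd s K d * s i = h * descProd s K d := by
  intro d
  induction d with
  | zero => intro _ hi; omega
  | succ d ih =>
    intro hd hi
    by_cases hc : i + d = K + 1
    · obtain ⟨e, rfl⟩ : ∃ e, d = e + 1 := ⟨d - 1, by omega⟩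
      obtain ⟨j, rfl⟩ : ∃ j, i = j + 1 := ⟨i - 1, by omega⟩
      obtain ⟨h, hh, eq⟩ := descProd_mul_of_lt R hK (i := j) e (by omega)
      refine ⟨h, hh, ?_⟩
      have h1 : K - e = j + 1 := by omega
      have h2 : K - (e + 1) = j := by omega
      simp only [descProd, h1, h2]
      calc descProd s K e * s (j + 1) * s j * s (j + 1)
          = descProd s K e * (s (j + 1) * s j * s (j + 1)) := by group
        _ = descProd s K e * s j * (s (j + 1) * s j) := by
            rw [R.braid _ (by omega)]; group
        _ = _ := by rw [eq]; group
    · obtain ⟨h, hh, e⟩ := ih (by omega) (by omega)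
      refine ⟨z * h, mul_mem (z_mem_parabolic K) hh, ?_⟩
      calc descProd s K d * s (K - d) * s i
          = descProd s K d * (s (K - d) * s i) := by group
        _ = descProd s K d * z * s i * s (K - d) := by
            rw [R.far _ _ (by omega) (by omega) (by omega)]; group
        _ = z * (descProd s K d * s i) * s (K - d) := by
            rw [← R.z_comm]; group
        _ = z * h * (descProd s K d * s (K - d)) := by rw [e]; group

theorem descProd_mul (R : SpinRelations z s N) {K : ℕ} (hK : K < N) {i d : ℕ}
    (hiK : i ≤ K) (hd : d ≤ K + 1) :
    ∃ h ∈ parabolic z s K, ∃ d' ≤ K + 1, descProd s K d * s i = h * descProd s K d' := by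
  rcases lt_trichotomy (i + d) K with h | h | h
  · obtain ⟨g, hg, e⟩ := descProd_mul_of_lt R hK d h
    exact ⟨g, hg, d, hd, e⟩
  · refine ⟨1, one_mem _, d + 1, by omega, ?_⟩
    rw [one_mul, descProd, show K - d = i by omega]
  · by_cases h' : i + d = K + 1
    · obtain ⟨e, rfl⟩ : ∃ e, d = e + 1 := ⟨d - 1, by omega⟩
      refine ⟨z, z_mem_parabolic K, e, by omega, ?_⟩
      rw [descProd, show K - e = i by omega, mul_assoc, R.s_sq _ (by omega), R.z_comm]
    · obtain ⟨g, hg, e⟩ := descProd_mul_of_gt R hK hiK d hd (by omega)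
      exact ⟨g, hg, d, hd, e⟩

theorem inv_eq_z_mul (R : SpinRelations z s N) {i : ℕ} (hi : i < N) : (s i)⁻¹ = z * s i := by
  rw [inv_eq_iff_mul_eq_one, ← mul_assoc, ← R.z_comm, mul_assoc, R.s_sq i hi, R.z_sq]

theorem exists_eq_mul_descProd (R : SpinRelations z s N) {K : ℕ} (hK : K < N) {w : Γ}
    (hw : w ∈ parabolic z s (K + 1)) :
    ∃ h ∈ parabolic z s K, ∃ d ≤ K + 1, w = h * descProd s K d := by
  have mul_z : ∀ {x : Γ}, (∃ h ∈ parabolic z s K, ∃ d ≤ K + 1, x = h * descProd s K d) →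
      ∃ h ∈ parabolic z s K, ∃ d ≤ K + 1, x * z = h * descProd s K d := by
    rintro x ⟨h, hh, d, hd, rfl⟩
    exact ⟨z * h, mul_mem (z_mem_parabolic K) hh, d, hd, by rw [← R.z_comm]; group⟩
  have mul_s : ∀ {x : Γ} {i : ℕ}, i ≤ K →
      (∃ h ∈ parabolic z s K, ∃ d ≤ K + 1, x = h * descProd s K d) →
      ∃ h ∈ parabolic z s K, ∃ d ≤ K + 1, x * s i = h * descProd s K d := by
    rintro x i hi ⟨h, hh, d, hd, rfl⟩
    obtain ⟨g, hg, d', hd', e⟩ := descProd_mul R hK hi hd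
    exact ⟨h * g, mul_mem hh hg, d', hd', by rw [mul_assoc, e, mul_assoc]⟩
  have z_inv : z⁻¹ = z := inv_eq_of_mul_eq_one_left R.z_sq
  induction hw using Subgroup.closure_induction_right with
  | one => exact ⟨1, one_mem _, 0, by omega, by simp [descProd]⟩
  | mul_right x hx y hy ih =>
    rcases hy with rfl | ⟨i, hi, rfl⟩
    · exact mul_z ih
    · exact mul_s (Nat.lt_succ_iff.mp hi) ih
  | mul_inv_cancel x hx y hy ih =>
    rcases hy with rfl | ⟨i, hi, rfl⟩
    · rw [z_inv]; exact mul_z ih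
    · have hi' : i < K + 1 := hi
      rw [inv_eq_z_mul R (by omega), ← mul_assoc]
      exact mul_s (Nat.lt_succ_iff.mp hi') (mul_z ih)

variable {α : Type*} [DecidableEq α] {f : Γ →* Equiv.Perm α} {pt : ℕ → α}

theorem apply_of_mem_parabolic (hz : f z = 1)
    (hs : ∀ i < N, f (s i) = Equiv.swap (pt i) (pt (i + 1)))
    (hpt : Set.InjOn pt (Set.Iic N)) {K : ℕ} {h : Γ} (hh : h ∈ parabolic z s K)
    {j : ℕ} (hj : K < j) (hjN : j ≤ N) : f h (pt j) = pt j := by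
  suffices parabolic z s K ≤ (MulAction.stabilizer (Equiv.Perm α) (pt j)).comap f from this hh
  rw [parabolic, Subgroup.closure_le]
  rintro _ (rfl | ⟨i, hi, rfl⟩)
  · simp [hz]
  · have hi' : i < K := hi
    change f (s i) (pt j) = pt j
    rw [hs i (by omega)]
    apply Equiv.swap_apply_of_ne_of_ne
    · intro e
      have := hpt (Set.mem_Iic.mpr hjN) (Set.mem_Iic.mpr (by omega)) e
      omega
    · intro e
      have := hpt (Set.mem_Iic.mpr hjN) (Set.mem_Iic.mpr (by omega)) e
      omega

theorem apply_descProd (hs : ∀ i < N, f (s i) = Equiv.swap (pt i) (pt (i + 1))) {K : ℕ}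
    (hK : K < N) : ∀ d ≤ K + 1, f (descProd s K d) (pt (K + 1 - d)) = pt (K + 1) := by
  intro d
  induction d with
  | zero => intro _; simp [descProd]
  | succ d ih =>
    intro hd
    rw [descProd, map_mul, Equiv.Perm.mul_apply, hs _ (by omega),
      show K + 1 - (d + 1) = K - d by omega, Equiv.swap_apply_left,
      show K - d + 1 = K + 1 - d by omega, ih (by omega)]

theorem mem_zpowers_of_apply_eq_one (R : SpinRelations z s N) (hz : f z = 1)
    (hs : ∀ i < N, f (s i) = Equiv.swap (pt i) (pt (i + 1)))
    (hpt : Set.InjOn pt (Set.Iic N)) :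
    ∀ K ≤ N, ∀ w, w ∈ parabolic z s K → f w = 1 → w ∈ Subgroup.zpowers z := by
  intro K
  induction K with
  | zero =>
    intro _ w hw _
    simpa [parabolic, Subgroup.zpowers_eq_closure] using hw
  | succ K ih =>
    intro hK w hw hfw
    obtain ⟨h, hh, d, hd, rfl⟩ := exists_eq_mul_descProd R (by omega) hw
    have e : f (h * descProd s K d) (pt (K + 1 - d)) = pt (K + 1) := by
      rw [map_mul, Equiv.Perm.mul_apply, apply_descProd hs (by omega) d hd,
        apply_of_mem_parabolic hz hs hpt hh (by omega) hK]
    rw [hfw, Equiv.Perm.one_apply] at e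
    have := hpt (Set.mem_Iic.mpr (by omega)) (Set.mem_Iic.mpr hK) e
    obtain rfl : d = 0 := by omega
    rw [descProd, mul_one] at hfw ⊢
    exact ih (by omega) h hh hfw

theorem ascProd_mul_s (R : SpinRelations z s N) {a j : ℕ} (hj : j < N) :
    ∀ l, a + l < j → ascProd s a l * s j = z ^ l * (s j * ascProd s a l) := by
  intro l
  induction l with
  | zero => intro _; simp [ascProd]
  | succ l ih =>
    intro h
    have zc : Commute z (ascProd s a l) := R.z_comm _
    calc ascProd s a l * s (a + l) * s j = ascProd s a l * (s (a + l) * s j) := by group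
      _ = ascProd s a l * z * s j * s (a + l) := by
          rw [R.far _ _ (by omega) (by omega) (by omega)]; group
      _ = z * (ascProd s a l * s j) * s (a + l) := by rw [← R.z_comm]; group
      _ = _ := by rw [ih (by omega), pow_succ', ascProd]; group

theorem ascProd_mul_ascProd (R : SpinRelations z s N) {a b l : ℕ} (hab : a + l < b) :
    ∀ k, b + k ≤ N →
      ascProd s a l * ascProd s b k = z ^ (l * k) * (ascProd s b k * ascProd s a l) := by
  intro k
  induction k with
  | zero => intro _; simp [ascProd]
  | succ k ih =>
    intro h
    have zc : ∀ g, z ^ l * g = g * z ^ l := fun g => (Commute.pow_left (R.z_comm g) l)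
    calc ascProd s a l * (ascProd s b k * s (b + k))
        = ascProd s a l * ascProd s b k * s (b + k) := by group
      _ = z ^ (l * k) * ascProd s b k * (ascProd s a l * s (b + k)) := by
          rw [ih (by omega)]; group
      _ = z ^ (l * k) * (ascProd s b k * z ^ l) * (s (b + k) * ascProd s a l) := by
          rw [ascProd_mul_s R (by omega) l (by omega)]; group
      _ = _ := by rw [← zc, mul_add, mul_one, pow_add, ascProd]; group

end Descent

theorem finrank_eq_two_of_anticommute {V : Type*} [AddCommGroup V] [Module ℂ V]
    [FiniteDimensional ℂ V] [Nontrivial V] (A B : Module.End ℂ V)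
    (hA : Function.Injective A) (hB : Function.Injective B) (hAB : A * B = -(B * A))
    (hirr : ∀ U : Submodule ℂ V, U.map A ≤ U → U.map B ≤ U → U = ⊥ ∨ U = ⊤) :
    Module.finrank ℂ V = 2 := by
  have anti : ∀ v, A (B v) = -B (A v) := fun v => LinearMap.congr_fun hAB v
  obtain ⟨μ, hμ⟩ := Module.End.exists_eigenvalue (B * B)
  have hE : Module.End.eigenspace (B * B) μ = ⊤ := by
    refine (hirr _ ?_ ?_).resolve_left hμ
    · rintro _ ⟨v, hv, rfl⟩
      have hv' : B (B v) = μ • v := Module.End.mem_eigenspace_iff.mp hv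
      refine Module.End.mem_eigenspace_iff.mpr ?_
      change B (B (A v)) = μ • A v
      have h1 : B (A v) = -A (B v) := by rw [anti, neg_neg]
      have h2 : B (A (B v)) = -A (B (B v)) := by rw [anti (B v), neg_neg]
      rw [h1, map_neg, h2, neg_neg, hv', map_smul]
    · rintro _ ⟨v, hv, rfl⟩
      have hv' : B (B v) = μ • v := Module.End.mem_eigenspace_iff.mp hv
      refine Module.End.mem_eigenspace_iff.mpr ?_
      change B (B (B v)) = μ • B v
      rw [hv', map_smul]
  have hBB : ∀ v, B (B v) = μ • v := fun v =>
    Module.End.mem_eigenspace_iff.mp (hE ▸ Submodule.mem_top : v ∈ Module.End.eigenspace (B * B) μ)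
  obtain ⟨l, hl⟩ := Module.End.exists_eigenvalue A
  obtain ⟨v, hv⟩ := hl.exists_hasEigenvector
  have hAv : A v = l • v := hv.apply_eq_smul
  have hv0 : v ≠ 0 := hv.2
  have hBv0 : B v ≠ 0 := fun h => hv0 (hB (by rw [h, map_zero]))
  have hABv : A (B v) = (-l) • B v := by rw [anti, hAv, map_smul, neg_smul]
  have hl0 : l ≠ 0 := by
    rintro rfl
    exact hv0 (hA (by rw [hAv, zero_smul, map_zero]))
  have hspan : Submodule.span ℂ (Set.range ![v, B v]) = ⊤ := by
    have hv_mem : v ∈ Submodule.span ℂ (Set.range ![v, B v]) := Submodule.subset_span ⟨0, rfl⟩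
    have hBv_mem : B v ∈ Submodule.span ℂ (Set.range ![v, B v]) :=
      Submodule.subset_span ⟨1, rfl⟩
    refine (hirr _ ?_ ?_).resolve_left fun h => hv0 ?_
    · rw [Submodule.map_span_le]
      rintro _ ⟨i, rfl⟩
      fin_cases i
      · simpa [hAv] using Submodule.smul_mem _ l hv_mem
      · simpa [hABv] using Submodule.smul_mem _ l hBv_mem
    · rw [Submodule.map_span_le]
      rintro _ ⟨i, rfl⟩
      fin_cases i
      · exact hBv_mem
      · simpa [hBB] using Submodule.smul_mem _ μ hv_mem
    · rw [h] at hv_mem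
      simpa using hv_mem
  have hind : LinearIndependent ℂ ![v, B v] := by
    rw [LinearIndependent.pair_iff]
    intro a b hab
    have h1 : A (a • v + b • B v) = 0 := by rw [hab, map_zero]
    rw [map_add, map_smul, map_smul, hAv, hABv] at h1
    have h2 : (2 * l * a) • v = 0 := by
      have : (2 * l * a) • v = l • (a • v + b • B v) + (a • l • v + b • (-l) • B v) := by
        module
      rw [this, hab, h1, smul_zero, add_zero]
    have ha : a = 0 := by
      have := (smul_eq_zero.mp h2).resolve_right hv0
      simpa [hl0] using this
    rw [ha, zero_smul, zero_add] at hab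
    exact ⟨ha, (smul_eq_zero.mp hab).resolve_right hBv0⟩
  have := Module.finrank_eq_card_basis (Module.Basis.mk hind hspan.ge)
  simpa using this

/-- The generators of `Cover n` as a sequence, extended by `1`. -/
def gen (n i : ℕ) : Cover n := if h : i < n - 1 then t n ⟨i, h⟩ else 1

theorem gen_of_lt {n i : ℕ} (h : i < n - 1) : gen n i = t n ⟨i, h⟩ := dif_pos h

theorem z_mul_self (n : ℕ) : z n * z n = 1 := by
  have h : (PresentedGroup.mk (rels n)) (zf n ^ 2) = 1 :=
    PresentedGroup.one_of_mem (Or.inl rfl)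
  rw [map_pow, pow_two] at h
  exact h

theorem t_mul_self {n : ℕ} (i : Fin (n - 1)) : t n i * t n i = z n := by
  have h : (PresentedGroup.mk (rels n)) (tf n i ^ 2 * (zf n)⁻¹) = 1 :=
    PresentedGroup.one_of_mem (Or.inr (Or.inl ⟨i, rfl⟩))
  rw [map_mul, map_inv, mul_inv_eq_one, map_pow, pow_two] at h
  exact h

theorem t_mul_t_pow_three {n : ℕ} {i j : Fin (n - 1)} (hij : (i : ℕ) + 1 = j) :
    (t n i * t n j) ^ 3 = z n := by
  have h : (PresentedGroup.mk (rels n)) ((tf n i * tf n j) ^ 3 * (zf n)⁻¹) = 1 :=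
    PresentedGroup.one_of_mem (Or.inr (Or.inr (Or.inl ⟨i, j, hij, rfl⟩)))
  rw [map_mul, map_inv, mul_inv_eq_one, map_pow, map_mul] at h
  exact h

theorem t_mul_t_pow_two {n : ℕ} {i j : Fin (n - 1)}
    (hij : (i : ℕ) + 2 ≤ j ∨ (j : ℕ) + 2 ≤ i) : (t n i * t n j) ^ 2 = z n := by
  have h : (PresentedGroup.mk (rels n)) ((tf n i * tf n j) ^ 2 * (zf n)⁻¹) = 1 :=
    PresentedGroup.one_of_mem (Or.inr (Or.inr (Or.inr ⟨i, j, hij, rfl⟩)))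
  rw [map_mul, map_inv, mul_inv_eq_one, map_pow, map_mul] at h
  exact h

theorem z_comm (n : ℕ) (g : Cover n) : z n * g = g * z n := by
  have hg : g ∈ Subgroup.closure (Set.range (PresentedGroup.of (rels := rels n))) := by
    rw [PresentedGroup.closure_range_of]; trivial
  have hle : Subgroup.closure (Set.range (PresentedGroup.of (rels := rels n))) ≤
      Subgroup.centralizer {z n} := by
    rw [Subgroup.closure_le]
    rintro _ ⟨_ | i, rfl⟩
    · exact Subgroup.mem_centralizer_singleton_iff.mpr rfl
    · refine Subgroup.mem_centralizer_singleton_iff.mpr ?_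
      change t n i * z n = z n * t n i
      rw [← t_mul_self i, mul_assoc]
  exact (Subgroup.mem_centralizer_singleton_iff.mp (hle hg)).symm

theorem spinRelations (n : ℕ) : SpinRelations (z n) (gen n) (n - 1) where
  z_sq := z_mul_self n
  z_comm := z_comm n
  s_sq i hi := by rw [gen_of_lt hi, t_mul_self]
  braid i hi := by
    rw [gen_of_lt hi, gen_of_lt (show i < n - 1 by omega)]
    set a := t n ⟨i, by omega⟩
    set b := t n ⟨i + 1, hi⟩
    have haa : a * a = z n := t_mul_self _
    have hbb : b * b = z n := t_mul_self _
    have h3 : (a * b) ^ 3 = z n := t_mul_t_pow_three rfl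
    have hzz := z_mul_self n
    have e : (a * b * a) * (b * a * b) = z n := by rw [← h3]; simp only [pow_succ, pow_zero]; group
    have e' : (b * a * b) * (b * a * b) = z n := by
      calc (b * a * b) * (b * a * b) = b * (a * (b * b) * a) * b := by group
        _ = b * (z n * (a * a)) * b := by rw [hbb, ← z_comm]; group
        _ = z n := by rw [haa, hzz, mul_one, hbb]
    exact mul_right_cancel (e'.trans e.symm)
  far i j hi hj hij := by
    rw [gen_of_lt hi, gen_of_lt hj]
    set a := t n ⟨i, hi⟩
    set b := t n ⟨j, hj⟩
    have haa : a * a = z n := t_mul_self _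
    have hbb : b * b = z n := t_mul_self _
    have h2 : (a * b) ^ 2 = z n := t_mul_t_pow_two hij
    have hzz := z_mul_self n
    have e : (a * b) * (a * b) = z n := by rw [← h2, pow_two]
    have e' : (z n * (b * a)) * (a * b) = z n := by
      calc (z n * (b * a)) * (a * b) = z n * (b * (a * a) * b) := by group
        _ = z n * (z n * (b * b)) := by rw [haa, ← z_comm]; group
        _ = z n := by rw [hbb, hzz, mul_one]
    exact mul_right_cancel (e.trans e'.symm)

theorem parabolic_eq_top (n : ℕ) : parabolic (z n) (gen n) (n - 1) = ⊤ := by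
  rw [eq_top_iff, ← PresentedGroup.closure_range_of, Subgroup.closure_le]
  rintro _ ⟨_ | i, rfl⟩
  · exact z_mem_parabolic _
  · have := s_mem_parabolic (z := z n) (s := gen n) i.2
    rwa [gen_of_lt i.2] at this

theorem mem_zpowers_z_of_map_eq_one {n : ℕ} (hn : 0 < n) {π : Cover n →* Equiv.Perm (Fin n)}
    (hπt : ∀ i : Fin (n - 1), π (t n i) = adj n i) (hπz : π (z n) = 1) {w : Cover n}
    (hw : π w = 1) : w ∈ Subgroup.zpowers (z n) := by
  refine mem_zpowers_of_apply_eq_one (pt := fun i => ⟨i % n, Nat.mod_lt _ hn⟩)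
    (spinRelations n) hπz ?_ ?_ (n - 1) le_rfl w (by rw [parabolic_eq_top]; trivial) hw
  · intro i hi
    rw [gen_of_lt hi, hπt, adj]
    congr 1 <;> ext <;> simp <;> rw [Nat.mod_eq_of_lt (by omega)]
  · intro i hi j hj h
    have hi' : i ≤ n - 1 := hi
    have hj' : j ≤ n - 1 := hj
    simpa [Nat.mod_eq_of_lt (show i < n by omega), Nat.mod_eq_of_lt (show j < n by omega)] using h

theorem map_ascProd_apply {n : ℕ} {π : Cover n →* Equiv.Perm (Fin n)}
    (hπt : ∀ i : Fin (n - 1), π (t n i) = adj n i) {a : ℕ} :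
    ∀ l, a + l < n → ∀ x : Fin n, ((π (ascProd (gen n) a l) x : Fin n) : ℕ) =
      if a ≤ (x : ℕ) ∧ (x : ℕ) < a + l then (x : ℕ) + 1
      else if (x : ℕ) = a + l then a else (x : ℕ) := by
  intro l
  induction l with
  | zero =>
    intro _ x
    simp only [ascProd, map_one, Equiv.Perm.one_apply]
    split_ifs <;> omega
  | succ l ih =>
    intro h x
    rw [ascProd, map_mul, Equiv.Perm.mul_apply, ih (by omega), gen_of_lt (by omega), hπt, adj]
    have key : ((Equiv.swap (⟨a + l, by omega⟩ : Fin n) ⟨a + l + 1, by omega⟩ x : Fin n) : ℕ) =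
        if (x : ℕ) = a + l then a + l + 1 else if (x : ℕ) = a + l + 1 then a + l else x := by
      rw [Equiv.swap_apply_def]
      simp only [Fin.ext_iff]
      split_ifs <;> rfl
    simp only [key]
    split_ifs <;> omega

theorem comap_closure_le {G H : Type*} [Group G] [Group H] {f : G →* H} {ζ x y : G}
    (hker : ∀ w, f w = 1 → w ∈ Subgroup.zpowers ζ) :
    (Subgroup.closure {f x, f y}).comap f ≤ Subgroup.closure {ζ, x, y} := by
  intro g hg
  rw [Subgroup.mem_comap, ← Set.image_pair, ← MonoidHom.map_closure] at hg
  obtain ⟨k, hk, e⟩ := hg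
  have hle : Subgroup.zpowers ζ ≤ Subgroup.closure {ζ, x, y} := by
    rw [Subgroup.zpowers_le]
    exact Subgroup.subset_closure (by simp)
  have hk' : k ∈ Subgroup.closure {ζ, x, y} :=
    Subgroup.closure_mono (Set.subset_insert _ _) hk
  have : k⁻¹ * g ∈ Subgroup.zpowers ζ := hker _ (by rw [map_mul, map_inv, e, inv_mul_cancel])
  simpa using mul_mem hk' (hle this)

/-- The elements of a group acting linearly that preserve a given submodule. -/
def submoduleStabilizer {G V : Type*} [Group G] [AddCommGroup V] [Module ℂ V]
    (ρ : G →* Module.End ℂ V) (U : Submodule ℂ V) : Subgroup G where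
  carrier := {g | U.map (ρ g) = U}
  one_mem' := by
    change U.map (ρ 1) = U
    rw [map_one]; exact Submodule.map_id U
  mul_mem' {a b} ha hb := by
    change U.map (ρ (a * b)) = U
    rw [map_mul, Module.End.mul_eq_comp, Submodule.map_comp, show U.map (ρ b) = U from hb]
    exact ha
  inv_mem' {a} ha := by
    change U.map (ρ a⁻¹) = U
    conv_lhs => rw [← show U.map (ρ a) = U from ha]
    rw [← Submodule.map_comp, ← Module.End.mul_eq_comp, ← map_mul, inv_mul_cancel, map_one]
    exact Submodule.map_id U

theorem injective_of_group {G V : Type*} [Group G] [AddCommGroup V] [Module ℂ V]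
    (ρ : G →* Module.End ℂ V) (g : G) : Function.Injective (ρ g) := by
  refine Function.LeftInverse.injective (g := ρ g⁻¹) fun v => ?_
  rw [← Module.End.mul_apply, ← map_mul, inv_mul_cancel, map_one, Module.End.one_apply]

theorem mem_submoduleStabilizer_of_map_le {G V : Type*} [Group G] [AddCommGroup V] [Module ℂ V]
    [FiniteDimensional ℂ V] {ρ : G →* Module.End ℂ V} {U : Submodule ℂ V} {g : G}
    (h : U.map (ρ g) ≤ U) : g ∈ submoduleStabilizer ρ U :=
  Submodule.eq_of_le_of_finrank_eq h
    (Submodule.equivMapOfInjective (ρ g) (injective_of_group ρ g) U).finrank_eq.symm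

end Schur

open Schur in
/-- Lemma: let `n = 2m` with `m` even, let `c₁, c₂ ∈ S_n` be the two disjoint `m`-cycles
`(1, …, m)` and `(m+1, …, 2m)` (0-indexed below), let `A = ⟨c₁, c₂⟩` and let
`G = π⁻¹(A) ≤ S̃_n`.  Then every irreducible spin representation of `G` (a
finite-dimensional irreducible complex representation with `ρ(z) = −Id`) has
dimension 2. -/
theorem schur_preimage_two_cycles_spin_rep_dim_two (n m : ℕ) (hm : Even m) (hm0 : 0 < m)
    (hn : n = 2 * m)
    (π : Cover n →* Equiv.Perm (Fin n))
    (hπt : ∀ i : Fin (n - 1), π (t n i) = adj n i)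
    (hπz : π (z n) = 1)
    (c₁ c₂ : Equiv.Perm (Fin n))
    (hc₁ : ∀ x : Fin n, ((c₁ x : Fin n) : ℕ) =
      if (x : ℕ) < m then ((x : ℕ) + 1) % m else (x : ℕ))
    (hc₂ : ∀ x : Fin n, ((c₂ x : Fin n) : ℕ) =
      if m ≤ (x : ℕ) then m + (((x : ℕ) - m + 1) % m) else (x : ℕ))
    (V : Type) [AddCommGroup V] [Module ℂ V] [FiniteDimensional ℂ V] [Nontrivial V]
    (ρ : (Subgroup.closure {c₁, c₂}).comap π →* Module.End ℂ V)
    (hirr : ∀ U : Submodule ℂ V,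
      (∀ h : (Subgroup.closure {c₁, c₂}).comap π, U.map (ρ h) ≤ U) → U = ⊥ ∨ U = ⊤)
    (hspin : ∀ x : (Subgroup.closure {c₁, c₂}).comap π, (x : Cover n) = z n → ρ x = -1) :
    Module.finrank ℂ V = 2 := by
  have hR := spinRelations n
  set x := ascProd (gen n) 0 (m - 1) with hx
  set y := ascProd (gen n) m (m - 1) with hy
  have hπx : π x = c₁ := by
    ext k
    rw [hx, map_ascProd_apply hπt _ (by omega), hc₁]
    by_cases hk : (k : ℕ) + 1 < m
    · rw [Nat.mod_eq_of_lt hk]; split_ifs <;> omega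
    · by_cases hk' : (k : ℕ) + 1 = m
      · rw [hk', Nat.mod_self]; split_ifs <;> omega
      · split_ifs <;> omega
  have hπy : π y = c₂ := by
    ext k
    have hkn := k.2
    rw [hy, map_ascProd_apply hπt _ (by omega), hc₂]
    by_cases hk : (k : ℕ) - m + 1 < m
    · rw [Nat.mod_eq_of_lt hk]; split_ifs <;> omega
    · rw [show (k : ℕ) - m + 1 = m by omega, Nat.mod_self]; split_ifs <;> omega
  have hxy : x * y = z n * (y * x) := by
    rw [hx, hy, ascProd_mul_ascProd hR (by omega) _ (by omega)]
    obtain ⟨r, hr⟩ : Odd ((m - 1) * (m - 1)) :=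
      (Nat.Even.sub_odd hm0 hm odd_one).mul (Nat.Even.sub_odd hm0 hm odd_one)
    rw [hr, pow_succ, pow_mul, pow_two, z_mul_self, one_pow, one_mul]
  have hxG : x ∈ (Subgroup.closure {c₁, c₂}).comap π := by
    rw [Subgroup.mem_comap, hπx]; exact Subgroup.subset_closure (by simp)
  have hyG : y ∈ (Subgroup.closure {c₁, c₂}).comap π := by
    rw [Subgroup.mem_comap, hπy]; exact Subgroup.subset_closure (by simp)
  have hzG : z n ∈ (Subgroup.closure {c₁, c₂}).comap π := by
    rw [Subgroup.mem_comap, hπz]; exact one_mem _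
  have hle : (Subgroup.closure {c₁, c₂}).comap π ≤ Subgroup.closure {z n, x, y} := by
    rw [← hπx, ← hπy]
    exact comap_closure_le fun w => mem_zpowers_z_of_map_eq_one (by omega) hπt hπz
  have hρz : ρ ⟨z n, hzG⟩ = -1 := hspin _ rfl
  refine finrank_eq_two_of_anticommute (ρ ⟨x, hxG⟩) (ρ ⟨y, hyG⟩)
    (injective_of_group ρ _) (injective_of_group ρ _) ?_ fun U hU₁ hU₂ => hirr U fun h => ?_
  · have e : (⟨x, hxG⟩ * ⟨y, hyG⟩ : (Subgroup.closure {c₁, c₂}).comap π) =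
        ⟨z n, hzG⟩ * (⟨y, hyG⟩ * ⟨x, hxG⟩) := Subtype.ext hxy
    rw [← map_mul, e, map_mul, map_mul, hρz, neg_one_mul]
  · have hgen : Subgroup.closure {z n, x, y} ≤ (submoduleStabilizer ρ U).map
        ((Subgroup.closure {c₁, c₂}).comap π).subtype := by
      rw [Subgroup.closure_le]
      rintro _ (rfl | rfl | rfl)
      · refine ⟨⟨z n, hzG⟩, mem_submoduleStabilizer_of_map_le ?_, rfl⟩
        rw [hρz]
        rintro _ ⟨v, hv, rfl⟩
        exact U.neg_mem hv
      · exact ⟨⟨_, hxG⟩, mem_submoduleStabilizer_of_map_le hU₁, rfl⟩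
      · exact ⟨⟨_, hyG⟩, mem_submoduleStabilizer_of_map_le hU₂, rfl⟩
    obtain ⟨g, hg, e⟩ := hgen (hle h.2)
    obtain rfl : g = h := Subtype.ext e
    exact le_of_eq hg
end
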